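/- Let d ≥ 1 and p₁ < 0 < p₀, let P satisfy hypothesis (H_{p₀,p₁}) with constants P₀, P₁ ≥ 0, and let Λ satisfy condition (C_{σ₀,σ₁}) with σ₀ ≥ p₀ and σ₁ ≤ p₁. Let χ ∈ C_c^∞(ℝ^d) and let δ ∈ ℝ satisfy δ + σ₀/2 < 1/2 and δ + σ₁/2 < 1/2. Then there exist a constant C > 0 and a time t₀ ≥ 1 such that for every t with |t| > t₀ and every Schwartz function f on ℝ^d, ‖Op(a^{alt}_{χ,δ,Λ}(t)) f‖_{L²(ℝ^d)} ≤ C ‖f‖_{L²(ℝ^d)}, where a^{alt}_{χ,δ,Λ}(t,x,ξ) = χ((x + t P'(ξ))/(|t|^{1/2+δ} Λ(|t|^{1/2} ξ))) · 1_{|x| > |t|·|P'(ξ)|}. -/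

import Mathlib

open MeasureTheory Filter Topology
open scoped RealInnerProductSpace ENNReal

noncomputable section

abbrev Euc (d : ℕ) := EuclideanSpace ℝ (Fin d)

/-- Fourier transform `f̂(ξ) = ∫ e^{-i x·ξ} f(x) dx`. -/
def FT {d : ℕ} (f : Euc d → ℂ) (ξ : Euc d) : ℂ :=
  ∫ x : Euc d, Complex.exp (-(Complex.I * ((⟪x, ξ⟫ : ℝ) : ℂ))) * f x

/-- The radial vector field `P'(ξ) = P'(|ξ|) · ξ/|ξ|`. -/
def Pgrad {d : ℕ} (P : ℝ → ℝ) (ξ : Euc d) : Euc d :=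
  (deriv P ‖ξ‖ / ‖ξ‖) • ξ

/-- Hypothesis (H_{p₀,p₁}) with constants P₀, P₁. -/
def HypH (p₀ p₁ P₀ P₁ : ℝ) (P : ℝ → ℝ) : Prop :=
  ContDiffOn ℝ (⊤ : ℕ∞) P (Set.Ioi 0) ∧
  (∀ ρ > (0:ℝ), 0 < deriv P ρ) ∧
  (MonotoneOn (deriv P) (Set.Ioi 0) ∨ AntitoneOn (deriv P) (Set.Ioi 0)) ∧
  (∃ c C ρ₀ : ℝ, 0 < c ∧ c < C ∧ 0 < ρ₀ ∧ ∀ ρ : ℝ, 0 < ρ → ρ < ρ₀ →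
      (c * ρ ^ p₀ ≤ |deriv P ρ - P₀| ∧ |deriv P ρ - P₀| ≤ C * ρ ^ p₀) ∧
      (c * ρ ^ (p₀ - 1) ≤ |deriv (deriv P) ρ| ∧ |deriv (deriv P) ρ| ≤ C * ρ ^ (p₀ - 1))) ∧
  (∃ c C R : ℝ, 0 < c ∧ c < C ∧ ∀ ρ : ℝ, R < ρ →
      (c * ρ ^ p₁ ≤ |deriv P ρ - P₁| ∧ |deriv P ρ - P₁| ≤ C * ρ ^ p₁) ∧
      (c * ρ ^ (p₁ - 1) ≤ |deriv (deriv P) ρ| ∧ |deriv (deriv P) ρ| ≤ C * ρ ^ (p₁ - 1))) ∧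
  (∀ j : ℕ, 3 ≤ j → ∃ C : ℝ,
      (∀ ρ : ℝ, 0 < ρ → ρ < 1 → |iteratedDeriv j P ρ| ≤ C * ρ ^ (p₀ + 1 - (j : ℝ))) ∧
      (∀ ρ : ℝ, 1 < ρ → |iteratedDeriv j P ρ| ≤ C * ρ ^ (p₁ + 1 - (j : ℝ))))

/-- The truncation symbol `a_{χ,δ}(t,x,ξ)
    `= χ((x+tP'(ξ))/|t|^{1/2+δ}) · 1_{|x| > |t|·|P'(ξ)|}`. -/
def symbA {d : ℕ} (P : ℝ → ℝ) (χ : Euc d → ℝ) (δ t : ℝ) (x ξ : Euc d) : ℂ :=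
  ((χ ((|t| ^ ((1:ℝ)/2 + δ))⁻¹ • (x + t • Pgrad P ξ)) : ℝ) : ℂ) *
    (if |t| * ‖Pgrad P ξ‖ < ‖x‖ then (1:ℂ) else 0)

/-- `Op(a) (e^{itP(D)} f)` for a Schwartz function `f`:
    `(2π)^{-d} ∫ e^{i(x·ξ + tP(ξ))} a(x,ξ) f̂(ξ) dξ`. -/
def combOp {d : ℕ} (P : ℝ → ℝ) (a : Euc d → Euc d → ℂ) (t : ℝ)
    (f : Euc d → ℂ) (x : Euc d) : ℂ :=
  (((2 * Real.pi) ^ d : ℝ) : ℂ)⁻¹ *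
    ∫ ξ : Euc d,
      Complex.exp (Complex.I * ((⟪x, ξ⟫ + t * P ‖ξ‖ : ℝ) : ℂ)) * a x ξ * FT f ξ


/-- Condition (C_{σ₀,σ₁}) with limit constant `λ₁` on the weight `Λ`. -/
def CondC (σ₀ σ₁ lam₁ : ℝ) (Λ : ℝ → ℝ) : Prop :=
  ContDiffOn ℝ (⊤ : ℕ∞) Λ (Set.Ioi 0) ∧
  (∀ ρ > (0:ℝ), 0 < Λ ρ) ∧
  (∃ c C ρ₀ : ℝ, 0 < c ∧ c < C ∧ 0 < ρ₀ ∧ ∀ ρ : ℝ, 0 < ρ → ρ < ρ₀ →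
      c * ρ ^ σ₀ ≤ Λ ρ ∧ Λ ρ ≤ C * ρ ^ σ₀) ∧
  (∃ c C R : ℝ, 0 < c ∧ c < C ∧ ∀ ρ : ℝ, R < ρ →
      c * ρ ^ σ₁ ≤ Λ ρ ∧ Λ ρ ≤ C * ρ ^ σ₁) ∧
  (∀ j : ℕ, 1 ≤ j → ∃ C : ℝ,
      (∀ ρ : ℝ, 0 < ρ → ρ < 1 → |iteratedDeriv j Λ ρ| ≤ C * ρ ^ (σ₀ - (j : ℝ))) ∧
      (∀ ρ : ℝ, 1 < ρ → |iteratedDeriv j Λ ρ| ≤ C * ρ ^ (σ₁ - (j : ℝ)))) ∧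
  Tendsto (fun ρ : ℝ => Λ ρ / ρ ^ σ₁) atTop (𝓝 lam₁)

/-- The pseudo-differential operator `Op(a)` on a Schwartz function:
`Op(a)f(x) = (2π)^{-d} ∫ e^{i x·ξ} a(x,ξ) f̂(ξ) dξ`. -/
def OpS {d : ℕ} (a : Euc d → Euc d → ℂ) (f : Euc d → ℂ) (x : Euc d) : ℂ :=
  (((2 * Real.pi) ^ d : ℝ) : ℂ)⁻¹ *
    ∫ ξ : Euc d, Complex.exp (Complex.I * ((⟪x, ξ⟫ : ℝ) : ℂ)) * a x ξ * FT f ξ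

open scoped FourierTransform ContDiff in
theorem plA {d : ℕ} (F : Euc d → ℂ) (h1 : Integrable F) (h2 : MemLp F 2) :
    eLpNorm (𝓕 F) 2 volume = eLpNorm F 2 volume := by
  set f : Lp ℂ 2 (volume : Measure (Euc d)) := h2.toLp F with hf
  set g : Lp ℂ 2 (volume : Measure (Euc d)) := 𝓕 f with hg
  have hF : (f : Euc d → ℂ) =ᵐ[volume] F := MemLp.coeFn_toLp h2
  have hn : eLpNorm (g : Euc d → ℂ) 2 volume = eLpNorm (f : Euc d → ℂ) 2 volume := by
    have := MeasureTheory.Lp.norm_fourier_eq f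
    rw [Lp.norm_def, Lp.norm_def] at this
    exact (ENNReal.toReal_eq_toReal_iff' (Lp.eLpNorm_ne_top _) (Lp.eLpNorm_ne_top _)).1 this
  rw [← eLpNorm_congr_ae hF, ← hn]
  apply eLpNorm_congr_ae
  have hcont : Continuous (𝓕 F) := by
    exact VectorFourier.fourierIntegral_continuous Real.continuous_fourierChar (L := innerₗ (Euc d)) (by exact continuous_inner) h1
  refine ae_eq_of_integral_contDiff_smul_eq hcont.locallyIntegrable
    ((Lp.memLp g).locallyIntegrable (by norm_num)) ?_
  intro φ hφ hc
  have hc' : HasCompactSupport (fun x => (φ x : ℂ)) := hc.comp_left (g := fun r : ℝ => (r:ℂ)) (by simp)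
  have hs' : ContDiff ℝ ∞ (fun x => (φ x : ℂ)) := Complex.ofRealCLM.contDiff.comp hφ
  set Φ : SchwartzMap (Euc d) ℂ := hc'.toSchwartzMap hs' with hΦ
  have hΦa : ∀ x, Φ x = (φ x : ℂ) := fun x => rfl
  have key : ∫ x, Φ x • g x = ∫ x, (𝓕 Φ) x • f x := by
    have := MeasureTheory.Lp.fourier_toTemperedDistribution_eq f
    have h := congrArg (fun T => T Φ) this
    simp only [TemperedDistribution.fourier_apply, Lp.toTemperedDistribution_apply] at h
    exact h.symm
  have key2 : ∫ x, (𝓕 F) x • Φ x = ∫ x, F x • (𝓕 (Φ : Euc d → ℂ)) x := by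
    have := VectorFourier.integral_fourierIntegral_smul_eq_flip (L := innerₗ (Euc d)) (μ := volume) (ν := volume)
      Real.continuous_fourierChar (by exact continuous_inner) h1 Φ.integrable
    simpa using! this
  have e1 : ∀ x, φ x • (𝓕 F) x = (𝓕 F) x • Φ x := fun x => by
    rw [hΦa, smul_eq_mul, mul_comm, Complex.real_smul]
  have e2 : ∀ x, φ x • g x = Φ x • g x := fun x => by
    rw [hΦa, smul_eq_mul, Complex.real_smul]
  simp_rw [e1, e2]
  rw [key, key2]
  apply integral_congr_ae
  filter_upwards [hF] with x hx
  rw [hx, SchwartzMap.fourier_coe, smul_eq_mul, smul_eq_mul, mul_comm]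

/-- The unnormalised inverse Fourier transform. -/
def UU {d : ℕ} (F : Euc d → ℂ) (y : Euc d) : ℂ :=
  ∫ ξ : Euc d, Complex.exp (Complex.I * ((⟪y, ξ⟫ : ℝ) : ℂ)) * F ξ

/-- Square of the `L²` norm. -/
def n2 {α : Type*} [MeasureSpace α] (G : α → ℂ) : ℝ≥0∞ := ∫⁻ y, ‖G y‖ₑ ^ 2

theorem n2_eq {α : Type*} [MeasureSpace α] (G : α → ℂ) :
    n2 G = eLpNorm G 2 volume ^ 2 := by
  rw [n2, eLpNorm_eq_lintegral_rpow_enorm_toReal (by norm_num) (by norm_num), ← ENNReal.rpow_natCast, ← ENNReal.rpow_mul]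
  simp

open scoped FourierTransform in
theorem UU_eq {d : ℕ} (F : Euc d → ℂ) (y : Euc d) :
    UU F y = 𝓕 F (-(2 * Real.pi)⁻¹ • y) := by
  rw [UU, Real.fourier_eq']
  congr 1; ext ξ
  rw [smul_eq_mul, inner_smul_right, real_inner_comm]
  congr 2
  push_cast
  have : (Real.pi : ℂ) ≠ 0 := by exact_mod_cast Real.pi_ne_zero
  field_simp

/-- bounded measurable functions with bounded support -/
def BB {d : ℕ} (F : Euc d → ℂ) : Prop :=
  Measurable F ∧ ∃ M R : ℝ, ∀ ξ, ‖F ξ‖ ≤ M ∧ (R < ‖ξ‖ → F ξ = 0)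

theorem BB.memLp {d : ℕ} {F : Euc d → ℂ} (h : BB F) (p : ℝ≥0∞) : MemLp F p := by
  obtain ⟨hm, M, R, hMR⟩ := h
  have : F = (Metric.closedBall (0 : Euc d) R).indicator F := by
    ext ξ
    by_cases hx : ξ ∈ Metric.closedBall (0 : Euc d) R
    · rw [Set.indicator_of_mem hx]
    · rw [Set.indicator_of_notMem hx]
      apply (hMR ξ).2
      simpa using hx
  rw [this, memLp_indicator_iff_restrict measurableSet_closedBall]
  have : IsFiniteMeasure ((volume : Measure (Euc d)).restrict (Metric.closedBall 0 R)) :=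
    ⟨by simpa using measure_closedBall_lt_top⟩
  exact MemLp.of_bound hm.aestronglyMeasurable M (ae_of_all _ fun x => (hMR x).1)

theorem BB.integrable {d : ℕ} {F : Euc d → ℂ} (h : BB F) : Integrable F :=
  memLp_one_iff_integrable.1 (h.memLp 1)

theorem lint_smul {d : ℕ} (f : Euc d → ℝ≥0∞) {c : ℝ} (hc : c ≠ 0) :
    ∫⁻ x, f (c • x) = ENNReal.ofReal (|c ^ d|⁻¹) * ∫⁻ x, f x := by
  have h := Measure.map_addHaar_smul (volume : Measure (Euc d)) hc
  have e := (Homeomorph.smulOfNeZero c hc (α := Euc d)).toMeasurableEquiv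
  have h2 : ∫⁻ x, f x ∂(Measure.map (c • ·) (volume : Measure (Euc d))) = ∫⁻ x, f (c • x) :=
    lintegral_map_equiv f (Homeomorph.smulOfNeZero c hc (α := Euc d)).toMeasurableEquiv
  rw [← h2, h, lintegral_smul_measure]
  simp [abs_inv]

theorem UU_planch' {d : ℕ} {F : Euc d → ℂ} (h1 : Integrable F) (h2 : MemLp F 2) :
    n2 (UU F) = ENNReal.ofReal ((2 * Real.pi) ^ d) * n2 F := by
  have h0 := congrArg (fun x => x ^ 2) (plA F h1 h2)
  simp only [← n2_eq] at h0
  rw [← h0]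
  unfold n2
  simp_rw [UU_eq]
  have hpi := Real.pi_pos
  rw [lint_smul (fun x => ‖FourierTransform.fourier F x‖ₑ ^ 2) (c := -(2 * Real.pi)⁻¹) (by simp [hpi.ne'])]
  congr 2
  rw [abs_pow, abs_neg, abs_inv, abs_of_pos (by positivity : 0 < 2 * Real.pi), inv_pow, inv_inv]

theorem UU_planch {d : ℕ} {F : Euc d → ℂ} (h : BB F) :
    n2 (UU F) = ENNReal.ofReal ((2 * Real.pi) ^ d) * n2 F :=
  UU_planch' h.integrable (h.memLp 2)

theorem UU_conv {d : ℕ} {F G : Euc d → ℂ} (hF : Integrable F) (hG : Integrable G) (y : Euc d) :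
    UU (fun x => ∫ z, F z * G (x - z)) y = UU F y * UU G y := by
  simp only [UU_eq]
  exact Real.fourier_mul_convolution_eq hF hG _

theorem UU_cont {d : ℕ} {F : Euc d → ℂ} (hF : Integrable F) : Continuous (UU F) := by
  have : UU F = fun y => FourierTransform.fourier F (-(2 * Real.pi)⁻¹ • y) := by
    ext y; exact UU_eq F y
  rw [this]
  have hcont : Continuous (FourierTransform.fourier F) :=
    VectorFourier.fourierIntegral_continuous Real.continuous_fourierChar
      (L := innerₗ (Euc d)) (by exact continuous_inner) hF
  fun_prop

/-- infinitesimal rotation -/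
def rotX {d : ℕ} (e τ y : Euc d) : Euc d := ⟪e, y⟫ • τ - ⟪τ, y⟫ • e

def rotR {d : ℕ} (e τ : Euc d) (α : ℝ) : Euc d →ₗ[ℝ] Euc d where
  toFun y := y + (Real.cos α - 1) • (⟪e, y⟫ • e + ⟪τ, y⟫ • τ) + Real.sin α • (⟪e, y⟫ • τ - ⟪τ, y⟫ • e)
  map_add' x y := by
    simp only [inner_add_right]; module
  map_smul' c y := by
    simp only [inner_smul_right, RingHom.id_apply]; module

theorem rotR_norm {d : ℕ} {e τ : Euc d} (he : ‖e‖ = 1) (hτ : ‖τ‖ = 1) (ho : ⟪e, τ⟫ = 0) (α : ℝ)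
    (y : Euc d) : ‖rotR e τ α y‖ = ‖y‖ := by
  have h1 : rotR e τ α y = y + (((Real.cos α - 1) * ⟪e, y⟫ - Real.sin α * ⟪τ, y⟫) • e +
      ((Real.cos α - 1) * ⟪τ, y⟫ + Real.sin α * ⟪e, y⟫) • τ) := by
    simp only [rotR, LinearMap.coe_mk, AddHom.coe_mk]; module
  have h2 : ‖rotR e τ α y‖ ^ 2 = ‖y‖ ^ 2 := by
    rw [h1, @norm_add_sq_real, @norm_add_sq_real, inner_add_right, inner_smul_right, inner_smul_right,
      inner_smul_left, inner_smul_right, ho, norm_smul, norm_smul, he, hτ, real_inner_comm e y,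
      real_inner_comm τ y]
    simp only [mul_one, Real.norm_eq_abs, sq_abs, mul_zero]
    have := Real.sin_sq_add_cos_sq α
    linear_combination (⟪e, y⟫ ^ 2 + ⟪τ, y⟫ ^ 2) * this
  exact (sq_eq_sq₀ (norm_nonneg _) (norm_nonneg _)).1 h2

theorem rotR_int {d : ℕ} {e τ : Euc d} (he : ‖e‖ = 1) (hτ : ‖τ‖ = 1) (ho : ⟪e, τ⟫ = 0) (α : ℝ)
    (G : Euc d → ℂ) (w : ℝ → ℂ) :
    ∫ y, w ‖y‖ * G (rotR e τ α y) = ∫ y, w ‖y‖ * G y := by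
  let R : Euc d →ₗᵢ[ℝ] Euc d := ⟨rotR e τ α, rotR_norm he hτ ho α⟩
  have := (R.toLinearIsometryEquiv rfl).measurePreserving.integral_comp
    (R.toLinearIsometryEquiv rfl).toMeasurableEquiv.measurableEmbedding (fun y => w ‖y‖ * G y)
  rw [← this]
  congr 1; ext y
  have h1 : (R.toLinearIsometryEquiv rfl) y = rotR e τ α y := rfl
  rw [LinearIsometryEquiv.norm_map, h1]

theorem rotR_deriv {d : ℕ} (e τ y : Euc d) (α : ℝ) :
    HasDerivAt (fun α => rotR e τ α y) (-Real.sin α • (⟪e, y⟫ • e + ⟪τ, y⟫ • τ) +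
      Real.cos α • rotX e τ y) α := by
  have h1 : HasDerivAt (fun α => (Real.cos α - 1) • (⟪e, y⟫ • e + ⟪τ, y⟫ • τ))
      (-Real.sin α • (⟪e, y⟫ • e + ⟪τ, y⟫ • τ)) α :=
    ((Real.hasDerivAt_cos α).sub_const 1).smul_const _
  have h2 := (Real.hasDerivAt_sin α).smul_const (⟪e, y⟫ • τ - ⟪τ, y⟫ • e)
  have := (h1.const_add y).add h2
  exact this

theorem rot_ibp {d : ℕ} {e τ : Euc d} (he : ‖e‖ = 1) (hτ : ‖τ‖ = 1) (ho : ⟪e, τ⟫ = 0)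
    {G : Euc d → ℂ} (hG : ContDiff ℝ 1 G) (hc : HasCompactSupport G) {w : ℝ → ℂ}
    (hw : Measurable w) {M : ℝ} (hM : ∀ r, ‖w r‖ ≤ M) :
    ∫ y, w ‖y‖ * fderiv ℝ G y (rotX e τ y) = 0 := by
  have hM0 : 0 ≤ M := (norm_nonneg _).trans (hM 0)
  obtain ⟨B, hB⟩ := (hG.continuous_fderiv (by norm_num)).bounded_above_of_compact_support (hc.fderiv ℝ)
  have hB0 : 0 ≤ B := (norm_nonneg _).trans (hB 0)
  obtain ⟨S, hS⟩ := hc.isBounded.subset_closedBall 0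
  have hsup : ∀ y, S < ‖y‖ → fderiv ℝ G y = 0 := by
    intro y hy
    by_contra h
    have h1 := hS ((support_fderiv_subset ℝ) h)
    simp at h1; linarith
  set F' : ℝ → Euc d → ℂ := fun α y => w ‖y‖ * fderiv ℝ G (rotR e τ α y)
    (-Real.sin α • (⟪e, y⟫ • e + ⟪τ, y⟫ • τ) + Real.cos α • rotX e τ y) with hF'
  have hwm : Measurable fun y : Euc d => w ‖y‖ := hw.comp measurable_norm
  have hrc : ∀ α, Continuous (rotR e τ α) := fun α => (rotR e τ α).continuous_of_finiteDimensional
  have hint : Integrable (fun y => w ‖y‖ * G y) := by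
    have := (hG.continuous.integrable_of_hasCompactSupport (μ := volume) hc).bdd_mul (c := M) (hwm.aestronglyMeasurable) (ae_of_all _ fun y => hM _)
    exact this
  have key := hasDerivAt_integral_of_dominated_loc_of_deriv_le (μ := (volume : Measure (Euc d)))
    (F := fun α y => w ‖y‖ * G (rotR e τ α y)) (F' := F') (x₀ := 0) (s := Set.univ)
    (bound := (Metric.closedBall (0 : Euc d) S).indicator (fun _ => M * (B * (4 * S)))) univ_mem
    (Eventually.of_forall fun α => (hwm.mul ((hG.continuous.comp (hrc α)).measurable)).aestronglyMeasurable)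
    (by
      have : ∀ y, rotR e τ 0 y = y := by intro y; simp [rotR]
      simpa [this] using hint)
    (by
      apply Measurable.aestronglyMeasurable
      apply hwm.mul
      have : Continuous fun y => fderiv ℝ G (rotR e τ 0 y)
        (-Real.sin 0 • (⟪e, y⟫ • e + ⟪τ, y⟫ • τ) + Real.cos 0 • rotX e τ y) := by
        apply ((hG.continuous_fderiv (by norm_num)).comp (hrc 0)).clm_apply
        unfold rotX
        fun_prop
      exact this.measurable)
    (by
      refine ae_of_all _ fun y α _ => ?_
      by_cases hy : y ∈ Metric.closedBall (0 : Euc d) S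
      · rw [Set.indicator_of_mem hy]
        have hy' : ‖y‖ ≤ S := by simpa using hy
        rw [hF']; simp only [norm_mul]
        have h1 : |⟪e, y⟫| ≤ S := (abs_real_inner_le_norm e y).trans (by rw [he]; linarith)
        have h2 : |⟪τ, y⟫| ≤ S := (abs_real_inner_le_norm τ y).trans (by rw [hτ]; linarith)
        have hS0 : 0 ≤ S := (norm_nonneg _).trans hy'
        refine mul_le_mul (hM _) ?_ (norm_nonneg _) hM0
        refine (ContinuousLinearMap.le_opNorm _ _).trans (mul_le_mul (hB _) ?_ (norm_nonneg _) hB0)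
        have ha : ‖⟪e, y⟫ • e + ⟪τ, y⟫ • τ‖ ≤ 2 * S := by
          refine (norm_add_le _ _).trans ?_
          rw [norm_smul, norm_smul, he, hτ, Real.norm_eq_abs, Real.norm_eq_abs]; linarith
        have hb : ‖rotX e τ y‖ ≤ 2 * S := by
          refine (norm_sub_le _ _).trans ?_
          rw [norm_smul, norm_smul, he, hτ, Real.norm_eq_abs, Real.norm_eq_abs]; linarith
        refine (norm_add_le _ _).trans ?_
        rw [norm_smul, norm_smul, norm_neg, Real.norm_eq_abs, Real.norm_eq_abs]
        nlinarith [Real.abs_sin_le_one α, Real.abs_cos_le_one α, norm_nonneg (rotX e τ y), norm_nonneg (⟪e, y⟫ • e + ⟪τ, y⟫ • τ)]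
      · have hy' : S < ‖rotR e τ α y‖ := by rw [rotR_norm he hτ ho]; simpa using hy
        rw [Set.indicator_of_notMem hy, hF']
        simp [hsup _ hy'])
    (by
      rw [integrable_indicator_iff measurableSet_closedBall]
      exact integrableOn_const (by exact measure_closedBall_lt_top.ne))
    (by
      refine ae_of_all _ fun y α _ => ?_
      exact (((hG.differentiable (by norm_num)) _).hasFDerivAt.comp_hasDerivAt α (rotR_deriv e τ y α)).const_mul _)
  have h2 := key.2
  simp_rw [rotR_int he hτ ho] at h2
  have h3 := h2.unique (hasDerivAt_const _ _)
  have : ∀ y, rotR e τ 0 y = y := by intro y; simp [rotR]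
  rw [hF'] at h3
  simpa [this] using h3

open scoped ContDiff in
theorem exists_inv_cut : ∃ g : ℝ → ℝ, ContDiff ℝ ∞ g ∧ ∀ x, 1/8 ≤ |x| → g x * x = 1 := by
  let h : ContDiffBump (0:ℝ) := ⟨1/16, 1/8, by norm_num, by norm_num⟩
  have hpos : ∀ x, x ^ 2 + h x ≠ 0 := by
    intro x
    have h0 := h.nonneg' x
    by_cases hx : x = 0
    · have : h x = 1 := h.one_of_mem_closedBall (by simp [hx, h])
      rw [this]; positivity
    · have : 0 < x ^ 2 := by positivity
      linarith
  refine ⟨fun x => x / (x ^ 2 + h x), contDiff_id.div ((contDiff_id.pow 2).add h.contDiff) hpos, ?_⟩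
  intro x hx
  have h1 : h x = 0 := h.zero_of_le_dist (by simpa [h] using hx)
  have h2 := hpos x
  rw [h1, add_zero] at h2
  have hx0 : x ≠ 0 := by rintro rfl; simp at h2
  change x / (x ^ 2 + h x) * x = 1
  rw [h1, add_zero]
  field_simp

open scoped ContDiff in
theorem nonstat {d : ℕ} {K : Set (Euc d)} (hK : IsCompact K) (N : ℕ) :
    ∀ b : (Euc d × Euc d × Euc d) × Euc d → ℂ, ContDiff ℝ ∞ b → (∀ p y, y ∉ K → b (p, y) = 0) →
    ∃ C : ℝ, 0 ≤ C ∧ ∀ e τ κ : Euc d, ‖e‖ = 1 → ‖τ‖ = 1 → ⟪e, τ⟫ = 0 → ‖κ‖ ≤ 1 →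
      (∀ y ∈ K, 1/8 ≤ |⟪e, y⟫|) → ∀ w : ℝ → ℂ, Measurable w → (∃ M, ∀ r, ‖w r‖ ≤ M) → ∀ m : ℝ, 0 < m →
      m ^ N * ‖∫ y, w ‖y‖ * (b ((e, τ, κ), y) * Complex.exp (Complex.I * ((m * ⟪τ, y⟫ : ℝ) : ℂ)))‖
        ≤ C * ∫ y in K, ‖w ‖y‖‖ := by
  induction N with
  | zero =>
    intro b hb hbK
    have hcpt : IsCompact (((Metric.closedBall (0 : Euc d) 1) ×ˢ (Metric.closedBall (0 : Euc d) 1 ×ˢ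
      Metric.closedBall (0 : Euc d) 1)) ×ˢ K) :=
      ((isCompact_closedBall _ _).prod ((isCompact_closedBall _ _).prod (isCompact_closedBall _ _))).prod hK
    obtain ⟨C, hC⟩ := hcpt.exists_bound_of_continuousOn hb.continuous.continuousOn
    refine ⟨|C|, abs_nonneg _, ?_⟩
    intro e τ κ he hτ ho hκ hy w hw hM m hm
    obtain ⟨M, hM⟩ := hM
    rw [pow_zero, one_mul]
    have h1 : ∫ y, w ‖y‖ * (b ((e, τ, κ), y) * Complex.exp (Complex.I * ((m * ⟪τ, y⟫ : ℝ) : ℂ))) =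
      ∫ y in K, w ‖y‖ * (b ((e, τ, κ), y) * Complex.exp (Complex.I * ((m * ⟪τ, y⟫ : ℝ) : ℂ))) := by
      rw [setIntegral_eq_integral_of_forall_compl_eq_zero]
      intro y hy; rw [hbK _ _ hy]; simp
    rw [h1, ← integral_const_mul]
    have hwm : Measurable fun y : Euc d => w ‖y‖ := hw.comp measurable_norm
    refine norm_integral_le_of_norm_le ?_ ?_
    · apply Integrable.const_mul
      have : IsFiniteMeasure ((volume : Measure (Euc d)).restrict K) := ⟨by simpa using hK.measure_lt_top⟩
      exact Integrable.of_bound hwm.norm.aestronglyMeasurable M (ae_of_all _ fun y => by simpa using hM _)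
    · refine (ae_restrict_iff' hK.measurableSet).2 (ae_of_all _ fun y hy => ?_)
      rw [norm_mul, norm_mul, mul_comm Complex.I, Complex.norm_exp_ofReal_mul_I, mul_one, mul_comm]
      refine mul_le_mul_of_nonneg_right ((hC _ ?_).trans (le_abs_self _)) (norm_nonneg _)
      simp [he, hτ, hκ, hy]
  | succ N ih =>
    intro b hb hbK
    obtain ⟨g, hg, hg1⟩ := exists_inv_cut
    set B : (Euc d × Euc d × Euc d) × Euc d → ℂ := fun q => b q * ((g ⟪q.1.1, q.2⟫ : ℝ) : ℂ) with hB
    have hBs : ContDiff ℝ ∞ B := by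
      refine hb.mul (Complex.ofRealCLM.contDiff.comp (hg.comp ?_))
      exact ContDiff.inner ℝ (contDiff_fst.comp contDiff_fst) contDiff_snd
    set b' : (Euc d × Euc d × Euc d) × Euc d → ℂ := fun q => fderiv ℝ B q (0, rotX q.1.1 q.1.2.1 q.2) with hb'
    have hb's : ContDiff ℝ ∞ b' := by
      refine ContDiff.clm_apply (hBs.fderiv_right (m := ∞) (by simp)) ?_
      refine contDiff_const.prodMk ?_
      unfold rotX
      refine ContDiff.sub (ContDiff.smul (ContDiff.inner ℝ ?_ ?_) ?_) (ContDiff.smul (ContDiff.inner ℝ ?_ ?_) ?_)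
      all_goals fun_prop
    have hBK : ∀ p y, y ∉ K → B (p, y) = 0 := by
      intro p y hy; rw [hB]; simp [hbK p y hy]
    have hder : ∀ p y, HasFDerivAt (fun z => B (p, z)) ((fderiv ℝ B (p, y)).comp (ContinuousLinearMap.inr ℝ _ _)) y := by
      intro p y
      have h1 := ((hBs.differentiable (by simp)) (p, y)).hasFDerivAt
      exact h1.comp y (hasFDerivAt_prodMk_right p y)
    have hb'K : ∀ p y, y ∉ K → b' (p, y) = 0 := by
      intro p y hy
      have h1 : (fun z => B (p, z)) =ᶠ[𝓝 y] fun _ => 0 := by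
        filter_upwards [hK.isClosed.isOpen_compl.mem_nhds hy] with z hz using hBK p z hz
      have h2 := ((hder p y).congr_of_eventuallyEq h1.symm).unique (hasFDerivAt_const (0:ℂ) y)
      have h3 := congrArg (fun T => T (rotX p.1 p.2.1 y)) h2
      simpa using h3
    obtain ⟨C, hC0, hC⟩ := ih b' hb's hb'K
    refine ⟨C, hC0, ?_⟩
    intro e τ κ he hτ ho hκ hy w hw hM m hm
    have hC' := hC e τ κ he hτ ho hκ hy w hw hM m hm
    obtain ⟨M, hM⟩ := hM
    set ex : Euc d → ℂ := fun y => Complex.exp (Complex.I * ((m * ⟪τ, y⟫ : ℝ) : ℂ)) with hex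
    have hexd : ∀ y, HasFDerivAt ex (ex y • (Complex.I * (m:ℂ)) • (Complex.ofRealCLM.comp (innerSL ℝ τ))) y := by
      intro y
      have h1 : HasFDerivAt (fun y : Euc d => ((⟪τ, y⟫ : ℝ) : ℂ)) (Complex.ofRealCLM.comp (innerSL ℝ τ)) y :=
        (Complex.ofRealCLM.comp (innerSL ℝ τ)).hasFDerivAt
      have h2 := (h1.const_mul (Complex.I * (m:ℂ))).cexp
      have h3 : ex = fun y : Euc d => Complex.exp (Complex.I * (m:ℂ) * ((⟪τ, y⟫ : ℝ) : ℂ)) := by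
        ext y; simp [hex, mul_assoc]
      rw [h3]; exact h2
    have hexs : ContDiff ℝ ∞ ex := by
      apply ContDiff.cexp
      refine contDiff_const.mul (Complex.ofRealCLM.contDiff.comp ?_)
      exact contDiff_const.mul (contDiff_const.inner ℝ contDiff_id)
    set G : Euc d → ℂ := fun y => B ((e, τ, κ), y) * ex y with hG
    have hGs : ContDiff ℝ ∞ G := (hBs.comp (contDiff_const.prodMk contDiff_id)).mul hexs
    have hGc : HasCompactSupport G := by
      refine HasCompactSupport.intro hK fun y hy => ?_
      rw [hG]; simp [hBK _ y hy]
    have hGd : ∀ y, fderiv ℝ G y (rotX e τ y) = b' ((e, τ, κ), y) * ex y +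
        Complex.I * m * (b ((e, τ, κ), y) * ex y) := by
      intro y
      have h1 := ((hder (e, τ, κ) y).mul (hexd y)).fderiv
      rw [show G = (fun z => B ((e, τ, κ), z)) * ex from rfl, h1]
      have h2 : ⟪τ, rotX e τ y⟫ = ⟪e, y⟫ := by
        rw [rotX, inner_sub_right, inner_smul_right, inner_smul_right, real_inner_self_eq_norm_sq, hτ, real_inner_comm e τ, ho]
        simp
      simp only [add_apply, smul_apply, smul_eq_mul,
        ContinuousLinearMap.comp_apply, innerSL_apply_apply, h2, Complex.ofRealCLM_apply, ContinuousLinearMap.inr_apply]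
      by_cases hyK : y ∈ K
      · have h3 : ((g ⟪e, y⟫ : ℝ) : ℂ) * ((⟪e, y⟫ : ℝ) : ℂ) = 1 := by
          exact_mod_cast hg1 _ (hy y hyK)
        simp only [hB, hb']
        linear_combination (b ((e, τ, κ), y) * ex y * Complex.I * m) * h3
      · simp [hBK _ y hyK, hbK _ y hyK, hb']
        ring
    have hib := rot_ibp he hτ ho (hGs.of_le (by simp)) hGc hw hM
    have hwm : Measurable fun y : Euc d => w ‖y‖ := hw.comp measurable_norm
    have hInt : ∀ c : (Euc d × Euc d × Euc d) × Euc d → ℂ, ContDiff ℝ ∞ c → (∀ p y, y ∉ K → c (p, y) = 0) →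
        Integrable (fun y => w ‖y‖ * (c ((e, τ, κ), y) * ex y)) := by
      intro c hc hcK
      have h1 : Continuous fun y => c ((e, τ, κ), y) * ex y :=
        (hc.continuous.comp (by fun_prop)).mul hexs.continuous
      have h2 : HasCompactSupport fun y => c ((e, τ, κ), y) * ex y := by
        refine HasCompactSupport.intro hK fun y hy => ?_
        simp [hcK _ y hy]
      exact (h1.integrable_of_hasCompactSupport (μ := volume) h2).bdd_mul (c := M) hwm.aestronglyMeasurable (ae_of_all _ fun y => hM _)
    have hsplit : (∫ y, w ‖y‖ * (b' ((e, τ, κ), y) * ex y)) + Complex.I * m * ∫ y, w ‖y‖ * (b ((e, τ, κ), y) * ex y) = 0 := by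
      rw [← hib, ← integral_const_mul, ← integral_add (hInt b' hb's hb'K) ((hInt b hb hbK).const_mul _)]
      congr 1; ext y
      rw [hGd]; ring
    have hn : m * ‖∫ y, w ‖y‖ * (b ((e, τ, κ), y) * ex y)‖ = ‖∫ y, w ‖y‖ * (b' ((e, τ, κ), y) * ex y)‖ := by
      rw [eq_neg_of_add_eq_zero_left hsplit, norm_neg, norm_mul, norm_mul]
      simp [abs_of_pos hm]
    rw [pow_succ, mul_assoc, hn]
    exact hC'

/-- geometry of the phase -/
theorem geomF1 {d : ℕ} {e0 ξ ξ' : Euc d} (he0 : ‖e0‖ = 1) {a : ℝ}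
    (h1 : 0.99 * ‖ξ‖ ≤ ⟪ξ, e0⟫) (h2 : 0.99 * ‖ξ'‖ ≤ ⟪ξ', e0⟫)
    (h3 : a ≤ ‖ξ‖) (h4 : ‖ξ‖ < a + 1) (h5 : a ≤ ‖ξ'‖) (h6 : ‖ξ'‖ < a + 1) (h7 : 2 ≤ ‖ξ' - ξ‖) :
    ∃ e τ κ : Euc d, ∃ m : ℝ, ‖e‖ = 1 ∧ ‖τ‖ = 1 ∧ ⟪e, τ⟫ = 0 ∧ ‖κ‖ ≤ 1 ∧ 0.99 ≤ ⟪e, e0⟫ ∧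
      (1 + ‖ξ' - ξ‖) / 4 ≤ m ∧ ξ' - ξ = κ + m • τ := by
  have hξ : 0 < ‖ξ‖ := by
    by_contra h
    have h8 := norm_sub_le ξ' ξ
    have := norm_nonneg ξ
    linarith
  have hξ' : 0 < ‖ξ'‖ := by
    by_contra h
    have h8 := norm_sub_le ξ' ξ
    have := norm_nonneg ξ'
    linarith
  set η : Euc d := (‖ξ‖ / ‖ξ'‖) • ξ' with hη
  have hηn : ‖η‖ = ‖ξ‖ := by
    rw [hη, norm_smul, Real.norm_of_nonneg (by positivity)]; field_simp
  have hκ : ‖ξ' - η‖ ≤ 1 := by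
    have : ξ' - η = (1 - ‖ξ‖ / ‖ξ'‖) • ξ' := by rw [hη]; module
    have h9 : ‖ξ' - η‖ = |‖ξ'‖ - ‖ξ‖| := by
      rw [this, norm_smul, Real.norm_eq_abs, ← abs_of_pos hξ', ← abs_mul, abs_of_pos hξ']
      congr 1; field_simp
    rw [h9, abs_le]; constructor <;> linarith
  have hD : ‖ξ' - ξ‖ ≤ 1 + ‖η - ξ‖ := by
    have : ξ' - ξ = (ξ' - η) + (η - ξ) := by abel
    rw [this]; exact (norm_add_le _ _).trans (by linarith)
  have hD0 : 0 < ‖η - ξ‖ := by linarith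
  have hηc : 0.99 * ‖ξ‖ ≤ ⟪η, e0⟫ := by
    rw [hη, inner_smul_left]
    have : 0.99 * ‖ξ‖ = ‖ξ‖ / ‖ξ'‖ * (0.99 * ‖ξ'‖) := by field_simp
    rw [this]
    exact mul_le_mul_of_nonneg_left h2 (by positivity)
  have hs : ⟪ξ + η, e0⟫ ≥ 0.99 * (2 * ‖ξ‖) := by rw [inner_add_left]; linarith
  have hsn : ‖ξ + η‖ ≤ 2 * ‖ξ‖ := (norm_add_le _ _).trans (by linarith)
  have hs0 : 0 < ‖ξ + η‖ := by
    have := real_inner_le_norm (ξ + η) e0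
    rw [he0] at this; linarith
  refine ⟨‖ξ + η‖⁻¹ • (ξ + η), ‖η - ξ‖⁻¹ • (η - ξ), ξ' - η, ‖η - ξ‖, ?_, ?_, ?_, hκ, ?_, ?_, ?_⟩
  · rw [norm_smul, norm_inv, norm_norm, inv_mul_cancel₀ hs0.ne']
  · rw [norm_smul, norm_inv, norm_norm, inv_mul_cancel₀ hD0.ne']
  · rw [inner_smul_left, inner_smul_right, inner_add_left, inner_sub_right, inner_sub_right,
      real_inner_self_eq_norm_sq, real_inner_self_eq_norm_sq, hηn, real_inner_comm ξ η]
    ring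
  · rw [inner_smul_left]
    simp only [conj_trivial]
    rw [inv_mul_eq_div, le_div_iff₀ hs0]; linarith
  · linarith
  · rw [smul_smul, mul_inv_cancel₀ hD0.ne']; module

open scoped ContDiff in
theorem kernF1 {d : ℕ} {e0 : Euc d} (he0 : ‖e0‖ = 1) {K : Set (Euc d)} (hK : IsCompact K)
    (hKe : ∀ y ∈ K, 1/4 ≤ ‖y‖ ∧ 0.8 * ‖y‖ ≤ |⟪y, e0⟫|) {A : Euc d → ℂ} (hA : ContDiff ℝ ∞ A)
    (hAK : ∀ y, y ∉ K → A y = 0) :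
    ∃ C : ℝ, 0 ≤ C ∧ ∀ (a : ℝ) (ξ ξ' : Euc d), 0.99 * ‖ξ‖ ≤ ⟪ξ, e0⟫ → 0.99 * ‖ξ'‖ ≤ ⟪ξ', e0⟫ →
      a ≤ ‖ξ‖ → ‖ξ‖ < a + 1 → a ≤ ‖ξ'‖ → ‖ξ'‖ < a + 1 →
      ∀ w : ℝ → ℂ, Measurable w → (∃ M, ∀ r, ‖w r‖ ≤ M) →
      ‖∫ y, w ‖y‖ * (A y * Complex.exp (Complex.I * ((⟪y, ξ' - ξ⟫ : ℝ) : ℂ)))‖ ≤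
        C * (1 + ‖ξ' - ξ‖) ^ (-((d:ℝ) + 1)) * ∫ y in K, ‖w ‖y‖‖ := by
  obtain ⟨C1, hC10, hC1⟩ := nonstat hK (d + 1)
    (fun q => A q.2 * Complex.exp (Complex.I * ((⟪q.2, q.1.2.2⟫ : ℝ) : ℂ))) (by
      refine (hA.comp contDiff_snd).mul (ContDiff.cexp (contDiff_const.mul (Complex.ofRealCLM.contDiff.comp ?_)))
      exact ContDiff.inner ℝ contDiff_snd (by fun_prop)) (fun p y hy => by simp [hAK y hy])
  obtain ⟨C2, hC2⟩ := hK.exists_bound_of_continuousOn hA.continuous.continuousOn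
  refine ⟨C1 * 4 ^ (d + 1) + |C2| * 3 ^ (d + 1), by positivity, ?_⟩
  intro a ξ ξ' h1 h2 h3 h4 h5 h6 w hw hM
  set S := ∫ y in K, ‖w ‖y‖‖ with hS
  have hS0 : 0 ≤ S := integral_nonneg fun y => norm_nonneg _
  set Δ := ‖ξ' - ξ‖ with hΔ
  have hΔ0 : 0 ≤ Δ := norm_nonneg _
  have hpow : (1 + Δ) ^ (-((d:ℝ) + 1)) = ((1 + Δ) ^ (d + 1))⁻¹ := by
    rw [Real.rpow_neg (by linarith), ← Real.rpow_natCast]; push_cast; rfl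
  rw [hpow]
  have hp : 0 < (1 + Δ) ^ (d + 1) := by positivity
  rcases le_or_gt 2 Δ with h7 | h7
  · obtain ⟨e, τ, κ, m, he, hτ, ho, hκ, hee, hm, hdec⟩ := geomF1 he0 h1 h2 h3 h4 h5 h6 h7
    have hm0 : 0 < m := by linarith
    have hy : ∀ y ∈ K, 1/8 ≤ |⟪e, y⟫| := by
      intro y hy
      obtain ⟨hy1, hy2⟩ := hKe y hy
      have h8 : ‖e0 - e‖ ≤ 0.2 := by
        have : ‖e0 - e‖ ^ 2 ≤ 0.2 ^ 2 := by
          rw [@norm_sub_sq_real, he0, he, real_inner_comm]; linarith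
        exact le_of_sq_le_sq this (by norm_num)
      have h9 : ⟪y, e0⟫ = ⟪e, y⟫ + ⟪y, e0 - e⟫ := by
        rw [inner_sub_right, real_inner_comm y e]; ring
      have h10 : |⟪y, e0 - e⟫| ≤ ‖y‖ * 0.2 := (abs_real_inner_le_norm _ _).trans
        (mul_le_mul_of_nonneg_left h8 (norm_nonneg _))
      have h11 := abs_add_le ⟪e, y⟫ ⟪y, e0 - e⟫
      rw [← h9] at h11
      linarith
    have := hC1 e τ κ he hτ ho hκ hy w hw hM m hm0
    have heq : ∀ y, A y * Complex.exp (Complex.I * ((⟪y, κ⟫ : ℝ) : ℂ)) * Complex.exp (Complex.I * ((m * ⟪τ, y⟫ : ℝ) : ℂ))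
       = A y * Complex.exp (Complex.I * ((⟪y, ξ' - ξ⟫ : ℝ) : ℂ)) := by
      intro y
      rw [mul_assoc, ← Complex.exp_add, hdec, inner_add_right, inner_smul_right, real_inner_comm y τ]
      push_cast; ring_nf
    simp only [heq] at this
    set I := ‖∫ y, w ‖y‖ * (A y * Complex.exp (Complex.I * ((⟪y, ξ' - ξ⟫ : ℝ) : ℂ)))‖ with hI
    have h12 : ((1 + Δ) / 4) ^ (d + 1) * I ≤ C1 * S :=
      (mul_le_mul_of_nonneg_right (pow_le_pow_left₀ (by positivity) hm _) (norm_nonneg _)).trans this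
    rw [div_pow, div_mul_eq_mul_div, div_le_iff₀ (by positivity)] at h12
    rw [mul_assoc, inv_mul_eq_div, mul_div_assoc', le_div_iff₀ hp]
    have : 0 ≤ |C2| * 3 ^ (d + 1) * S := by positivity
    nlinarith
  · obtain ⟨M, hM⟩ := hM
    have hwm : Measurable fun y : Euc d => w ‖y‖ := hw.comp measurable_norm
    have h8 : ‖∫ y, w ‖y‖ * (A y * Complex.exp (Complex.I * ((⟪y, ξ' - ξ⟫ : ℝ) : ℂ)))‖ ≤ |C2| * S := by
      have h1 : ∫ y, w ‖y‖ * (A y * Complex.exp (Complex.I * ((⟪y, ξ' - ξ⟫ : ℝ) : ℂ))) =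
        ∫ y in K, w ‖y‖ * (A y * Complex.exp (Complex.I * ((⟪y, ξ' - ξ⟫ : ℝ) : ℂ))) := by
        rw [setIntegral_eq_integral_of_forall_compl_eq_zero]
        intro y hy; rw [hAK _ hy]; simp
      rw [h1, hS, ← integral_const_mul]
      refine norm_integral_le_of_norm_le ?_ ?_
      · apply Integrable.const_mul
        have : IsFiniteMeasure ((volume : Measure (Euc d)).restrict K) := ⟨by simpa using hK.measure_lt_top⟩
        exact Integrable.of_bound hwm.norm.aestronglyMeasurable M (ae_of_all _ fun y => by simpa using hM _)
      · refine (ae_restrict_iff' hK.measurableSet).2 (ae_of_all _ fun y hy => ?_)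
        rw [norm_mul, norm_mul, mul_comm Complex.I, Complex.norm_exp_ofReal_mul_I, mul_one, mul_comm]
        exact mul_le_mul_of_nonneg_right ((hC2 _ hy).trans (le_abs_self _)) (norm_nonneg _)
    refine h8.trans ?_
    refine mul_le_mul_of_nonneg_right ?_ hS0
    rw [← div_eq_mul_inv, le_div_iff₀ hp]
    have h9 : (1 + Δ) ^ (d + 1) ≤ 3 ^ (d + 1) := pow_le_pow_left₀ (by linarith) (by linarith) _
    have : |C2| * (1 + Δ) ^ (d + 1) ≤ |C2| * 3 ^ (d + 1) := mul_le_mul_of_nonneg_left h9 (abs_nonneg _)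
    have : 0 ≤ C1 * 4 ^ (d + 1) := by positivity
    linarith

theorem n2_ofReal {d : ℕ} {H : Euc d → ℂ} (h : Integrable fun y => ‖H y‖ ^ 2) :
    n2 H = ENNReal.ofReal (∫ y, ‖H y‖ ^ 2) := by
  rw [ofReal_integral_eq_lintegral_ofReal h (ae_of_all _ fun y => by positivity), n2]
  congr 1; ext y
  rw [ENNReal.ofReal_pow (norm_nonneg _), ofReal_norm_eq_enorm]

theorem BB.sq_int {d : ℕ} {F : Euc d → ℂ} (h : BB F) : Integrable fun y => ‖F y‖ ^ 2 := by
  have := (h.memLp 2).integrable_norm_pow (by norm_num)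
  simpa using this

theorem schurF1 {d : ℕ} {F : Euc d → ℂ} (hF : BB F) :
    ∫ z : Euc d × Euc d, ‖F z.1‖ * ‖F z.2‖ * (1 + ‖z.2 - z.1‖) ^ (-((d:ℝ) + 1)) ≤
      (∫ x : Euc d, (1 + ‖x‖) ^ (-((d:ℝ) + 1))) * ∫ x, ‖F x‖ ^ 2 := by
  set k : Euc d → ℝ := fun x => (1 + ‖x‖) ^ (-((d:ℝ) + 1)) with hk
  have hk0 : ∀ x, 0 ≤ k x := fun x => by rw [hk]; positivity
  have hk1 : ∀ x, k x ≤ 1 := fun x => by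
    rw [hk]; exact Real.rpow_le_one_of_one_le_of_nonpos (by linarith [norm_nonneg x]) (by linarith [(Nat.cast_nonneg d : (0:ℝ) ≤ d)])
  have hki : Integrable k := by
    have := integrable_one_add_norm (E := Euc d) (μ := volume) (r := (d:ℝ) + 1) (by simp)
    exact this
  have hkm : Continuous k := by
    rw [hk]
    exact (continuous_const.add continuous_norm).rpow_const fun x => Or.inl (add_pos_of_pos_of_nonneg one_pos (norm_nonneg _)).ne'
  have hFm := hF.1
  have hsq := hF.sq_int
  have i1 : Integrable (fun z : Euc d × Euc d => ‖F z.1‖ ^ 2 * k (z.2 - z.1)) (volume.prod volume) := by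
    rw [integrable_prod_iff]
    · refine ⟨ae_of_all _ fun x => (show Integrable (fun y => ‖F x‖ ^ 2 * k (y - x)) from (hki.comp_sub_right x).const_mul _), ?_⟩
      have : (fun x => ∫ y, ‖‖F (x, y).1‖ ^ 2 * k ((x, y).2 - (x, y).1)‖) = fun x => ‖F x‖ ^ 2 * ∫ u, k u := by
        ext x
        simp only [norm_mul, norm_pow, norm_norm, Real.norm_of_nonneg (hk0 _)]
        rw [integral_const_mul, integral_sub_right_eq_self]
      rw [this]; exact hsq.mul_const _
    · apply Measurable.aestronglyMeasurable
      exact ((hFm.comp measurable_fst).norm.pow_const 2).mul (hkm.measurable.comp (measurable_snd.sub measurable_fst))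
  have i2 : Integrable (fun z : Euc d × Euc d => ‖F z.2‖ ^ 2 * k (z.2 - z.1)) (volume.prod volume) := by
    have := i1.swap
    refine this.congr (ae_of_all _ fun z => ?_)
    simp [hk, norm_sub_rev]
  have e1 : ∫ z : Euc d × Euc d, ‖F z.1‖ ^ 2 * k (z.2 - z.1) = (∫ x, k x) * ∫ x, ‖F x‖ ^ 2 := by
    rw [Measure.volume_eq_prod, integral_prod _ i1]
    simp only
    simp_rw [integral_const_mul, integral_sub_right_eq_self]
    rw [integral_mul_const, mul_comm]
  have e2 : ∫ z : Euc d × Euc d, ‖F z.2‖ ^ 2 * k (z.2 - z.1) = (∫ x, k x) * ∫ x, ‖F x‖ ^ 2 := by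
    rw [← e1, Measure.volume_eq_prod, ← integral_prod_swap]
    congr 1; ext z; simp [hk, norm_sub_rev]
  have : (∫ x, k x) * ∫ x, ‖F x‖ ^ 2 = ∫ z : Euc d × Euc d, (‖F z.1‖ ^ 2 * k (z.2 - z.1) + ‖F z.2‖ ^ 2 * k (z.2 - z.1)) / 2 := by
    have i1' : Integrable (fun z : Euc d × Euc d => ‖F z.1‖ ^ 2 * k (z.2 - z.1)) := i1
    have i2' : Integrable (fun z : Euc d × Euc d => ‖F z.2‖ ^ 2 * k (z.2 - z.1)) := i2
    rw [integral_div, integral_add i1' i2', e1, e2]; ring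
  rw [this]
  refine integral_mono_of_nonneg (ae_of_all _ fun z => ?_) ((i1.add i2).div_const 2) (ae_of_all _ fun z => ?_)
  · have := hk0 (z.2 - z.1)
    simp only [Pi.zero_apply]; positivity
  · have h0 := hk0 (z.2 - z.1)
    change ‖F z.1‖ * ‖F z.2‖ * k (z.2 - z.1) ≤ _
    have : 0 ≤ (‖F z.1‖ - ‖F z.2‖) ^ 2 * k (z.2 - z.1) := by positivity
    simp only
    nlinarith

open scoped ComplexConjugate in
theorem TTs {E : Type*} [MeasurableSpace E] (μ : Measure E) [SFinite μ] {ψ : E → ℂ} (hψ : Measurable ψ)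
    (hψi : Integrable (fun y => ‖ψ y‖ ^ 2) μ) {Q : E → E → ℂ} (hQ : Measurable (Function.uncurry Q)) {Fn : E → ℝ}
    (hFn : Integrable Fn μ) (hQn : ∀ y ξ, ‖Q y ξ‖ ≤ Fn ξ) :
    Integrable (fun y => ‖ψ y * ∫ ξ, Q y ξ ∂μ‖ ^ 2) μ ∧
    ∫ y, ‖ψ y * ∫ ξ, Q y ξ ∂μ‖ ^ 2 ∂μ =
      ‖∫ z, ∫ y, ((‖ψ y‖ ^ 2 : ℝ) : ℂ) * (conj (Q y z.1) * Q y z.2) ∂μ ∂(μ.prod μ)‖ := by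
  set Z : E → E × E → ℂ := fun y z => ((‖ψ y‖ ^ 2 : ℝ) : ℂ) * (conj (Q y z.1) * Q y z.2) with hZ
  have hsq : ∀ y, ((‖ψ y * ∫ ξ, Q y ξ ∂μ‖ ^ 2 : ℝ) : ℂ) = ∫ z, Z y z ∂(μ.prod μ) := by
    intro y
    rw [hZ]; simp only
    rw [integral_const_mul, integral_prod_mul (fun ξ => conj (Q y ξ)) (Q y), integral_conj,
      Complex.conj_mul', norm_mul, mul_pow]
    push_cast; rfl
  have hF0 : ∀ ξ, 0 ≤ Fn ξ := fun ξ => (norm_nonneg _).trans (hQn ξ ξ)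
  have hdom2 : Integrable (fun p : E × E => Fn p.1 * Fn p.2) (μ.prod μ) := hFn.mul_prod hFn
  have hdom : Integrable (fun p : E × E × E => ‖ψ p.1‖ ^ 2 * (Fn p.2.1 * Fn p.2.2)) (μ.prod (μ.prod μ)) :=
    hψi.mul_prod hdom2
  have hZi : Integrable (Function.uncurry Z) (μ.prod (μ.prod μ)) := by
    refine hdom.mono' ?_ (ae_of_all _ fun p => ?_)
    · apply Measurable.aestronglyMeasurable
      have h1 : Measurable fun p : E × E × E => Q p.1 p.2.1 :=
        hQ.comp (measurable_fst.prodMk (measurable_fst.comp measurable_snd))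
      have h2 : Measurable fun p : E × E × E => Q p.1 p.2.2 :=
        hQ.comp (measurable_fst.prodMk (measurable_snd.comp measurable_snd))
      have h3 : Measurable fun p : E × E × E => ((‖ψ p.1‖ ^ 2 : ℝ) : ℂ) :=
        Complex.continuous_ofReal.measurable.comp ((hψ.comp measurable_fst).norm.pow_const 2)
      exact h3.mul ((Complex.continuous_conj.measurable.comp h1).mul h2)
    · change ‖((‖ψ p.1‖ ^ 2 : ℝ) : ℂ) * (conj (Q p.1 p.2.1) * Q p.1 p.2.2)‖ ≤ _
      rw [norm_mul, norm_mul, RCLike.norm_conj, Complex.norm_real, Real.norm_of_nonneg (by positivity)]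
      exact mul_le_mul_of_nonneg_left (mul_le_mul (hQn _ _) (hQn _ _) (norm_nonneg _) (hF0 _)) (by positivity)
  constructor
  · have h1 := hZi.integral_prod_left
    have h2 : Integrable (fun y => ((‖ψ y * ∫ ξ, Q y ξ ∂μ‖ ^ 2 : ℝ) : ℂ)) μ := by
      simp_rw [hsq]; exact h1
    exact h2.re.congr (ae_of_all _ fun y => by simp only [RCLike.re_to_complex, Complex.ofReal_re])
  · have hmain : ((∫ y, ‖ψ y * ∫ ξ, Q y ξ ∂μ‖ ^ 2 ∂μ : ℝ) : ℂ) = ∫ z, ∫ y, Z y z ∂μ ∂(μ.prod μ) := by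
      rw [← integral_complex_ofReal]
      simp_rw [hsq]
      exact integral_integral_swap hZi
    have hnn : 0 ≤ ∫ y, ‖ψ y * ∫ ξ, Q y ξ ∂μ‖ ^ 2 ∂μ := integral_nonneg fun y => by positivity
    rw [← hmain, Complex.norm_real, Real.norm_of_nonneg hnn]

set_option maxHeartbeats 600000 in
open scoped ContDiff ComplexConjugate in
theorem F1 {d : ℕ} {e0 : Euc d} (he0 : ‖e0‖ = 1) {K : Set (Euc d)} (hK : IsCompact K)
    (hKe : ∀ y ∈ K, 1/4 ≤ ‖y‖ ∧ 0.8 * ‖y‖ ≤ |⟪y, e0⟫|) {ψ : Euc d → ℂ} (hψ : ContDiff ℝ ∞ ψ)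
    (hψK : ∀ y, y ∉ K → ψ y = 0) :
    ∃ C : ℝ, 0 ≤ C ∧ ∀ (a : ℝ) (F : Euc d → ℂ), BB F →
      (∀ ξ, F ξ ≠ 0 → 0.99 * ‖ξ‖ ≤ ⟪ξ, e0⟫ ∧ a ≤ ‖ξ‖ ∧ ‖ξ‖ < a + 1) →
      ∀ (κ : ℝ → ℝ → ℂ) (τ : ℝ → ℝ), Measurable (Function.uncurry κ) → Measurable τ →
      (∃ M, ∀ r, τ r ≤ M) → (∀ r ρ, ‖κ r ρ‖ ≤ τ r) →
      n2 (fun y => ψ y * ∫ ξ, Complex.exp (Complex.I * ((⟪y, ξ⟫ : ℝ) : ℂ)) * (κ ‖y‖ ‖ξ‖ * F ξ)) ≤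
        ENNReal.ofReal (C * ∫ y in K, τ ‖y‖ ^ 2) * n2 F := by
  set A : Euc d → ℂ := fun y => ((‖ψ y‖ ^ 2 : ℝ) : ℂ) with hA
  have hAs : ContDiff ℝ ∞ A := Complex.ofRealCLM.contDiff.comp (hψ.norm_sq ℝ)
  have hAK : ∀ y, y ∉ K → A y = 0 := fun y hy => by simp [hA, hψK y hy]
  obtain ⟨C, hC0, hC⟩ := kernF1 he0 hK hKe hAs hAK
  set k0 := (∫ x : Euc d, (1 + ‖x‖) ^ (-((d:ℝ) + 1))) with hk0
  have hk00 : 0 ≤ k0 := integral_nonneg fun x => by positivity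
  refine ⟨C * k0, mul_nonneg hC0 hk00, ?_⟩
  intro a F hF hFs κ τ hκm hτm ⟨M, hM⟩ hκ
  have hτ0 : ∀ r, 0 ≤ τ r := fun r => (norm_nonneg _).trans (hκ r 0)
  have hM0 : 0 ≤ M := (hτ0 0).trans (hM 0)
  set Q : Euc d → Euc d → ℂ := fun y ξ => Complex.exp (Complex.I * ((⟪y, ξ⟫ : ℝ) : ℂ)) * (κ ‖y‖ ‖ξ‖ * F ξ) with hQ
  have hFm := hF.1
  have hQm : Measurable (Function.uncurry Q) := by
    have h1 : Measurable fun z : Euc d × Euc d => κ ‖z.1‖ ‖z.2‖ :=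
      hκm.comp (measurable_fst.norm.prodMk measurable_snd.norm)
    have h2 : Measurable fun z : Euc d × Euc d => Complex.exp (Complex.I * ((⟪z.1, z.2⟫ : ℝ) : ℂ)) := by
      apply Continuous.measurable; fun_prop
    exact h2.mul (h1.mul (hFm.comp measurable_snd))
  have hQn : ∀ y ξ, ‖Q y ξ‖ ≤ M * ‖F ξ‖ := by
    intro y ξ
    rw [hQ]; simp only [norm_mul]
    rw [mul_comm Complex.I, Complex.norm_exp_ofReal_mul_I, one_mul]
    exact mul_le_mul_of_nonneg_right ((hκ _ _).trans (hM _)) (norm_nonneg _)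
  have hFi := hF.integrable
  have hQi : ∀ y, Integrable (Q y) := fun y =>
    (hFi.norm.const_mul M).mono' (hQm.comp measurable_prodMk_left).aestronglyMeasurable (ae_of_all _ (hQn y))
  have hψi : Integrable (fun y => ‖ψ y‖ ^ 2) := by
    refine Continuous.integrable_of_hasCompactSupport (by fun_prop) (HasCompactSupport.intro hK fun y hy => ?_)
    simp [hψK y hy]
  obtain ⟨hHi, hHe⟩ := TTs (volume : Measure (Euc d)) hψ.continuous.measurable hψi hQm (hFi.norm.const_mul M) hQn
  set S := ∫ y in K, τ ‖y‖ ^ 2 with hS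
  have hS0 : 0 ≤ S := integral_nonneg fun y => sq_nonneg _
  clear_value k0
  have hgoal : ENNReal.ofReal (C * k0 * S) * n2 F = ENNReal.ofReal (C * k0 * S * ∫ y, ‖F y‖ ^ 2) := by
    rw [n2_ofReal hF.sq_int, ENNReal.ofReal_mul (mul_nonneg (mul_nonneg hC0 hk00) hS0)]
  rw [hgoal]
  refine (le_of_eq (n2_ofReal hHi)).trans (ENNReal.ofReal_le_ofReal ((le_of_eq hHe).trans ?_))
  have hzb : ∀ z : Euc d × Euc d, ‖∫ y, A y * (conj (Q y z.1) * Q y z.2)‖ ≤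
      (C * S) * (‖F z.1‖ * ‖F z.2‖ * (1 + ‖z.2 - z.1‖) ^ (-((d:ℝ) + 1))) := by
    intro z
    have e1 : ∫ y, A y * (conj (Q y z.1) * Q y z.2) = (conj (F z.1) * F z.2) * ∫ y, (fun r => conj (κ r ‖z.1‖) * κ r ‖z.2‖) ‖y‖ *
        (A y * Complex.exp (Complex.I * ((⟪y, z.2 - z.1⟫ : ℝ) : ℂ))) := by
      rw [← integral_const_mul]
      congr 1; ext y
      rw [hQ]; simp only [map_mul]
      rw [← Complex.exp_conj, inner_sub_right]
      simp only [map_mul, Complex.conj_I, Complex.conj_ofReal]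
      have : Complex.exp (Complex.I * ((⟪y, z.2⟫ - ⟪y, z.1⟫ : ℝ) : ℂ)) = Complex.exp (-Complex.I * ((⟪y, z.1⟫ : ℝ) : ℂ)) *
          Complex.exp (Complex.I * ((⟪y, z.2⟫ : ℝ) : ℂ)) := by
        rw [← Complex.exp_add]; push_cast; ring_nf
      rw [this]; ring
    rw [e1, norm_mul, norm_mul, RCLike.norm_conj]
    by_cases hz : F z.1 = 0 ∨ F z.2 = 0
    · rcases hz with hz | hz <;> simp [hz]
    push Not at hz
    obtain ⟨a1, a2, a3⟩ := hFs _ hz.1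
    obtain ⟨b1, b2, b3⟩ := hFs _ hz.2
    have hwb : ∀ r, ‖(fun r => conj (κ r ‖z.1‖) * κ r ‖z.2‖) r‖ ≤ τ r ^ 2 := by
      intro r
      simp only [norm_mul, RCLike.norm_conj]
      rw [sq]; exact mul_le_mul (hκ _ _) (hκ _ _) (norm_nonneg _) (hτ0 _)
    have hm1 : ∀ ρ, Measurable fun r => κ r ρ := fun ρ => hκm.comp (measurable_id.prodMk measurable_const)
    have hwm : Measurable fun r => conj (κ r ‖z.1‖) * κ r ‖z.2‖ :=
      (Complex.continuous_conj.measurable.comp (hm1 _)).mul (hm1 _)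
    have h2 := hC a z.1 z.2 a1 b1 a2 a3 b2 b3 _ hwm ⟨M ^ 2, fun r => (hwb r).trans (pow_le_pow_left₀ (hτ0 r) (hM r) 2)⟩
    have : IsFiniteMeasure ((volume : Measure (Euc d)).restrict K) := ⟨by simpa using hK.measure_lt_top⟩
    have hτi : Integrable (fun y : Euc d => τ ‖y‖ ^ 2) (volume.restrict K) :=
      Integrable.of_bound ((hτm.comp measurable_norm).pow_const 2).aestronglyMeasurable (M ^ 2) (ae_of_all _ fun y => by
        rw [Real.norm_of_nonneg (by positivity)]; exact pow_le_pow_left₀ (hτ0 _) (hM _) 2)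
    have h3 : ∫ y in K, ‖(fun r => conj (κ r ‖z.1‖) * κ r ‖z.2‖) ‖y‖‖ ≤ S :=
      integral_mono_of_nonneg (ae_of_all _ fun y => norm_nonneg _) hτi (ae_of_all _ fun y => hwb _)
    have h4 := h2.trans (mul_le_mul_of_nonneg_left h3 (by positivity))
    refine (mul_le_mul_of_nonneg_left h4 (by positivity)).trans (le_of_eq (by ring))
  have hsch := schurF1 hF
  rw [← hk0] at hsch
  have hint : Integrable (fun z : Euc d × Euc d => (C * S) * (‖F z.1‖ * ‖F z.2‖ * (1 + ‖z.2 - z.1‖) ^ (-((d:ℝ) + 1))))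
      (volume.prod volume) := by
    apply Integrable.const_mul
    have h5 : Integrable (fun z : Euc d × Euc d => ‖F z.1‖ * ‖F z.2‖) (volume.prod volume) := hFi.norm.mul_prod hFi.norm
    refine h5.mono' ?_ (ae_of_all _ fun z => ?_)
    · apply Measurable.aestronglyMeasurable
      refine ((hFm.comp measurable_fst).norm.mul (hFm.comp measurable_snd).norm).mul ?_
      apply Continuous.measurable
      exact (continuous_const.add (continuous_snd.sub continuous_fst).norm).rpow_const fun x => Or.inl (add_pos_of_pos_of_nonneg one_pos (norm_nonneg _)).ne'
    · rw [Real.norm_of_nonneg (by positivity)]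
      refine mul_le_of_le_one_right (by positivity) ?_
      exact Real.rpow_le_one_of_one_le_of_nonpos (by linarith [norm_nonneg (z.2 - z.1)]) (by linarith [(Nat.cast_nonneg d : (0:ℝ) ≤ d)])
  refine (norm_integral_le_of_norm_le hint (ae_of_all _ hzb)).trans ?_
  rw [integral_const_mul]
  refine (mul_le_mul_of_nonneg_left hsch (mul_nonneg hC0 hS0)).trans (le_of_eq ?_)
  ring

open scoped FourierTransform ContDiff in
theorem exists_psi0 (d : ℕ) : ∃ (β ψ0 : Euc d → ℂ), Continuous β ∧ (∀ ζ, 1 ≤ ‖ζ‖ → β ζ = 0) ∧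
    (∃ M, ∀ ζ, ‖β ζ‖ ≤ M) ∧ ψ0 = UU β ∧ (∀ x y, ‖x‖ = ‖y‖ → ψ0 x = ψ0 y) ∧
    Integrable (fun x => (1 + ‖x‖) ^ 2 * ‖ψ0 x‖) ∧ Continuous ψ0 ∧ ∫ x, ψ0 x = 1 := by
  set b : Euc d → ℝ := fun ζ => Real.smoothTransition (1 - ‖ζ‖ ^ 2) with hb
  have hbs : ContDiff ℝ ∞ b := Real.smoothTransition.contDiff.comp (contDiff_const.sub (contDiff_norm_sq ℝ))
  have hb0 : ∀ ζ : Euc d, 1 ≤ ‖ζ‖ → b ζ = 0 := fun ζ h => by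
    apply Real.smoothTransition.zero_of_nonpos; nlinarith
  set c : ℂ := (((2 * Real.pi) ^ d : ℝ) : ℂ)⁻¹ with hc
  set β : Euc d → ℂ := fun ζ => c * (b ζ : ℂ) with hβ
  have hβs : ContDiff ℝ ∞ β := contDiff_const.mul (Complex.ofRealCLM.contDiff.comp hbs)
  have hβ0 : ∀ ζ, 1 ≤ ‖ζ‖ → β ζ = 0 := fun ζ h => by simp [hβ, hb0 ζ h]
  have hβc : HasCompactSupport β := HasCompactSupport.intro (isCompact_closedBall 0 1) fun x hx => hβ0 x (by
    simp at hx; exact hx.le)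
  set S : SchwartzMap (Euc d) ℂ := hβc.toSchwartzMap hβs with hS
  have hSβ : (S : Euc d → ℂ) = β := rfl
  have hUU : ∀ x, UU β x = (𝓕 S) (-(2 * Real.pi)⁻¹ • x) := by
    intro x; rw [UU_eq, SchwartzMap.fourier_coe, hSβ]
  have hk : (-(2 * Real.pi)⁻¹ : ℝ) ≠ 0 := neg_ne_zero.2 (inv_ne_zero (by positivity))
  have hcont : Continuous (UU β) := UU_cont (hβs.continuous.integrable_of_hasCompactSupport hβc)
  refine ⟨β, UU β, hβs.continuous, hβ0, ?_, rfl, ?_, ?_, hcont, ?_⟩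
  · obtain ⟨M, hM⟩ := hβs.continuous.bounded_above_of_compact_support hβc
    exact ⟨M, hM⟩
  · intro x y hxy
    let ρ := Submodule.reflection (ℝ ∙ (x - y))ᗮ
    have hρ : ρ x = y := Submodule.reflection_sub hxy
    unfold UU
    rw [← (LinearIsometryEquiv.measurePreserving ρ).integral_comp ρ.toHomeomorph.measurableEmbedding]
    congr 1; ext ξ
    have h1 : β (ρ ξ) = β ξ := by simp [hβ, hb]
    have h2 : ⟪x, ρ ξ⟫ = ⟪y, ξ⟫ := by
      rw [← hρ, ← LinearIsometryEquiv.inner_map_map ρ x (ρ ξ)]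
      simp [ρ]
    rw [← h1, ← h2]
  · have h1 : Integrable (fun x => 2 * ‖(𝓕 S) x‖ + 2 * (2 * Real.pi) ^ 2 * (‖x‖ ^ 2 * ‖(𝓕 S) x‖)) :=
      ((𝓕 S).integrable.norm.const_mul 2).add ((SchwartzMap.integrable_pow_mul volume (𝓕 S) 2).const_mul _)
    have h2 := h1.comp_smul hk
    refine h2.mono' (by fun_prop) (ae_of_all _ fun x => ?_)
    rw [Real.norm_of_nonneg (by positivity), hUU, norm_smul]
    have e : 2 * (2 * Real.pi) ^ 2 * ((‖(-(2 * Real.pi)⁻¹ : ℝ)‖ * ‖x‖) ^ 2 * ‖(𝓕 S) (-(2 * Real.pi)⁻¹ • x)‖) =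
        2 * ‖x‖ ^ 2 * ‖(𝓕 S) (-(2 * Real.pi)⁻¹ • x)‖ := by
      rw [Real.norm_eq_abs, mul_pow _ ‖x‖, sq_abs]
      have := Real.pi_pos
      field_simp
    rw [e]
    nlinarith [norm_nonneg ((𝓕 S) (-(2 * Real.pi)⁻¹ • x)), mul_nonneg (sq_nonneg (1 - ‖x‖)) (norm_nonneg ((𝓕 S) (-(2 * Real.pi)⁻¹ • x)))]
  · simp_rw [hUU]
    rw [Measure.integral_comp_smul]
    have h1 : ∫ x, (𝓕 S) x = c := by
      have h2 : 𝓕⁻ (𝓕 S) = S := FourierTransform.fourierInv_fourier_eq S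
      have h3 := congrArg (fun T : SchwartzMap (Euc d) ℂ => T 0) h2
      simp only [SchwartzMap.fourierInv_coe] at h3
      rw [Real.fourierInv_eq] at h3
      simp at h3
      rw [h3]
      show β 0 = c
      simp [hβ, hb]
    rw [h1]
    simp only [finrank_euclideanSpace, Fintype.card_fin, hc]
    rw [← Complex.coe_smul, smul_eq_mul]
    have hp : ((2 * Real.pi) ^ d : ℝ) ≠ 0 := by positivity
    rw [show |((-(2 * Real.pi)⁻¹ : ℝ) ^ d)⁻¹| = (2 * Real.pi) ^ d by
      rw [abs_inv, abs_pow, abs_neg, abs_inv, inv_pow, inv_inv, abs_of_pos (by positivity)]]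
    rw [← Complex.ofReal_inv, ← Complex.ofReal_mul, mul_inv_cancel₀ hp]; simp

theorem moll (d : ℕ) (hd : 1 ≤ d) : ∃ C : ℝ, 0 ≤ C ∧ ∀ δ : ℝ, 0 < δ → ∀ q : ℝ, ∃ (m : Euc d → ℂ) (φ : ℝ → ℂ),
    BB m ∧ (∀ ζ, δ ≤ ‖ζ‖ → m ζ = 0) ∧ Measurable φ ∧ (∀ y, UU m y = φ ‖y‖) ∧
    (∀ r, 0 ≤ r → ‖φ r‖ ≤ C) ∧
    ∀ r, 0 ≤ r → ‖(if r ≤ q then (1:ℂ) else 0) - φ r‖ ≤ C / (1 + δ * |r - q|) ^ 2 := by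
  obtain ⟨β, ψ0, hβc, hβ0, ⟨M, hM⟩, hψ, hrad, hint, hcont, hone⟩ := exists_psi0 d
  set C := ∫ x, (1 + ‖x‖) ^ 2 * ‖ψ0 x‖ with hC
  have hC0 : 0 ≤ C := integral_nonneg fun x => by positivity
  have hM0 : 0 ≤ M := (norm_nonneg _).trans (hM 0)
  refine ⟨C, hC0, fun δ hδ q => ?_⟩
  set B : Set (Euc d) := Metric.closedBall 0 q with hB
  have hBm : MeasurableSet B := Metric.isClosed_closedBall.measurableSet
  have hBf : IsFiniteMeasure ((volume : Measure (Euc d)).restrict B) :=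
    ⟨by simpa using (isCompact_closedBall (0 : Euc d) q).measure_lt_top⟩
  set ψδ : Euc d → ℂ := fun x => ((δ ^ d : ℝ) : ℂ) * ψ0 (δ • x) with hψδ
  have hψδc : Continuous ψδ := by fun_prop
  have hint0 : Integrable ψ0 := hint.mono' hcont.aestronglyMeasurable (ae_of_all _ fun x => by
    nlinarith [norm_nonneg x, norm_nonneg (ψ0 x), mul_nonneg (norm_nonneg x) (norm_nonneg (ψ0 x)), mul_nonneg (sq_nonneg ‖x‖) (norm_nonneg (ψ0 x))])
  have hψδi : Integrable ψδ := (hint0.comp_smul hδ.ne').const_mul _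
  have hfr : |(δ ^ Module.finrank ℝ (Euc d))⁻¹| = (δ ^ d)⁻¹ := by
    rw [finrank_euclideanSpace, Fintype.card_fin, abs_of_pos (by positivity)]
  have hdd : (δ ^ d : ℝ) ≠ 0 := by positivity
  have hψδ1 : ∫ x, ψδ x = 1 := by
    rw [hψδ, integral_const_mul, Measure.integral_comp_smul, hone, hfr, ← Complex.coe_smul, smul_eq_mul, mul_one,
      ← Complex.ofReal_mul, mul_inv_cancel₀ hdd]; simp
  have hw : Integrable (fun x => (1 + δ * ‖x‖) ^ 2 * ‖ψδ x‖) ∧ ∫ x, (1 + δ * ‖x‖) ^ 2 * ‖ψδ x‖ = C := by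
    have e : (fun x => (1 + δ * ‖x‖) ^ 2 * ‖ψδ x‖) = fun x => δ ^ d * ((1 + ‖δ • x‖) ^ 2 * ‖ψ0 (δ • x)‖) := by
      ext x; simp only [hψδ]; rw [norm_mul, Complex.norm_real, Real.norm_of_nonneg (by positivity), norm_smul, Real.norm_of_nonneg hδ.le]; ring
    rw [e]
    refine ⟨(hint.comp_smul hδ.ne').const_mul _, ?_⟩
    rw [integral_const_mul, Measure.integral_comp_smul (μ := volume) (fun x => (1 + ‖x‖) ^ 2 * ‖ψ0 x‖), hfr, smul_eq_mul, ← hC, ← mul_assoc, mul_inv_cancel₀ hdd, one_mul]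
  set Φ : Euc d → ℂ := fun y => ∫ z in B, ψδ (y - z) with hΦ
  have hΦrad : ∀ x y : Euc d, ‖x‖ = ‖y‖ → Φ x = Φ y := by
    intro x y hxy
    let ρ := Submodule.reflection (ℝ ∙ (x - y))ᗮ
    have hρ : ρ x = y := Submodule.reflection_sub hxy
    simp only [hΦ]
    rw [← integral_indicator hBm, ← integral_indicator hBm,
      ← (LinearIsometryEquiv.measurePreserving ρ).integral_comp ρ.toHomeomorph.measurableEmbedding (fun z => B.indicator (fun z => ψδ (y - z)) z)]
    congr 1; ext z
    have h1 : ψδ (y - ρ z) = ψδ (x - z) := by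
      rw [← hρ, ← map_sub]; simp only [hψδ]; rw [hrad _ (δ • (x - z))]; rw [norm_smul, norm_smul, LinearIsometryEquiv.norm_map]
    have h2 : ρ z ∈ B ↔ z ∈ B := by simp [hB]
    by_cases hz : z ∈ B
    · rw [Set.indicator_of_mem hz, Set.indicator_of_mem (h2.2 hz), h1]
    · rw [Set.indicator_of_notMem hz, Set.indicator_of_notMem (fun h => hz (h2.1 h))]
  set m : Euc d → ℂ := fun ζ => (∫ z in B, Complex.exp (-(Complex.I * ((⟪z, ζ⟫ : ℝ) : ℂ)))) * β (δ⁻¹ • ζ) with hm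
  have hnexp : ∀ z ζ : Euc d, ‖Complex.exp (-(Complex.I * ((⟪z, ζ⟫ : ℝ) : ℂ)))‖ = 1 := fun z ζ => by
    rw [← mul_neg, ← Complex.ofReal_neg, mul_comm, Complex.norm_exp_ofReal_mul_I]
  have hmc : Continuous m := by
    refine Continuous.mul ?_ (by fun_prop)
    refine continuous_of_dominated (bound := fun _ => 1) (fun ζ => ?_) (fun ζ => ae_of_all _ fun z => (hnexp z ζ).le) (integrable_const 1) (ae_of_all _ fun z => by fun_prop)
    exact Continuous.aestronglyMeasurable (by fun_prop)
  have hm0 : ∀ ζ, δ ≤ ‖ζ‖ → m ζ = 0 := by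
    intro ζ hζ
    simp only [hm]; rw [hβ0, mul_zero]
    rw [norm_smul, norm_inv, Real.norm_of_nonneg hδ.le, ← div_eq_inv_mul, le_div_iff₀ hδ]; linarith
  have hmB : BB m := by
    refine ⟨hmc.measurable, ?_⟩
    obtain ⟨M', hM'⟩ := hmc.bounded_above_of_compact_support (HasCompactSupport.intro (isCompact_closedBall 0 δ) fun x hx => hm0 x (by
      simp at hx; exact hx.le))
    exact ⟨M', δ, fun ξ => ⟨hM' ξ, fun h => hm0 ξ h.le⟩⟩
  have hUm : ∀ y, UU m y = Φ y := by
    intro y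
    have hβδ : Integrable (fun ξ => β (δ⁻¹ • ξ)) := by
      refine Continuous.integrable_of_hasCompactSupport (by fun_prop) (HasCompactSupport.intro (isCompact_closedBall 0 δ) fun ζ hζ => hβ0 _ ?_)
      rw [norm_smul, norm_inv, Real.norm_of_nonneg hδ.le, ← div_eq_inv_mul, le_div_iff₀ hδ]
      simp at hζ; linarith
    have hin : ∀ z, ∫ ξ, Complex.exp (Complex.I * ((⟪y - z, ξ⟫ : ℝ) : ℂ)) * β (δ⁻¹ • ξ) = ψδ (y - z) := by
      intro z
      have := Measure.integral_comp_smul (μ := (volume : Measure (Euc d))) (fun ξ => Complex.exp (Complex.I * ((⟪δ • (y - z), ξ⟫ : ℝ) : ℂ)) * β ξ) δ⁻¹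
      have e : ∀ ξ : Euc d, ⟪δ • (y - z), δ⁻¹ • ξ⟫ = ⟪y - z, ξ⟫ := fun ξ => by
        rw [inner_smul_left, inner_smul_right]; simp; field_simp
      simp only [e] at this
      rw [this, hψδ]; simp only [hψ, UU]
      rw [inv_pow, inv_inv, finrank_euclideanSpace, Fintype.card_fin, abs_of_pos (by positivity), ← Complex.coe_smul, smul_eq_mul]
    simp only [UU, hm, hΦ]
    simp_rw [← hin]
    rw [integral_integral_swap]
    · congr 1; ext ξ
      rw [← mul_assoc, ← integral_const_mul, ← integral_mul_const]
      congr 1; ext z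
      rw [← Complex.exp_add, inner_sub_left]; push_cast; ring_nf
    · have h0 : Integrable (fun p : Euc d × Euc d => (1:ℂ) * β (δ⁻¹ • p.2)) ((volume.restrict B).prod volume) :=
        (integrable_const (1:ℂ)).mul_prod hβδ
      refine h0.norm.mono' ?_ (ae_of_all _ fun p => ?_)
      · apply Continuous.aestronglyMeasurable; unfold Function.uncurry; fun_prop
      · unfold Function.uncurry
        rw [norm_mul, mul_comm Complex.I, Complex.norm_exp_ofReal_mul_I, norm_mul, norm_one]
  have hΦc : Continuous Φ := by
    have : Φ = UU m := (funext hUm).symm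
    rw [this]; exact UU_cont hmB.integrable
  set e : Euc d := EuclideanSpace.single ⟨0, hd⟩ 1 with he
  have he1 : ‖e‖ = 1 := by simp [he]
  have hsh : ∀ y, Integrable (fun z => ψδ (y - z)) := fun y => hψδi.comp_sub_left y
  have hshw : ∀ y, Integrable (fun z => (1 + δ * ‖y - z‖) ^ 2 * ‖ψδ (y - z)‖) := fun y => hw.1.comp_sub_left y
  have hshe : ∀ y, ∫ z, (1 + δ * ‖y - z‖) ^ 2 * ‖ψδ (y - z)‖ = C := fun y => by
    rw [integral_sub_left_eq_self (fun z => (1 + δ * ‖z‖) ^ 2 * ‖ψδ z‖), hw.2]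
  refine ⟨m, fun r => Φ (r • e), hmB, hm0, (hΦc.comp (by fun_prop)).measurable, fun y => ?_, fun r hr => ?_, fun r hr => ?_⟩
  · rw [hUm]; apply hΦrad; simp [norm_smul, he1]
  · refine (norm_integral_le_integral_norm _).trans ?_
    rw [← hshe (r • e)]
    refine (setIntegral_le_integral (hsh _).norm (ae_of_all _ fun z => norm_nonneg _)).trans ?_
    refine integral_mono (hsh _).norm (hshw _) fun z => ?_
    have : 1 ≤ (1 + δ * ‖r • e - z‖) ^ 2 := one_le_pow₀ (by nlinarith [norm_nonneg (r • e - z)])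
    show ‖ψδ (r • e - z)‖ ≤ (1 + δ * ‖r • e - z‖) ^ 2 * ‖ψδ (r • e - z)‖
    nlinarith [norm_nonneg (ψδ (r • e - z))]
  · have hr' : ‖r • e‖ = r := by rw [norm_smul, he1, mul_one, Real.norm_of_nonneg hr]
    have h1 : (if r ≤ q then (1:ℂ) else 0) - Φ (r • e) =
        ∫ z, ((if r ≤ q then (1:ℂ) else 0) - (if ‖z‖ ≤ q then (1:ℂ) else 0)) * ψδ (r • e - z) := by
      have e1 : Φ (r • e) = ∫ z, (if ‖z‖ ≤ q then (1:ℂ) else 0) * ψδ (r • e - z) := by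
        simp only [hΦ]; rw [← integral_indicator hBm]; congr 1; ext z
        simp only [Set.indicator, hB, mem_closedBall_zero_iff]; split_ifs <;> simp
      have e2 : Integrable (fun z => (if ‖z‖ ≤ q then (1:ℂ) else 0) * ψδ (r • e - z)) := by
        refine (hsh (r • e)).norm.mono' ?_ (ae_of_all _ fun z => ?_)
        · exact ((Measurable.ite (measurableSet_le measurable_norm measurable_const) measurable_const measurable_const).aestronglyMeasurable).mul (hsh _).1
        · split_ifs <;> simp
      simp_rw [sub_mul]
      rw [integral_sub ((hsh _).const_mul _) e2, ← e1, integral_const_mul, integral_sub_left_eq_self ψδ, hψδ1, mul_one]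
    rw [h1, le_div_iff₀ (by positivity), ← hshe (r • e)]
    set D := (1 + δ * |r - q|) ^ 2 with hD
    have hD0 : 0 < D := by positivity
    rw [← le_div_iff₀ hD0, ← integral_div]
    refine norm_integral_le_of_norm_le ((hshw _).div_const _) (ae_of_all _ fun z => ?_)
    rw [norm_mul, le_div_iff₀ hD0]
    by_cases hz : (r ≤ q ∧ ‖z‖ ≤ q) ∨ (¬ r ≤ q ∧ ¬ ‖z‖ ≤ q)
    · have : ((if r ≤ q then (1:ℂ) else 0) - (if ‖z‖ ≤ q then (1:ℂ) else 0)) = 0 := by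
        rcases hz with h | h <;> simp [h]
      rw [this]; simp; positivity
    · have h5 : |r - q| ≤ ‖r • e - z‖ := by
        have h6 := abs_norm_sub_norm_le (r • e) z
        rw [hr'] at h6
        refine le_trans ?_ h6
        rw [not_or, not_and_or, not_and_or] at hz
        push Not at hz
        rw [abs_le]
        by_cases hq : r ≤ q
        · have : q < ‖z‖ := by rcases hz.1 with h | h <;> linarith
          rw [abs_of_nonpos (by linarith)]; constructor <;> linarith
        · have : ‖z‖ ≤ q := by rcases hz.2 with h | h <;> linarith
          rw [abs_of_nonneg (by linarith)]; constructor <;> linarith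
      have h7 : D ≤ (1 + δ * ‖r • e - z‖) ^ 2 := by rw [hD]; gcongr
      have h8 : ‖((if r ≤ q then (1:ℂ) else 0) - (if ‖z‖ ≤ q then (1:ℂ) else 0))‖ ≤ 1 := by
        split_ifs <;> simp
      calc _ ≤ 1 * ‖ψδ (r • e - z)‖ * D := by gcongr
        _ ≤ _ := by rw [one_mul, mul_comm]; gcongr

def th (b q x : ℝ) : ℝ := 1 / (1 + b * |x - q|) ^ 2

theorem th_nonneg (b q x : ℝ) : 0 ≤ th b q x := by unfold th; positivity

theorem th_le_one {b : ℝ} (hb : 0 < b) (q x : ℝ) : th b q x ≤ 1 := by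
  unfold th
  rw [div_le_one (by positivity)]
  exact one_le_pow₀ (by nlinarith [abs_nonneg (x - q)])

theorem th_meas (b q : ℝ) : Measurable (th b q) := by unfold th; fun_prop

theorem thI (μ : Measure ℝ) {b c : ℝ} (hb : 0 < b) (hc : 0 ≤ c) (p : ℝ)
    (h : ∀ L, 1 / b ≤ L → μ (Metric.closedBall p L) ≤ ENNReal.ofReal (c * L)) :
    ∫⁻ x, ENNReal.ofReal (th b p x) ∂μ ≤ ENNReal.ofReal (8 * c / b) := by
  have h1 : ∀ x, ENNReal.ofReal (th b p x) ≤ ∑' k : ℕ, ENNReal.ofReal (4 * (1/4) ^ k) *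
      (Metric.closedBall p (2 ^ k / b)).indicator 1 x := by
    intro x
    have : ∃ k : ℕ, b * |x - p| ≤ 2 ^ k ∧ th b p x ≤ 4 * (1/4) ^ k := by
      by_cases hs : b * |x - p| ≤ 1
      · exact ⟨0, by simpa using hs, (th_le_one hb p x).trans (by norm_num)⟩
      · obtain ⟨n, h1, h2⟩ := exists_nat_pow_near (le_of_lt (not_le.1 hs)) (one_lt_two)
        refine ⟨n + 1, h2.le, ?_⟩
        have : (4:ℝ) * (1/4) ^ (n+1) = 1 / (2 ^ n) ^ 2 := by
          rw [pow_succ, ← pow_mul, mul_comm n 2, pow_mul, one_div, one_div, inv_pow]; norm_num; ring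
        rw [this, th]
        gcongr; linarith
    obtain ⟨k, h1, h2⟩ := this
    refine le_trans ?_ (ENNReal.le_tsum k)
    rw [Set.indicator_of_mem]
    · simpa using ENNReal.ofReal_le_ofReal h2
    · rw [Metric.mem_closedBall, Real.dist_eq, le_div_iff₀ hb]; linarith
  refine (lintegral_mono h1).trans ?_
  rw [lintegral_tsum (fun k => by
    refine (Measurable.const_mul ?_ _).aemeasurable
    exact measurable_one.indicator Metric.isClosed_closedBall.measurableSet)]
  have h2 : ∀ k : ℕ, ∫⁻ x, ENNReal.ofReal (4 * (1/4) ^ k) * (Metric.closedBall p (2 ^ k / b)).indicator 1 x ∂μ ≤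
      ENNReal.ofReal (4 * c / b * (1/2) ^ k) := by
    intro k
    rw [lintegral_const_mul _ (measurable_one.indicator Metric.isClosed_closedBall.measurableSet),
      lintegral_indicator_one Metric.isClosed_closedBall.measurableSet]
    refine (mul_le_mul_right (h (2 ^ k / b) ?_) _).trans ?_
    · gcongr; exact one_le_pow₀ one_le_two
    · rw [← ENNReal.ofReal_mul (by positivity)]
      apply le_of_eq; congr 1
      have : (1/4:ℝ)^k = (1/2)^k * (1/2)^k := by rw [← mul_pow]; norm_num
      rw [this]
      have h3 : (1/2:ℝ)^k * 2^k = 1 := by rw [← mul_pow]; norm_num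
      calc _ = 4 * c / b * (1/2)^k * ((1/2:ℝ)^k * 2^k) := by ring
        _ = _ := by rw [h3, mul_one]
  refine (ENNReal.tsum_le_tsum h2).trans ?_
  rw [← ENNReal.ofReal_tsum_of_nonneg (fun k => by positivity) (summable_geometric_two.mul_left _), tsum_mul_left, tsum_geometric_two]
  apply le_of_eq; congr 1; ring

theorem thII (μ : Measure ℝ) {a b c : ℝ} (ha : 0 < a) (hab : a ≤ b) (hc : 0 ≤ c) (p q : ℝ)
    (h : ∀ p L, 1 / b ≤ L → μ (Metric.closedBall p L) ≤ ENNReal.ofReal (c * L)) :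
    ∫⁻ x, ENNReal.ofReal (th b p x * th a q x) ∂μ ≤ ENNReal.ofReal (160 * c / b * th a q p) := by
  have hb : 0 < b := ha.trans_le hab
  set D := |p - q| with hD
  have hD0 : 0 ≤ D := abs_nonneg _
  have hIb := thI μ hb hc p (h p)
  by_cases hDb : D < 1 / b
  · have h1 : 1/4 ≤ th a q p := by
      unfold th
      rw [← hD]
      apply one_div_le_one_div_of_le (by positivity)
      have : a * D ≤ 1 := by
        rw [lt_div_iff₀ hb] at hDb; nlinarith
      nlinarith [mul_nonneg ha.le hD0]
    refine (lintegral_mono fun x => ENNReal.ofReal_le_ofReal (mul_le_of_le_one_right (th_nonneg _ _ _) (th_le_one ha _ _))).trans (hIb.trans (ENNReal.ofReal_le_ofReal ?_))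
    have : 0 ≤ c / b := by positivity
    rw [mul_div_assoc, mul_div_assoc]; nlinarith
  · push Not at hDb
    have hbD : 1 ≤ b * D := by rw [div_le_iff₀ hb] at hDb; linarith
    set v := 4 / (1 + b * D) ^ 2 with hv
    have hv0 : 0 ≤ v := by positivity
    have hpt : ∀ x, ENNReal.ofReal (th b p x * th a q x) ≤ ENNReal.ofReal (4 * th a q p) * ENNReal.ofReal (th b p x) +
        ENNReal.ofReal v * (Metric.closedBall q D).indicator (fun x => ENNReal.ofReal (th a q x)) x := by
      intro x
      by_cases hx : |x - q| < D / 2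
      · refine le_add_of_nonneg_of_le zero_le ?_
        rw [Set.indicator_of_mem (by rw [Metric.mem_closedBall, Real.dist_eq]; linarith), ← ENNReal.ofReal_mul hv0]
        apply ENNReal.ofReal_le_ofReal
        refine mul_le_mul_of_nonneg_right ?_ (th_nonneg _ _ _)
        have h3 : D / 2 ≤ |x - p| := by
          have := abs_sub_le p x q
          rw [abs_sub_comm p x] at this; linarith
        rw [hv, th, div_le_div_iff₀ (by positivity) (by positivity)]
        have : 1 + b * D ≤ 2 * (1 + b * |x - p|) := by nlinarith
        nlinarith [mul_nonneg hb.le hD0]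
      · refine le_add_of_le_of_nonneg ?_ zero_le
        rw [← ENNReal.ofReal_mul (mul_nonneg (by norm_num) (th_nonneg _ _ _))]
        apply ENNReal.ofReal_le_ofReal
        rw [mul_comm (th b p x)]
        refine mul_le_mul_of_nonneg_right ?_ (th_nonneg _ _ _)
        push Not at hx
        rw [th, th, ← hD, mul_one_div, div_le_div_iff₀ (by positivity) (by positivity)]
        have : 1 + a * D ≤ 2 * (1 + a * |x - q|) := by nlinarith
        nlinarith [mul_nonneg ha.le hD0]
    refine (lintegral_mono hpt).trans ?_
    have hms := Metric.isClosed_closedBall (x := q) (ε := D) |>.measurableSet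
    have hmt : Measurable fun x => ENNReal.ofReal (th a q x) := (th_meas a q).ennreal_ofReal
    rw [lintegral_add_left (((th_meas b p).ennreal_ofReal).const_mul _), lintegral_const_mul _ (th_meas b p).ennreal_ofReal,
      lintegral_const_mul _ (hmt.indicator hms)]
    have h2 : ENNReal.ofReal v * ∫⁻ x, (Metric.closedBall q D).indicator (fun x => ENNReal.ofReal (th a q x)) x ∂μ ≤
        ENNReal.ofReal (128 * c / b * th a q p) := by
      by_cases haD : a * D ≤ 1
      · have h4 : ∫⁻ x, (Metric.closedBall q D).indicator (fun x => ENNReal.ofReal (th a q x)) x ∂μ ≤ ENNReal.ofReal (c * D) := by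
          refine le_trans ?_ (h q D hDb)
          rw [← lintegral_indicator_one hms]
          apply lintegral_mono; intro x
          apply Set.indicator_le_indicator
          simpa using th_le_one ha q x
        refine (mul_le_mul_right h4 _).trans ?_
        rw [← ENNReal.ofReal_mul hv0]
        apply ENNReal.ofReal_le_ofReal
        rw [hv, th, ← hD, div_mul_eq_mul_div, div_mul_div_comm, div_le_div_iff₀ (by positivity) (by positivity)]
        have h5 : (1 + a * D) ^ 2 ≤ 4 := by nlinarith [mul_nonneg ha.le hD0]
        have h6 : b * D ≤ (1 + b * D) ^ 2 := by nlinarith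
        calc 4 * (c * D) * (b * (1 + a * D) ^ 2) = 4 * c * (b * D) * (1 + a * D) ^ 2 := by ring
          _ ≤ 4 * c * (1 + b * D) ^ 2 * 4 := by gcongr
          _ ≤ _ := by nlinarith [mul_nonneg hc (sq_nonneg (1 + b * D))]
      · have h4 : ∫⁻ x, (Metric.closedBall q D).indicator (fun x => ENNReal.ofReal (th a q x)) x ∂μ ≤ ENNReal.ofReal (8 * c / a) := by
          refine le_trans (lintegral_mono fun x => Set.indicator_le_self _ _ x) (thI μ ha hc q fun L hL => h q L (le_trans ?_ hL))
          exact one_div_le_one_div_of_le ha hab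
        refine (mul_le_mul_right h4 _).trans ?_
        rw [← ENNReal.ofReal_mul hv0]
        apply ENNReal.ofReal_le_ofReal
        push Not at haD
        rw [hv, th, ← hD, div_mul_div_comm, div_mul_div_comm, div_le_div_iff₀ (by positivity) (by positivity)]
        have h5 : (1 + a * D) ^ 2 ≤ 4 * (a * D) ^ 2 := by nlinarith
        have h6 : b * (a * D) ^ 2 ≤ a * (1 + b * D) ^ 2 := by
          have : b * (a * D) ^ 2 ≤ a * (b * D) ^ 2 := by
            have : 0 ≤ a * b * D ^ 2 * (b - a) := mul_nonneg (by positivity) (by linarith)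
            nlinarith
          refine this.trans ?_
          gcongr; linarith
        calc 4 * (8 * c) * (b * (1 + a * D) ^ 2) ≤ 32 * c * (b * (4 * (a * D) ^ 2)) := by
              rw [show (4:ℝ) * (8 * c) = 32 * c by ring]; gcongr
          _ = 128 * c * (b * (a * D) ^ 2) := by ring
          _ ≤ 128 * c * (a * (1 + b * D) ^ 2) := by gcongr
          _ = _ := by ring
    refine (add_le_add (mul_le_mul_right hIb _) h2).trans ?_
    have h0 := th_nonneg a q p
    rw [← ENNReal.ofReal_mul (by positivity), ← ENNReal.ofReal_add (by positivity) (by positivity)]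
    apply ENNReal.ofReal_le_ofReal
    apply le_of_eq; ring

theorem thD {ι : Type*} (J : Finset ι) (b q : ι → ℝ) (hb : ∀ j, 0 < b j) {c : ℝ} (hc : 0 ≤ c)
    (k l : ι) (hlk : b l ≤ b k)
    (hp : ∀ p L, 1 / b k ≤ L → ∑ j ∈ J with (b k ≤ b j ∧ |q j - p| ≤ L), 1 / b j ≤ c * L) :
    ∑ j ∈ J with b k ≤ b j, 1 / b j * (th (b k) (q k) (q j) * th (b l) (q l) (q j)) ≤
      160 * c / b k * th (b l) (q l) (q k) := by
  classical
  set μ : Measure ℝ := ∑ j ∈ J with b k ≤ b j, ENNReal.ofReal (1 / b j) • Measure.dirac (q j) with hμ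
  have h1 := thII μ (hb l) hlk hc (q k) (q l) (by
    intro p L hL
    rw [hμ, Measure.finset_sum_apply]
    refine le_trans (le_of_eq ?_) (ENNReal.ofReal_le_ofReal (hp p L hL))
    rw [ENNReal.ofReal_sum_of_nonneg (fun j _ => by have := hb j; positivity), ← Finset.filter_filter, Finset.sum_filter (fun j => |q j - p| ≤ L)]
    apply Finset.sum_congr rfl
    intro j _
    rw [Measure.smul_apply, Measure.dirac_apply, smul_eq_mul, Set.indicator]
    simp only [Metric.mem_closedBall, Real.dist_eq]
    split_ifs <;> simp)
  rw [hμ, lintegral_finset_sum_measure] at h1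
  simp only [lintegral_smul_measure, lintegral_dirac, smul_eq_mul] at h1
  rw [← ENNReal.ofReal_le_ofReal_iff (by have := hb k; have := th_nonneg (b l) (q l) (q k); positivity)]
  refine le_trans (le_of_eq ?_) h1
  rw [ENNReal.ofReal_sum_of_nonneg (fun j _ => by have := hb j; have := th_nonneg (b l) (q l) (q j); have := th_nonneg (b k) (q k) (q j); positivity)]
  apply Finset.sum_congr rfl
  intro j _
  rw [ENNReal.ofReal_mul (by have := hb j; positivity)]

theorem carl {ι : Type*} (J : Finset ι) (b q a : ι → ℝ) (hb : ∀ j, 0 < b j) (ha : ∀ j, 0 ≤ a j) {c : ℝ} (hc : 0 ≤ c)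
    (hp : ∀ k ∈ J, ∀ p L, 1 / b k ≤ L → ∑ j ∈ J with (b k ≤ b j ∧ |q j - p| ≤ L), 1 / b j ≤ c * L)
    (ν : Measure ℝ) (hν : ∀ p L, 0 < L → ν (Metric.closedBall p L) ≤ ENNReal.ofReal (c * L)) :
    ∫⁻ x, ENNReal.ofReal ((∑ j ∈ J, a j * √(b j) * th (b j) (q j) x) ^ 2) ∂ν ≤
      ENNReal.ofReal (4 * (160 * c) ^ 2 * ∑ j ∈ J, a j ^ 2) := by
  classical
  set K := 160 * c with hK
  have hK0 : 0 ≤ K := by positivity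
  set w : ι → ℝ := fun j => a j * √(b j) with hw
  have hw0 : ∀ j, 0 ≤ w j := fun j => mul_nonneg (ha j) (Real.sqrt_nonneg _)
  set U : ι → ι → ℝ := fun j k => if b k ≤ b j then w j * w k * (1 / b j * th (b k) (q k) (q j)) else 0 with hU
  have hU0 : ∀ j k, 0 ≤ U j k := fun j k => by
    simp only [hU]; split_ifs
    · have := hb j; have := hw0 j; have := hw0 k; have := th_nonneg (b k) (q k) (q j); positivity
    · exact le_rfl
  set Y := ∑ j ∈ J, ∑ k ∈ J, U j k with hY
  have hY0 : 0 ≤ Y := Finset.sum_nonneg fun j _ => Finset.sum_nonneg fun k _ => hU0 j k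
  have hYs : ∑ j ∈ J, ∑ k ∈ J, K * (U j k + U k j) = 2 * K * Y := by
    simp_rw [mul_add, Finset.sum_add_distrib]
    rw [Finset.sum_comm (f := fun j k => K * U k j)]
    simp_rw [← Finset.mul_sum]; rw [← hY]; ring
  -- integral estimate
  have hi1 : ∀ j ∈ J, ∀ k ∈ J, ∫⁻ x, ENNReal.ofReal (w j * w k * (th (b j) (q j) x * th (b k) (q k) x)) ∂ν ≤ ENNReal.ofReal (K * (U j k + U k j)) := by
    have key : ∀ j k, b k ≤ b j → ∫⁻ x, ENNReal.ofReal (w j * w k * (th (b j) (q j) x * th (b k) (q k) x)) ∂ν ≤ ENNReal.ofReal (K * U j k) := by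
      intro j k hjk
      have h0 : 0 ≤ w j * w k := mul_nonneg (hw0 j) (hw0 k)
      simp_rw [ENNReal.ofReal_mul h0]
      rw [lintegral_const_mul _ (show Measurable fun x => ENNReal.ofReal (th (b j) (q j) x * th (b k) (q k) x) from
        ((th_meas _ _).mul (th_meas _ _)).ennreal_ofReal)]
      refine (mul_le_mul_right (thII ν (hb k) hjk hc (q j) (q k) fun p L hL => hν p L (lt_of_lt_of_le (by have := hb j; positivity) hL)) _).trans ?_
      rw [← ENNReal.ofReal_mul h0]
      apply ENNReal.ofReal_le_ofReal
      simp only [hU, if_pos hjk]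
      apply le_of_eq; ring
    intro j _ k _
    rcases le_total (b k) (b j) with h | h
    · refine (key j k h).trans (ENNReal.ofReal_le_ofReal ?_)
      exact mul_le_mul_of_nonneg_left (by linarith [hU0 k j]) hK0
    · refine le_trans (le_of_eq ?_) ((key k j h).trans (ENNReal.ofReal_le_ofReal (mul_le_mul_of_nonneg_left (by linarith [hU0 j k]) hK0)))
      congr 1; ext x; congr 1; ring
  have hmain : ∫⁻ x, ENNReal.ofReal ((∑ j ∈ J, w j * th (b j) (q j) x) ^ 2) ∂ν ≤ ENNReal.ofReal (2 * K * Y) := by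
    have e : ∀ x, ENNReal.ofReal ((∑ j ∈ J, w j * th (b j) (q j) x) ^ 2) =
        ∑ j ∈ J, ∑ k ∈ J, ENNReal.ofReal (w j * w k * (th (b j) (q j) x * th (b k) (q k) x)) := by
      intro x
      have hn : ∀ j k, 0 ≤ w j * w k * (th (b j) (q j) x * th (b k) (q k) x) := fun j k =>
        mul_nonneg (mul_nonneg (hw0 j) (hw0 k)) (mul_nonneg (th_nonneg _ _ _) (th_nonneg _ _ _))
      rw [sq, Finset.sum_mul_sum, ENNReal.ofReal_sum_of_nonneg (fun j _ => Finset.sum_nonneg fun k _ => by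
        refine (hn j k).trans (le_of_eq (by ring)))]
      apply Finset.sum_congr rfl; intro j _
      rw [ENNReal.ofReal_sum_of_nonneg (fun k _ => (hn j k).trans (le_of_eq (by ring)))]
      apply Finset.sum_congr rfl; intro k _
      congr 1; ring
    have hmm : ∀ j k, Measurable fun x => ENNReal.ofReal (w j * w k * (th (b j) (q j) x * th (b k) (q k) x)) := fun j k =>
      (((th_meas _ _).mul (th_meas _ _)).const_mul _).ennreal_ofReal
    simp_rw [e]
    rw [lintegral_finset_sum _ (fun j _ => Finset.measurable_sum _ fun k _ => hmm j k)]
    simp_rw [lintegral_finset_sum J (fun k _ => hmm _ k)]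
    rw [← hYs, ENNReal.ofReal_sum_of_nonneg (fun j _ => Finset.sum_nonneg fun k _ => mul_nonneg hK0 (add_nonneg (hU0 j k) (hU0 k j)))]
    apply Finset.sum_le_sum; intro j hj
    rw [ENNReal.ofReal_sum_of_nonneg (fun k _ => mul_nonneg hK0 (add_nonneg (hU0 j k) (hU0 k j)))]
    exact Finset.sum_le_sum fun k hk => hi1 j hj k hk
  -- discrete estimate
  set H : ι → ℝ := fun j => ∑ k ∈ J, if b k ≤ b j then w k * th (b k) (q k) (q j) else 0 with hH
  have hYH : Y = ∑ j ∈ J, a j * (H j / √(b j)) := by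
    rw [hY]; apply Finset.sum_congr rfl; intro j _
    simp only [hH, hU]
    rw [Finset.sum_div, Finset.mul_sum]
    apply Finset.sum_congr rfl; intro k _
    split_ifs
    · have h1 := Real.mul_self_sqrt (hb j).le
      have h2 : √(b j) ≠ 0 := (Real.sqrt_pos.2 (hb j)).ne'
      have h3 : (1 : ℝ) / b j = 1 / √(b j) * (1 / √(b j)) := by rw [div_mul_div_comm, h1, one_mul]
      simp only [hw]; rw [h3]; field_simp
    · simp
  have hHs : ∑ j ∈ J, (H j / √(b j)) ^ 2 ≤ 2 * K * Y := by
    have e : ∀ j ∈ J, (H j / √(b j)) ^ 2 = ∑ k ∈ J, ∑ l ∈ J, if (b k ≤ b j ∧ b l ≤ b j) then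
        w k * w l * (1 / b j * (th (b k) (q k) (q j) * th (b l) (q l) (q j))) else 0 := by
      intro j _
      rw [div_pow, Real.sq_sqrt (hb j).le, sq, hH]
      simp only
      rw [Finset.sum_mul_sum, Finset.sum_div]
      apply Finset.sum_congr rfl; intro k _
      rw [Finset.sum_div]
      apply Finset.sum_congr rfl; intro l _
      by_cases h1 : b k ≤ b j <;> by_cases h2 : b l ≤ b j <;> simp [h1, h2]
      ring
    rw [Finset.sum_congr rfl e, Finset.sum_comm, ← hYs]
    apply Finset.sum_le_sum; intro k hk
    rw [Finset.sum_comm]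
    apply Finset.sum_le_sum; intro l hl
    have key : ∀ k ∈ J, ∀ l ∈ J, b l ≤ b k → (∑ j ∈ J, if (b k ≤ b j ∧ b l ≤ b j) then
        w k * w l * (1 / b j * (th (b k) (q k) (q j) * th (b l) (q l) (q j))) else 0) ≤ K * U k l := by
      intro k hk l hl hlk
      have h1 := thD J b q hb hc k l hlk (hp k hk)
      have h2 := mul_le_mul_of_nonneg_left h1 (mul_nonneg (hw0 k) (hw0 l))
      rw [Finset.mul_sum, Finset.sum_filter] at h2
      refine le_trans (le_of_eq ?_) (h2.trans (le_of_eq ?_))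
      · apply Finset.sum_congr rfl; intro j _
        by_cases h : b k ≤ b j
        · simp [h, hlk.trans h]
        · simp [h]
      · simp only [hU, if_pos hlk]; ring
    rcases le_total (b l) (b k) with h | h
    · exact (key k hk l hl h).trans (mul_le_mul_of_nonneg_left (by linarith [hU0 l k]) hK0)
    · refine le_trans (le_of_eq ?_) ((key l hl k hk h).trans (mul_le_mul_of_nonneg_left (by linarith [hU0 k l]) hK0))
      apply Finset.sum_congr rfl; intro j _
      by_cases h1 : b k ≤ b j <;> by_cases h2 : b l ≤ b j <;> simp only [h1, h2, and_self, and_true, true_and, if_true, if_false, and_false, false_and]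
      ring
  have hCS := Finset.sum_mul_sq_le_sq_mul_sq J a (fun j => H j / √(b j))
  rw [← hYH] at hCS
  set A := ∑ j ∈ J, a j ^ 2 with hA
  have hA0 : 0 ≤ A := Finset.sum_nonneg fun j _ => sq_nonneg _
  have hYA : Y ≤ 2 * K * A := by
    rcases hY0.eq_or_lt with h | h
    · rw [← h]; positivity
    · have : Y * Y ≤ (2 * K * A) * Y := by nlinarith [mul_le_mul_of_nonneg_left hHs hA0]
      exact le_of_mul_le_mul_right this h
  refine hmain.trans (ENNReal.ofReal_le_ofReal ?_)
  nlinarith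

theorem tele (f : ℤ → ℝ) (a b : ℤ) (hab : a ≤ b) : ∑ s ∈ Finset.Ico a b, (f (s + 1) - f s) = f b - f a := by
  induction b, hab using Int.le_induction with
  | base => simp
  | succ b hb ih =>
    rw [← Finset.insert_Ico_right_eq_Ico_add_one hb, Finset.sum_insert (by simp), ih]; ring

theorem packW (S : Finset (ℕ × ℤ)) (h : ℝ → ℝ) (hm : Monotone h) {V c : ℝ} (hc : 0 < c) (hV : ∀ x y, h x - h y ≤ V)
    (hS : ∀ W ∈ S, c * (1/2) ^ W.1 ≤ h ((W.2 + 1) * 2 ^ W.1) - h (W.2 * 2 ^ W.1)) :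
    ∑ W ∈ S, (1/2 : ℝ) ^ W.1 ≤ 2 / c * V := by
  classical
  set f : ℤ → ℝ := fun s => h s with hf
  set lo : ℕ × ℤ → ℤ := fun W => W.2 * 2 ^ W.1 with hlo
  set hi : ℕ × ℤ → ℤ := fun W => (W.2 + 1) * 2 ^ W.1 with hhi
  have hlh : ∀ W, lo W ≤ hi W := fun W => by
    simp only [hlo, hhi]; have : (0:ℤ) < 2 ^ W.1 := by positivity
    nlinarith
  set μ : ℕ × ℤ → ℝ := fun W => f (hi W) - f (lo W) with hμ
  have hμc : ∀ W ∈ S, c * (1/2) ^ W.1 ≤ μ W := fun W hW => by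
    have := hS W hW; simp only [hμ, hf, hhi, hlo]; push_cast; exact this
  have hμ0 : ∀ W ∈ S, 0 < μ W := fun W hW => lt_of_lt_of_le (by positivity) (hμc W hW)
  obtain ⟨a, b, hab, hcov⟩ : ∃ a b : ℤ, a ≤ b ∧ ∀ W ∈ S, a ≤ lo W ∧ hi W ≤ b := by
    have : ∀ T : Finset (ℕ × ℤ), ∃ a b : ℤ, a ≤ b ∧ ∀ W ∈ T, a ≤ lo W ∧ hi W ≤ b := by
      intro T
      induction T using Finset.induction with
      | empty => exact ⟨0, 0, le_rfl, by simp⟩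
      | insert W T _ ih =>
        obtain ⟨a, b, hab, h⟩ := ih
        refine ⟨min a (lo W), max b (hi W), by omega, ?_⟩
        intro X hX
        rcases Finset.mem_insert.1 hX with rfl | hX
        · omega
        · have := h X hX; omega
    exact this S
  have hd : ∀ s, 0 ≤ f (s + 1) - f s := fun s => sub_nonneg.2 (hm (by exact_mod_cast (by omega)))
  have e1 : ∀ W ∈ S, (1/2 : ℝ) ^ W.1 = ∑ s ∈ Finset.Ico a b, if (lo W ≤ s ∧ s < hi W) then (f (s + 1) - f s) * ((1/2) ^ W.1 / μ W) else 0 := by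
    intro W hW
    rw [← Finset.sum_filter, ← Finset.sum_mul]
    have : (Finset.Ico a b).filter (fun s => lo W ≤ s ∧ s < hi W) = Finset.Ico (lo W) (hi W) := by
      ext s; have := hcov W hW; simp only [Finset.mem_filter, Finset.mem_Ico]; omega
    rw [this, tele f _ _ (hlh W)]
    have := (hμ0 W hW).ne'
    show _ = μ W * _
    field_simp
  rw [Finset.sum_congr rfl e1, Finset.sum_comm]
  have hkey : ∀ s ∈ Finset.Ico a b, (∑ W ∈ S, if (lo W ≤ s ∧ s < hi W) then (f (s + 1) - f s) * ((1/2) ^ W.1 / μ W) else 0) ≤ (f (s + 1) - f s) * (2 / c) := by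
    intro s _
    rw [← Finset.sum_filter, ← Finset.mul_sum]
    refine mul_le_mul_of_nonneg_left ?_ (hd s)
    set T := S.filter (fun W => lo W ≤ s ∧ s < hi W) with hT
    have hN : ∀ W ∈ T, W.2 = s / 2 ^ W.1 := by
      intro W hW
      simp only [hT, Finset.mem_filter, hlo, hhi] at hW
      have hp : (0:ℤ) < 2 ^ W.1 := by positivity
      symm
      rw [Int.ediv_eq_iff_of_pos hp]
      exact ⟨hW.2.1, by linarith [hW.2.2]⟩
    rcases T.eq_empty_or_nonempty with hE | hE
    · rw [hE]; simp; positivity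
    · obtain ⟨W0, hW0, hmin⟩ := Finset.exists_min_image T (fun W => W.1) hE
      have hTS : ∀ W ∈ T, W ∈ S := fun W hW => (Finset.mem_filter.1 hW).1
      have hle : ∀ W ∈ T, μ W0 ≤ μ W := by
        intro W hW
        have h1 := hmin W hW
        have h2 := hN W hW
        have h3 := hN W0 hW0
        obtain ⟨k, hk⟩ := Nat.exists_eq_add_of_le h1
        have h4 : W.2 = W0.2 / 2 ^ k := by rw [h2, h3, hk, pow_add, Int.ediv_ediv_of_nonneg (by positivity)]
        have hp : (0:ℤ) < 2 ^ k := by positivity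
        have hp0 : (0:ℤ) < 2 ^ W0.1 := by positivity
        have h5 : W.2 * 2 ^ k ≤ W0.2 := by rw [h4]; exact Int.ediv_mul_le _ hp.ne'
        have h6 : W0.2 + 1 ≤ (W.2 + 1) * 2 ^ k := by
          rw [h4]; have := Int.lt_ediv_add_one_mul_self W0.2 hp; omega
        have h7 : lo W ≤ lo W0 := by
          simp only [hlo]; rw [hk, pow_add, mul_comm (2 ^ W0.1), ← mul_assoc]; gcongr
        have h8 : hi W0 ≤ hi W := by
          simp only [hhi]; rw [hk, pow_add, mul_comm (2 ^ W0.1), ← mul_assoc]; gcongr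
        simp only [hμ, hf]
        have h9 : h (lo W) ≤ h (lo W0) := hm (by exact_mod_cast h7)
        have h10 : h (hi W0) ≤ h (hi W) := hm (by exact_mod_cast h8)
        linarith
      have h5 : ∀ W ∈ T, (1/2 : ℝ) ^ W.1 / μ W ≤ 1 / c * (1/2) ^ (W.1 - W0.1) := by
        intro W hW
        rw [div_le_iff₀ (hμ0 W (hTS W hW))]
        have h6 := (hμc W0 (hTS _ hW0)).trans (hle W hW)
        obtain ⟨k, hk⟩ := Nat.exists_eq_add_of_le (hmin W hW)
        rw [hk, pow_add, Nat.add_sub_cancel_left]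
        calc (1/2 : ℝ) ^ W0.1 * (1/2) ^ k = 1 / c * (1/2) ^ k * (c * (1/2) ^ W0.1) := by field_simp
          _ ≤ _ := by gcongr
      refine (Finset.sum_le_sum h5).trans ?_
      rw [← Finset.mul_sum]
      have hinj : Set.InjOn (fun W : ℕ × ℤ => W.1 - W0.1) (T : Set (ℕ × ℤ)) := by
        intro X hX Y hY hXY
        have h1 := hmin X hX; have h2 := hmin Y hY
        have h3 : X.1 = Y.1 := by simp only at hXY; omega
        exact Prod.ext h3 (by rw [hN X hX, hN Y hY, h3])
      rw [← Finset.sum_image (f := fun k => (1/2:ℝ) ^ k) hinj]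
      have h6 := summable_geometric_two.sum_le_tsum (T.image (fun W => W.1 - W0.1)) (fun _ _ => by positivity)
      rw [tsum_geometric_two] at h6
      calc _ ≤ 1 / c * 2 := by gcongr
        _ = _ := by ring
  refine (Finset.sum_le_sum hkey).trans ?_
  rw [← Finset.sum_mul, tele f a b hab, mul_comm]
  gcongr
  exact hV _ _

/-- smallness of a dyadic interval -/
def sm (g : ℝ → ℝ) (A : ℝ) (j m : ℕ) : Prop := 2 ^ j * (g ((m + 2) * 2 ^ j) - g ((m - 1) * 2 ^ j)) ≤ A

open Classical in
def lev (g : ℝ → ℝ) (A : ℝ) (n : ℕ) (ρ : ℝ) : ℕ := Nat.findGreatest (fun j => sm g A j ⌊ρ / 2 ^ j⌋₊) n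

def InC (g : ℝ → ℝ) (A : ℝ) (n : ℕ) (c : ℕ × ℕ) (ρ : ℝ) : Prop := 0 ≤ ρ ∧ lev g A n ρ = c.1 ∧ ⌊ρ / 2 ^ c.1⌋₊ = c.2

theorem InC.mem {g : ℝ → ℝ} {A : ℝ} {n : ℕ} {c : ℕ × ℕ} {ρ : ℝ} (h : InC g A n c ρ) :
    (c.2 : ℝ) * 2 ^ c.1 ≤ ρ ∧ ρ < (c.2 + 1) * 2 ^ c.1 := by
  obtain ⟨h0, h1, h2⟩ := h
  have hp : (0:ℝ) < 2 ^ c.1 := by positivity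
  have h3 := (Nat.floor_eq_iff (by positivity)).1 h2
  rw [le_div_iff₀ hp, div_lt_iff₀ hp] at h3
  exact h3

theorem lev_le (g : ℝ → ℝ) (A : ℝ) (n : ℕ) (ρ : ℝ) : lev g A n ρ ≤ n := by
  classical
  exact Nat.findGreatest_le n

theorem lev_sm {g : ℝ → ℝ} {A : ℝ} (hA : ∀ x y, g x - g y ≤ A) (n : ℕ) (ρ : ℝ) :
    sm g A (lev g A n ρ) ⌊ρ / 2 ^ (lev g A n ρ)⌋₊ := by
  classical
  have : sm g A 0 ⌊ρ / 2 ^ 0⌋₊ := by simp only [sm, pow_zero, one_mul]; exact hA _ _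
  exact Nat.findGreatest_spec (P := fun j => sm g A j ⌊ρ / 2 ^ j⌋₊) (Nat.zero_le n) this

theorem InC.sm {g : ℝ → ℝ} {A : ℝ} (hA : ∀ x y, g x - g y ≤ A) {n : ℕ} {c : ℕ × ℕ} {ρ : ℝ} (h : InC g A n c ρ) :
    sm g A c.1 c.2 := by
  have := lev_sm hA n ρ
  rw [h.2.1, h.2.2] at this; exact this

theorem le_lev {g : ℝ → ℝ} {A : ℝ} {n j : ℕ} {ρ : ℝ} (hj : j ≤ n) (h : sm g A j ⌊ρ / 2 ^ j⌋₊) : j ≤ lev g A n ρ := by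
  classical
  exact Nat.le_findGreatest (P := fun j => sm g A j ⌊ρ / 2 ^ j⌋₊) hj h

theorem InC.osc {g : ℝ → ℝ} (hg : Monotone g) {A : ℝ} (hA : ∀ x y, g x - g y ≤ A) {n : ℕ} {c : ℕ × ℕ} {ρ : ℝ} (h : InC g A n c ρ) :
    2 ^ c.1 * |g ρ - g (c.2 * 2 ^ c.1)| ≤ A := by
  have h1 := h.sm hA
  obtain ⟨h2, h3⟩ := h.mem
  have hp : (0:ℝ) < 2 ^ c.1 := by positivity
  have h4 := hg h2
  have h5 : g ρ ≤ g ((c.2 + 2) * 2 ^ c.1) := hg (by nlinarith)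
  have h6 : g ((c.2 - 1) * 2 ^ c.1) ≤ g (c.2 * 2 ^ c.1) := hg (by nlinarith)
  rw [abs_of_nonneg (by linarith)]
  refine le_trans ?_ h1
  gcongr

theorem lev_near {g : ℝ → ℝ} (hg : Monotone g) {A : ℝ} (hA : ∀ x y, g x - g y ≤ A) {n : ℕ} {ρ ρ' : ℝ} (h0 : 0 ≤ ρ) (h0' : 0 ≤ ρ')
    (h : |ρ - ρ'| ≤ 2 ^ (lev g A n ρ) / 4) : lev g A n ρ ≤ lev g A n ρ' + 2 := by
  by_contra hcon
  push Not at hcon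
  set j := lev g A n ρ with hj
  obtain ⟨i, hi⟩ : ∃ i, j = i + 2 := ⟨j - 2, by omega⟩
  have h1 := lev_sm hA n ρ
  rw [← hj] at h1
  have h2 : sm g A i ⌊ρ' / 2 ^ i⌋₊ := by
    have a1 := Nat.floor_le (a := ρ / 2 ^ j) (by positivity)
    have a2 := Nat.lt_floor_add_one (ρ / 2 ^ j)
    have b1 := Nat.floor_le (a := ρ' / 2 ^ i) (by positivity)
    have b2 := Nat.lt_floor_add_one (ρ' / 2 ^ i)
    unfold sm at h1 ⊢
    set m : ℝ := ((⌊ρ / 2 ^ j⌋₊ : ℕ) : ℝ)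
    set m' : ℝ := ((⌊ρ' / 2 ^ i⌋₊ : ℕ) : ℝ)
    have hp : (0:ℝ) < 2 ^ i := by positivity
    have hpj : (2:ℝ) ^ j = 4 * 2 ^ i := by rw [hi, pow_add]; norm_num; ring
    rw [le_div_iff₀ (by positivity)] at a1 b1
    rw [div_lt_iff₀ (by positivity)] at a2 b2
    obtain ⟨c1, c2⟩ := abs_le.1 h
    clear_value m m'
    rw [hpj] at a1 a2 c1 c2 h1
    have d1 : g ((m' + 2) * 2 ^ i) ≤ g ((m + 2) * (4 * 2 ^ i)) := hg (by nlinarith)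
    have d2 : g ((m - 1) * (4 * 2 ^ i)) ≤ g ((m' - 1) * 2 ^ i) := hg (by nlinarith)
    refine le_trans ?_ h1
    have : 0 ≤ g ((m' + 2) * 2 ^ i) - g ((m' - 1) * 2 ^ i) := sub_nonneg.2 (hg (by nlinarith))
    nlinarith
  have h3 := le_lev (n := n) (by have := lev_le g A n ρ; omega) h2
  omega

open Classical in
def cells (g : ℝ → ℝ) (A : ℝ) (n : ℕ) : Finset (ℕ × ℕ) :=
  (Finset.range (n + 1) ×ˢ Finset.range (2 ^ n)).filter fun c => ∃ ρ, ρ < 2 ^ n ∧ InC g A n c ρ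

theorem mem_cells {g : ℝ → ℝ} {A : ℝ} {n : ℕ} {c : ℕ × ℕ} {ρ : ℝ} (hρ : ρ < 2 ^ n) (h : InC g A n c ρ) : c ∈ cells g A n := by
  classical
  unfold cells
  rw [Finset.mem_filter, Finset.mem_product, Finset.mem_range, Finset.mem_range]
  refine ⟨⟨?_, ?_⟩, ρ, hρ, h⟩
  · have := lev_le g A n ρ; rw [h.2.1] at this; omega
  · have h1 := h.mem.1
    have h2 : (c.2 : ℝ) < 2 ^ n := by
      have : (1:ℝ) ≤ 2 ^ c.1 := one_le_pow₀ one_le_two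
      have h3 : (0:ℝ) ≤ c.2 := Nat.cast_nonneg _
      nlinarith
    exact_mod_cast h2

open Classical in
theorem overlap {g : ℝ → ℝ} (hg : Monotone g) {A : ℝ} (hA : ∀ x y, g x - g y ≤ A) {n : ℕ} (ρ' : ℝ) (h0 : 0 ≤ ρ') :
    ((cells g A n).filter fun c => ∃ ρ, InC g A n c ρ ∧ |ρ - ρ'| ≤ 2 ^ c.1 / 4).card ≤ 15 := by
  set j' := lev g A n ρ' with hj'
  have hsub : ((cells g A n).filter fun c => ∃ ρ, InC g A n c ρ ∧ |ρ - ρ'| ≤ 2 ^ c.1 / 4) ⊆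
      (Finset.Icc (j' - 2) (j' + 2)).biUnion fun j => (Finset.Icc (⌊ρ' / 2 ^ j⌋₊ - 1) (⌊ρ' / 2 ^ j⌋₊ + 1)).image fun m => (j, m) := by
    rintro ⟨j, m⟩ hc
    rw [Finset.mem_filter] at hc
    obtain ⟨_, ρ, hρ, hd⟩ := hc
    have hj := hρ.2.1
    simp only at hj hd
    rw [← hj] at hd
    have h1 := lev_near hg hA hρ.1 h0 hd
    have h2 : j' ≤ j + 2 := by
      by_contra hcon
      push Not at hcon
      have hd' : |ρ' - ρ| ≤ 2 ^ (lev g A n ρ') / 4 := by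
        rw [abs_sub_comm]; refine hd.trans ?_
        rw [hj, ← hj']; gcongr
        · norm_num
        · omega
      have := lev_near hg hA h0 hρ.1 hd'
      omega
    rw [Finset.mem_biUnion]
    refine ⟨j, by rw [Finset.mem_Icc]; omega, ?_⟩
    rw [Finset.mem_image]
    refine ⟨m, ?_, rfl⟩
    rw [hj] at hd
    have hp : (0:ℝ) < 2 ^ j := by positivity
    obtain ⟨a1, a2⟩ := hρ.mem
    simp only at a1 a2
    have b1 := Nat.floor_le (a := ρ' / 2 ^ j) (by positivity)
    have b2 := Nat.lt_floor_add_one (ρ' / 2 ^ j)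
    rw [le_div_iff₀ hp] at b1
    rw [div_lt_iff₀ hp] at b2
    obtain ⟨c1, c2⟩ := abs_le.1 hd
    have e1 : (m:ℝ) < (⌊ρ' / 2 ^ j⌋₊ : ℕ) + 2 := by
      by_contra hh; push Not at hh; nlinarith
    have e2 : ((⌊ρ' / 2 ^ j⌋₊ : ℕ) : ℝ) < m + 2 := by
      by_contra hh; push Not at hh; nlinarith
    have e1' : m < ⌊ρ' / 2 ^ j⌋₊ + 2 := by exact_mod_cast e1
    have e2' : ⌊ρ' / 2 ^ j⌋₊ < m + 2 := by exact_mod_cast e2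
    rw [Finset.mem_Icc]; omega
  refine (Finset.card_le_card hsub).trans ((Finset.card_biUnion_le_card_mul _ _ 3 ?_).trans ?_)
  · intro j _
    refine Finset.card_image_le.trans ?_
    rw [Nat.card_Icc]; omega
  · rw [Nat.card_Icc]; omega

open Classical in
theorem packing {g : ℝ → ℝ} (hg : Monotone g) {A : ℝ} (hA1 : 1 ≤ A) {n : ℕ}
    {b0 : ℝ} (hb0 : 0 < b0) (p L : ℝ) (hL : 1 / b0 ≤ L) :
    ∑ c ∈ cells g A n with (b0 ≤ 2 ^ c.1 ∧ |g (c.2 * 2 ^ c.1) - p| ≤ L), 1 / (2:ℝ) ^ c.1 ≤ 289 * L := by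
  have hL0 : 0 < L := lt_of_lt_of_le (by positivity) hL
  set T := (cells g A n).filter (fun c => b0 ≤ 2 ^ c.1 ∧ |g (c.2 * 2 ^ c.1) - p| ≤ L) with hT
  have hTb : ∀ c ∈ T, 1 / (2:ℝ) ^ c.1 ≤ L := fun c hc =>
    (one_div_le_one_div_of_le hb0 (Finset.mem_filter.1 hc).2.1).trans hL
  have hTc : ∀ c ∈ T, c.1 ≤ n ∧ ∃ ρ, ρ < 2 ^ n ∧ InC g A n c ρ := fun c hc => by
    have := (Finset.mem_filter.1 hc).1
    unfold cells at this
    rw [Finset.mem_filter, Finset.mem_product, Finset.mem_range] at this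
    exact ⟨by omega, this.2⟩
  rw [← Finset.sum_filter_add_sum_filter_not T (fun c => c.1 = n)]
  have hA' : ∑ c ∈ T with c.1 = n, 1 / (2:ℝ) ^ c.1 ≤ L := by
    have : ∀ c ∈ T.filter (fun c => c.1 = n), c = (n, 0) := by
      intro c hc
      rw [Finset.mem_filter] at hc
      obtain ⟨_, ρ, h1, h2⟩ := hTc c hc.1
      have h3 := h2.mem.1
      rw [hc.2] at h3
      have h4 : (c.2:ℝ) < 1 := by
        by_contra hh; push Not at hh
        have : (0:ℝ) < 2 ^ n := by positivity
        nlinarith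
      have h5 : c.2 < 1 := by exact_mod_cast h4
      exact Prod.ext hc.2 (by simp; omega)
    have hsub : T.filter (fun c => c.1 = n) ⊆ {(n, 0)} := fun c hc => Finset.mem_singleton.2 (this c hc)
    rcases Finset.subset_singleton_iff.1 hsub with h | h
    · rw [h]; simpa using hL0.le
    · rw [h, Finset.sum_singleton]
      exact hTb _ (Finset.mem_filter.1 (h ▸ Finset.mem_singleton_self (n, 0))).1
  set h : ℝ → ℝ := fun x => max (p - 2 * L) (min (p + 2 * L) (g x)) with hh
  have hhm : Monotone h := fun x y hxy => max_le_max le_rfl (min_le_min le_rfl (hg hxy))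
  have hhV : ∀ x y, h x - h y ≤ 4 * L := by
    intro x y
    have h1 : h x ≤ p + 2 * L := max_le (by linarith) (min_le_left _ _)
    have h2 : p - 2 * L ≤ h y := le_max_left _ _
    linarith
  set φ : ℕ → ℕ × ℕ → ℕ × ℤ := fun k c => (c.1 + 1, ((c.2 / 2 : ℕ) : ℤ) - 1 + k) with hφ
  set good : ℕ → ℕ × ℕ → Prop := fun k c => 1/3 * (1/2:ℝ) ^ (φ k c).1 ≤ h (((φ k c).2 + 1) * 2 ^ (φ k c).1) - h ((φ k c).2 * 2 ^ (φ k c).1) with hgood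
  have hex : ∀ c ∈ T.filter (fun c => ¬ c.1 = n), ∃ k ∈ Finset.range 3, good k c := by
    intro c hc
    rw [Finset.mem_filter] at hc
    obtain ⟨hcn, ρ, h1, h2⟩ := hTc c hc.1
    have hns : ¬ sm g A (c.1 + 1) (c.2 / 2) := by
      intro hs
      have : ⌊ρ / 2 ^ (c.1 + 1)⌋₊ = c.2 / 2 := by
        rw [pow_succ, ← div_div, ← h2.2.2, ← Nat.floor_div_natCast]; norm_num
      rw [← this] at hs
      have := le_lev (n := n) (by omega) hs
      rw [h2.2.1] at this; omega
    unfold sm at hns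
    push Not at hns
    set i := c.1 + 1 with hi
    set M := c.2 / 2 with hM
    have hp : (0:ℝ) < 2 ^ i := by positivity
    have hiL : (1/2:ℝ) ^ i ≤ L := by
      have := hTb c hc.1
      refine le_trans ?_ this
      rw [hi, one_div_pow]
      apply one_div_le_one_div_of_le (by positivity)
      rw [pow_succ]; have : (0:ℝ) < 2 ^ c.1 := by positivity
      linarith
    have hdiff : (1/2:ℝ) ^ i ≤ g ((M + 2) * 2 ^ i) - g ((M - 1) * 2 ^ i) := by
      rw [one_div_pow, div_le_iff₀ hp]; linarith
    have hx := abs_le.1 (Finset.mem_filter.1 hc.1).2.2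
    set x := g (c.2 * 2 ^ c.1) with hxd
    have hMc : (2:ℝ) * M ≤ c.2 ∧ (c.2:ℝ) ≤ 2 * M + 1 := by
      have : 2 * M ≤ c.2 ∧ c.2 ≤ 2 * M + 1 := by omega
      exact_mod_cast this
    have hpi : (2:ℝ) ^ i = 2 * 2 ^ c.1 := by rw [hi, pow_succ]; ring
    have hpc : (0:ℝ) < 2 ^ c.1 := by positivity
    have hlo : g ((M - 1) * 2 ^ i) ≤ x := hg (by rw [hpi]; nlinarith)
    have hhi : x ≤ g ((M + 2) * 2 ^ i) := hg (by rw [hpi]; nlinarith)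
    have hdh : (1/2:ℝ) ^ i ≤ h ((M + 2) * 2 ^ i) - h ((M - 1) * 2 ^ i) := by
      simp only [hh]
      set u := g ((M + 2) * 2 ^ i)
      set v := g ((M - 1) * 2 ^ i)
      have e1 : min (p + 2 * L) u ≤ max (p - 2 * L) (min (p + 2 * L) u) := le_max_right _ _
      have e2 : max (p - 2 * L) (min (p + 2 * L) v) ≤ max (p - 2 * L) v := max_le_max le_rfl (min_le_right _ _)
      have e3 : x + (1/2:ℝ) ^ i ≤ p + 2 * L := by linarith
      rcases le_total (p + 2 * L) u with h3 | h3 <;> rcases le_total (p - 2 * L) v with h4 | h4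
      · rw [min_eq_left h3] at *; rw [max_eq_right h4] at e2; linarith
      · rw [min_eq_left h3] at *; rw [max_eq_left h4] at e2; linarith
      · rw [min_eq_right h3] at *; rw [max_eq_right h4] at e2; linarith
      · rw [min_eq_right h3] at *; rw [max_eq_left h4] at e2; linarith
    by_contra hcon
    push Not at hcon
    have k0 := hcon 0 (by simp)
    have k1 := hcon 1 (by simp)
    have k2 := hcon 2 (by simp)
    simp only [hgood, hφ, not_le, ← hM, Int.cast_add, Int.cast_sub, Int.cast_natCast, Int.cast_one, Nat.cast_zero, Nat.cast_one, Nat.cast_ofNat, Int.cast_zero, Int.cast_ofNat] at k0 k1 k2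
    rw [show ((M:ℝ) - 1 + 0 + 1) = M by ring, show ((M:ℝ) - 1 + 0) = M - 1 by ring] at k0
    rw [show ((M:ℝ) - 1 + 1 + 1) = M + 1 by ring, show ((M:ℝ) - 1 + 1) = M by ring] at k1
    rw [show ((M:ℝ) - 1 + 2 + 1) = M + 2 by ring, show ((M:ℝ) - 1 + 2) = M + 1 by ring] at k2
    linarith
  have hke : ∀ k e : ℕ, ∑ c ∈ T.filter (fun c => ¬ c.1 = n) with (good k c ∧ c.2 % 2 = e), 1 / (2:ℝ) ^ c.1 ≤ 48 * L := by
    intro k e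
    set X := (T.filter (fun c => ¬ c.1 = n)).filter (fun c => good k c ∧ c.2 % 2 = e) with hX
    have hinj : Set.InjOn (φ k) (X : Set (ℕ × ℕ)) := by
      intro c hc c' hc' hcc
      have h1 := (Finset.mem_filter.1 hc).2.2
      have h2 := (Finset.mem_filter.1 hc').2.2
      simp only [hφ, Prod.mk.injEq] at hcc
      exact Prod.ext (by omega) (by omega)
    have h3 := packW (X.image (φ k)) h hhm (c := 1/3) (by norm_num) hhV (by
      intro W hW
      obtain ⟨c, hc, rfl⟩ := Finset.mem_image.1 hW
      exact (Finset.mem_filter.1 hc).2.1)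
    rw [Finset.sum_image hinj] at h3
    have h4 : ∑ c ∈ X, 1 / (2:ℝ) ^ c.1 = 2 * ∑ c ∈ X, (1/2:ℝ) ^ (φ k c).1 := by
      rw [Finset.mul_sum]; apply Finset.sum_congr rfl; intro c _
      simp only [hφ]; rw [pow_succ, one_div_pow]; ring
    rw [h4]; linarith
  have hB : ∑ c ∈ T with ¬ c.1 = n, 1 / (2:ℝ) ^ c.1 ≤ 288 * L := by
    calc ∑ c ∈ T with ¬ c.1 = n, 1 / (2:ℝ) ^ c.1 ≤ ∑ c ∈ T with ¬ c.1 = n, ∑ k ∈ Finset.range 3, ∑ e ∈ Finset.range 2, if (good k c ∧ c.2 % 2 = e) then 1 / (2:ℝ) ^ c.1 else 0 := by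
          apply Finset.sum_le_sum; intro c hc
          obtain ⟨k, hk, hgk⟩ := hex c hc
          have hn : ∀ k e, 0 ≤ if (good k c ∧ c.2 % 2 = e) then 1 / (2:ℝ) ^ c.1 else 0 := fun k e => by split_ifs <;> positivity
          refine le_trans ?_ (Finset.single_le_sum (f := fun k => ∑ e ∈ Finset.range 2, if (good k c ∧ c.2 % 2 = e) then 1 / (2:ℝ) ^ c.1 else 0) (fun k _ => Finset.sum_nonneg fun e _ => hn k e) hk)
          refine le_trans ?_ (Finset.single_le_sum (f := fun e => if (good k c ∧ c.2 % 2 = e) then 1 / (2:ℝ) ^ c.1 else 0) (fun e _ => hn k e) (Finset.mem_range.2 (Nat.mod_lt c.2 two_pos)))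
          simp [hgk]
      _ = ∑ k ∈ Finset.range 3, ∑ e ∈ Finset.range 2, ∑ c ∈ T.filter (fun c => ¬ c.1 = n) with (good k c ∧ c.2 % 2 = e), 1 / (2:ℝ) ^ c.1 := by
          rw [Finset.sum_comm]; apply Finset.sum_congr rfl; intro k _
          rw [Finset.sum_comm]; apply Finset.sum_congr rfl; intro e _
          rw [← Finset.sum_filter]
      _ ≤ ∑ k ∈ Finset.range 3, ∑ e ∈ Finset.range 2, 48 * L := Finset.sum_le_sum fun k _ => Finset.sum_le_sum fun e _ => hke k e
      _ = 288 * L := by simp; ring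
  linarith

theorem n2_mono {α : Type*} [MeasureSpace α] {G H : α → ℂ} (h : ∀ y, ‖G y‖ ≤ ‖H y‖) : n2 G ≤ n2 H := by
  unfold n2
  refine lintegral_mono fun y => ?_
  have : ‖G y‖ₑ ≤ ‖H y‖ₑ := by rw [enorm_le_iff_norm_le]; exact h y
  gcongr

theorem enorm_sq_eq (z : ℂ) : ‖z‖ₑ ^ 2 = ENNReal.ofReal (‖z‖ ^ 2) := by
  rw [ENNReal.ofReal_pow (norm_nonneg _), ofReal_norm]

theorem n2_cmul {α : Type*} [MeasureSpace α] {G : α → ℂ} (c : ℂ) :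
    n2 (fun y => c * G y) = ENNReal.ofReal (‖c‖ ^ 2) * n2 G := by
  unfold n2
  rw [← lintegral_const_mul' _ _ ENNReal.ofReal_ne_top]
  refine lintegral_congr fun y => ?_
  rw [← enorm_sq_eq, enorm_mul, mul_pow]

theorem n2_le_cmul {α : Type*} [MeasureSpace α] {G H : α → ℂ} {c : ℝ} (h : ∀ y, ‖G y‖ ≤ c * ‖H y‖) :
    n2 G ≤ ENNReal.ofReal (c ^ 2) * n2 H := by
  have := n2_cmul (G := H) (c : ℂ)
  rw [Complex.norm_real, Real.norm_eq_abs, sq_abs] at this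
  rw [← this]
  refine n2_mono fun y => (h y).trans ?_
  rw [norm_mul, Complex.norm_real, Real.norm_eq_abs]
  exact mul_le_mul_of_nonneg_right (le_abs_self c) (norm_nonneg _)

theorem n2_sum_ov {α ι : Type*} [MeasureSpace α] [DecidableEq ι] (J : Finset ι) (G : ι → α → ℂ) (hG : ∀ j ∈ J, Measurable (G j))
    (M : ℕ) (hM : ∀ y, ∃ S : Finset ι, S ⊆ J ∧ S.card ≤ M ∧ ∀ j ∈ J, j ∉ S → G j y = 0) :
    n2 (fun y => ∑ j ∈ J, G j y) ≤ M * ∑ j ∈ J, n2 (G j) := by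
  unfold n2
  rw [← lintegral_finsetSum' _ (fun j hj => ((hG j hj).enorm.pow_const 2).aemeasurable), ← lintegral_const_mul' _ _ (ENNReal.natCast_ne_top _)]
  refine lintegral_mono fun y => ?_
  obtain ⟨S, hS, hc, h0⟩ := hM y
  have e1 : ∑ j ∈ J, G j y = ∑ j ∈ S, G j y := (Finset.sum_subset hS h0).symm
  simp only [e1]
  have h1 : ‖∑ j ∈ S, G j y‖ ^ 2 ≤ M * ∑ j ∈ S, ‖G j y‖ ^ 2 := by
    calc ‖∑ j ∈ S, G j y‖ ^ 2 ≤ (∑ j ∈ S, ‖G j y‖) ^ 2 := by gcongr; exact norm_sum_le _ _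
      _ ≤ S.card * ∑ j ∈ S, ‖G j y‖ ^ 2 := sq_sum_le_card_mul_sum_sq
      _ ≤ M * ∑ j ∈ S, ‖G j y‖ ^ 2 := by gcongr
  calc ‖∑ j ∈ S, G j y‖ₑ ^ 2 = ENNReal.ofReal (‖∑ j ∈ S, G j y‖ ^ 2) := enorm_sq_eq _
    _ ≤ ENNReal.ofReal (M * ∑ j ∈ S, ‖G j y‖ ^ 2) := ENNReal.ofReal_le_ofReal h1
    _ = M * ∑ j ∈ S, ‖G j y‖ₑ ^ 2 := by
      rw [ENNReal.ofReal_mul (by positivity), ENNReal.ofReal_natCast, ENNReal.ofReal_sum_of_nonneg (fun _ _ => by positivity)]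
      simp only [enorm_sq_eq]
    _ ≤ M * ∑ j ∈ J, ‖G j y‖ₑ ^ 2 := by
      gcongr

theorem n2_sum_le {α ι : Type*} [MeasureSpace α] (J : Finset ι) (G : ι → α → ℂ) (hG : ∀ j ∈ J, Measurable (G j)) :
    n2 (fun y => ∑ j ∈ J, G j y) ≤ J.card * ∑ j ∈ J, n2 (G j) := by
  classical
  exact n2_sum_ov J G hG _ fun y => ⟨J, subset_rfl, le_rfl, fun j h1 h2 => absurd h1 h2⟩

theorem n2_add_le {α : Type*} [MeasureSpace α] {G H : α → ℂ} (hG : Measurable G) (hH : Measurable H) :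
    n2 (fun y => G y + H y) ≤ 2 * (n2 G + n2 H) := by
  have := n2_sum_le (Finset.univ : Finset (Fin 2)) ![G, H] (by intro j _; fin_cases j <;> simpa)
  simpa [Fin.sum_univ_two] using this

theorem n2_parts {α ι : Type*} [MeasureSpace α] (J : Finset ι) (F : α → ℂ) (hF : Measurable F) (s : ι → Set α) (hs : ∀ j, MeasurableSet (s j))
    (hd : ∀ i j x, x ∈ s i → x ∈ s j → i = j) :
    ∑ j ∈ J, n2 ((s j).indicator F) ≤ n2 F := by
  unfold n2
  rw [← lintegral_finsetSum' _ (fun j hj => ((hF.indicator (hs j)).enorm.pow_const 2).aemeasurable)]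
  refine lintegral_mono fun y => ?_
  by_cases h : ∃ i ∈ J, y ∈ s i
  · obtain ⟨i, hi, hy⟩ := h
    rw [Finset.sum_eq_single_of_mem i hi]
    · rw [Set.indicator_of_mem hy]
    · intro j _ hji
      rw [Set.indicator_of_notMem (fun h => hji (hd _ _ _ h hy))]; simp
  · push Not at h
    rw [Finset.sum_eq_zero]
    · exact zero_le
    · intro j hj
      rw [Set.indicator_of_notMem (h j hj)]; simp

open Classical in
theorem BB.ind {d : ℕ} {F : Euc d → ℂ} (h : BB F) {s : Set (Euc d)} (hs : MeasurableSet s) : BB (s.indicator F) := by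
  obtain ⟨h1, M, R, h2⟩ := h
  refine ⟨h1.indicator hs, M, R, fun ξ => ⟨(norm_indicator_le_norm_self _ _).trans (h2 ξ).1, fun hR => ?_⟩⟩
  rw [Set.indicator_apply, (h2 ξ).2 hR, ite_self]

theorem BB.n2_ne_top {d : ℕ} {F : Euc d → ℂ} (h : BB F) : n2 F ≠ ⊤ := by
  rw [n2_ofReal h.sq_int]; exact ENNReal.ofReal_ne_top

def VV {d : ℕ} (k : Euc d → Euc d → ℂ) (F : Euc d → ℂ) (y : Euc d) : ℂ :=
  ∫ ξ, Complex.exp (Complex.I * ((⟪y, ξ⟫ : ℝ) : ℂ)) * (k y ξ * F ξ)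

theorem VV_meas {d : ℕ} {k : Euc d → Euc d → ℂ} (hk : Measurable (Function.uncurry k)) {F : Euc d → ℂ} (hF : Measurable F) :
    Measurable (VV k F) := by
  have : StronglyMeasurable (VV k F) := by
    unfold VV
    apply StronglyMeasurable.integral_prod_right' (f := fun p : Euc d × Euc d => Complex.exp (Complex.I * ((⟪p.1, p.2⟫ : ℝ) : ℂ)) * (k p.1 p.2 * F p.2))
    apply Measurable.stronglyMeasurable
    have h1 : Continuous fun p : Euc d × Euc d => Complex.exp (Complex.I * ((⟪p.1, p.2⟫ : ℝ) : ℂ)) := by fun_prop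
    exact h1.measurable.mul (hk.mul (hF.comp measurable_snd))
  exact this.measurable

theorem VV_int {d : ℕ} {k : Euc d → Euc d → ℂ} (hk : Measurable (Function.uncurry k)) {F : Euc d → ℂ} (hF : Integrable F) (y : Euc d)
    {M : ℝ} (hM : ∀ ξ, ‖k y ξ‖ ≤ M) : Integrable fun ξ => Complex.exp (Complex.I * ((⟪y, ξ⟫ : ℝ) : ℂ)) * (k y ξ * F ξ) := by
  have h1 : Continuous fun ξ : Euc d => Complex.exp (Complex.I * ((⟪y, ξ⟫ : ℝ) : ℂ)) := by fun_prop
  have h2 : Measurable (k y) := hk.comp (measurable_const.prodMk measurable_id)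
  refine Integrable.bdd_mul (c := 1) (Integrable.bdd_mul (c := M) hF h2.aestronglyMeasurable (ae_of_all _ hM)) h1.aestronglyMeasurable (ae_of_all _ fun ξ => ?_)
  rw [mul_comm Complex.I, Complex.norm_exp_ofReal_mul_I]

theorem VV_sum {d : ℕ} {ι : Type*} (J : Finset ι) {k : ι → Euc d → Euc d → ℂ} (hk : ∀ j, Measurable (Function.uncurry (k j))) {F : ι → Euc d → ℂ} (hF : ∀ j, Integrable (F j)) (y : Euc d)
    {M : ℝ} (hM : ∀ j ξ, ‖k j y ξ‖ ≤ M) : ∑ j ∈ J, VV (k j) (F j) y = ∫ ξ, Complex.exp (Complex.I * ((⟪y, ξ⟫ : ℝ) : ℂ)) * ∑ j ∈ J, (k j y ξ * F j ξ) := by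
  simp only [Finset.mul_sum]
  unfold VV
  rw [integral_finsetSum]
  exact fun j _ => VV_int (hk j) (hF j) y (hM j)

theorem VV_ae0 {d : ℕ} {k : Euc d → Euc d → ℂ} {F : Euc d → ℂ} (hF : Measurable F) (h : n2 F = 0) (y : Euc d) : VV k F y = 0 := by
  unfold n2 at h
  rw [lintegral_eq_zero_iff (hF.enorm.pow_const 2)] at h
  unfold VV
  apply integral_eq_zero_of_ae
  filter_upwards [h] with ξ hξ
  have : F ξ = 0 := by simpa using hξ
  simp [this]

def F1P {d : ℕ} (e0 : Euc d) (K : Set (Euc d)) (ψ : Euc d → ℂ) (C : ℝ) : Prop :=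
    ∀ (a : ℝ) (F : Euc d → ℂ), BB F →
      (∀ ξ, F ξ ≠ 0 → 0.99 * ‖ξ‖ ≤ ⟪ξ, e0⟫ ∧ a ≤ ‖ξ‖ ∧ ‖ξ‖ < a + 1) →
      ∀ (κ : ℝ → ℝ → ℂ) (τ : ℝ → ℝ), Measurable (Function.uncurry κ) → Measurable τ →
      (∃ M, ∀ r, τ r ≤ M) → (∀ r ρ, ‖κ r ρ‖ ≤ τ r) →
      n2 (fun y => ψ y * VV (fun y ξ => κ ‖y‖ ‖ξ‖) F y) ≤
        ENNReal.ofReal (C * ∫ y in K, τ ‖y‖ ^ 2) * n2 F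

theorem kap_meas {d : ℕ} {κ : ℝ → ℝ → ℂ} (hκ : Measurable (Function.uncurry κ)) :
    Measurable (Function.uncurry fun (y ξ : Euc d) => κ ‖y‖ ‖ξ‖) :=
  hκ.comp (f := fun p : Euc d × Euc d => (‖p.1‖, ‖p.2‖)) (by fun_prop)

theorem shells {d : ℕ} {e0 : Euc d} {K : Set (Euc d)} {ψ : Euc d → ℂ} {C : ℝ} (h : F1P e0 K ψ C) (hψ : Measurable ψ)
    (N : ℕ) (a : ℝ) (F : Euc d → ℂ) (hF : BB F) (hs : ∀ ξ, F ξ ≠ 0 → 0.99 * ‖ξ‖ ≤ ⟪ξ, e0⟫ ∧ a ≤ ‖ξ‖ ∧ ‖ξ‖ < a + N)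
    (κ : ℝ → ℝ → ℂ) (τ : ℝ → ℝ) (hκ : Measurable (Function.uncurry κ)) (hτ : Measurable τ)
    {M : ℝ} (hM : ∀ r, τ r ≤ M) (hκτ : ∀ r ρ, ‖κ r ρ‖ ≤ τ r) :
      n2 (fun y => ψ y * VV (fun y ξ => κ ‖y‖ ‖ξ‖) F y) ≤
        N * (ENNReal.ofReal (C * ∫ y in K, τ ‖y‖ ^ 2) * n2 F) := by
  set s : ℕ → Set (Euc d) := fun i => {ξ | a + i ≤ ‖ξ‖ ∧ ‖ξ‖ < a + i + 1} with hsd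
  have hsm : ∀ i, MeasurableSet (s i) := fun i =>
    (measurableSet_le measurable_const measurable_norm).inter (measurableSet_lt measurable_norm measurable_const)
  have hdis : ∀ i j x, x ∈ s i → x ∈ s j → i = j := by
    intro i j x hi hj
    simp only [hsd, Set.mem_ofPred_eq] at hi hj
    have h1 : (i:ℝ) < j + 1 := by linarith
    have h2 : (j:ℝ) < i + 1 := by linarith
    have h1' : i < j + 1 := by exact_mod_cast h1
    have h2' : j < i + 1 := by exact_mod_cast h2
    omega
  have hsum : ∀ y, ψ y * VV (fun y ξ => κ ‖y‖ ‖ξ‖) F y = ∑ i ∈ Finset.range N, ψ y * VV (fun y ξ => κ ‖y‖ ‖ξ‖) ((s i).indicator F) y := by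
    intro y
    rw [← Finset.mul_sum, VV_sum _ (fun _ => kap_meas hκ) (fun i => (hF.ind (hsm i)).integrable) y (M := M) (fun _ ξ => (hκτ _ _).trans (hM _))]
    unfold VV
    congr 2
    ext ξ
    rw [← Finset.mul_sum]
    congr 2
    by_cases hξ : F ξ = 0
    · rw [hξ, Finset.sum_eq_zero]; intro i _; rw [Set.indicator_apply_eq_zero]; exact fun _ => hξ
    · obtain ⟨_, h1, h2⟩ := hs ξ hξ
      have f1 := Nat.floor_le (a := ‖ξ‖ - a) (by linarith)
      have f2 := Nat.lt_floor_add_one (‖ξ‖ - a)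
      have hmem : ξ ∈ s ⌊‖ξ‖ - a⌋₊ := ⟨by linarith, by linarith⟩
      rw [Finset.sum_eq_single_of_mem ⌊‖ξ‖ - a⌋₊]
      · rw [Set.indicator_of_mem hmem]
      · rw [Finset.mem_range]
        have : ((⌊‖ξ‖ - a⌋₊ : ℕ) : ℝ) < N := by linarith
        exact_mod_cast this
      · intro j _ hj
        exact Set.indicator_of_notMem (fun hh => hj (hdis _ _ _ hh hmem)) _
  simp only [hsum]
  refine (n2_sum_le _ _ fun i _ => hψ.mul (VV_meas (kap_meas hκ) (hF.ind (hsm i)).1)).trans ?_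
  rw [Finset.card_range]
  gcongr
  refine le_trans (Finset.sum_le_sum fun i _ => h (a + i) _ (hF.ind (hsm i)) ?_ κ τ hκ hτ ⟨M, hM⟩ hκτ) ?_
  · intro ξ hξ
    have hm := Set.mem_of_indicator_ne_zero hξ
    rw [Set.indicator_of_mem hm] at hξ
    exact ⟨(hs ξ hξ).1, hm.1, hm.2⟩
  · rw [← Finset.mul_sum]
    gcongr
    exact n2_parts _ F hF.1 s hsm hdis

theorem shell_vol {d : ℕ} (hd : 1 ≤ d) {K : Set (Euc d)} {R : ℝ} (hR : 0 ≤ R) (hK : ∀ y ∈ K, ‖y‖ ≤ R) (hKm : MeasurableSet K) :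
    ∃ c : ℝ, 0 ≤ c ∧ ∀ p L, 0 < L → ((volume.restrict K).map (fun y : Euc d => ‖y‖)) (Metric.closedBall p L) ≤ ENNReal.ofReal (c * L) := by
  haveI : Nonempty (Fin d) := ⟨⟨0, hd⟩⟩
  set v := (volume (Metric.ball (0 : Euc d) 1)).toReal with hv
  have hv0 : 0 ≤ v := ENNReal.toReal_nonneg
  have hvt : volume (Metric.ball (0 : Euc d) 1) = ENNReal.ofReal v := (ENNReal.ofReal_toReal measure_ball_lt_top.ne).symm
  refine ⟨2 * d * R ^ (d - 1) * v, by positivity, fun p L hL => ?_⟩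
  rw [Measure.map_apply measurable_norm Metric.isClosed_closedBall.measurableSet, Measure.restrict_apply (measurable_norm Metric.isClosed_closedBall.measurableSet)]
  set b := min (p + L) R with hb
  set a := max (p - L) 0 with ha
  have hsub : (fun y : Euc d => ‖y‖) ⁻¹' Metric.closedBall p L ∩ K ⊆ Metric.closedBall 0 b \ Metric.ball 0 a := by
    rintro y ⟨h1, h2⟩
    rw [Set.mem_preimage, Metric.mem_closedBall, Real.dist_eq, abs_le] at h1
    rw [Set.mem_sdiff, mem_closedBall_zero_iff, mem_ball_zero_iff, not_lt]
    exact ⟨le_min (by linarith) (hK y h2), max_le (by linarith) (norm_nonneg _)⟩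
  by_cases hab : a ≤ b
  · have ha0 : 0 ≤ a := le_max_right _ _
    have hbR : b ≤ R := min_le_right _ _
    have hba : b - a ≤ 2 * L := by
      have := min_le_left (p + L) R; have := le_max_left (p - L) 0; linarith
    refine (measure_mono hsub).trans ?_
    rw [measure_sdiff ((Metric.ball_subset_ball hab).trans Metric.ball_subset_closedBall) Metric.isOpen_ball.measurableSet.nullMeasurableSet measure_ball_lt_top.ne]
    rw [Measure.addHaar_closedBall _ _ (ha0.trans hab), Measure.addHaar_ball _ _ ha0, hvt, ← ENNReal.ofReal_mul (pow_nonneg (ha0.trans hab) _), ← ENNReal.ofReal_mul (pow_nonneg ha0 _), ← ENNReal.ofReal_sub _ (by positivity)]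
    apply ENNReal.ofReal_le_ofReal
    rw [finrank_euclideanSpace_fin, ← sub_mul]
    have key : b ^ d - a ^ d ≤ d * R ^ (d - 1) * (b - a) := by
      rw [← mul_comm (b - a), ← (Commute.all b a).mul_geom_sum₂]
      apply mul_le_mul_of_nonneg_left _ (by linarith)
      calc ∑ i ∈ Finset.range d, b ^ i * a ^ (d - 1 - i) ≤ ∑ i ∈ Finset.range d, R ^ (d - 1) := by
            apply Finset.sum_le_sum; intro i hi
            rw [Finset.mem_range] at hi
            have : d - 1 = i + (d - 1 - i) := by omega
            conv_rhs => rw [this, pow_add]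
            gcongr
            · linarith
            · linarith
        _ = d * R ^ (d - 1) := by simp
    have h2 : (d:ℝ) * R ^ (d - 1) * (b - a) ≤ d * R ^ (d - 1) * (2 * L) := by gcongr
    calc (b ^ d - a ^ d) * v ≤ (d * R ^ (d - 1) * (2 * L)) * v := by
          gcongr; linarith
      _ = _ := by ring
  · have : (fun y : Euc d => ‖y‖) ⁻¹' Metric.closedBall p L ∩ K = ∅ := by
      apply Set.eq_empty_of_subset_empty
      refine hsub.trans ?_
      rintro y ⟨h1, h2⟩
      rw [mem_closedBall_zero_iff] at h1
      rw [mem_ball_zero_iff, not_lt] at h2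
      exact hab (h2.trans h1)
    rw [this]; simp

theorem th_pos {b : ℝ} (hb : 0 < b) (q x : ℝ) : 0 < th b q x := by unfold th; positivity

theorem remL {ι : Type*} (J : Finset ι) {d : ℕ} {e0 : Euc d} {K : Set (Euc d)} (hK : IsCompact K) {ψ : Euc d → ℂ} {C : ℝ} (h : F1P e0 K ψ C) (hC : 0 ≤ C) (hψ : Measurable ψ)
    (N : ι → ℕ) (hN : ∀ c, 1 ≤ N c) (q a0 : ι → ℝ) (f : ι → Euc d → ℂ) (hf : ∀ c, BB (f c))
    (hs : ∀ c ξ, f c ξ ≠ 0 → 0.99 * ‖ξ‖ ≤ ⟪ξ, e0⟫ ∧ a0 c ≤ ‖ξ‖ ∧ ‖ξ‖ < a0 c + N c)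
    (κ : ι → ℝ → ℝ → ℂ) (hκ : ∀ c, Measurable (Function.uncurry (κ c))) {D : ℝ} (hD : 0 < D)
    (hκτ : ∀ c r ρ, ‖κ c r ρ‖ ≤ D * th (N c) (q c) r) {cc : ℝ} (hcc : 0 ≤ cc)
    (hp : ∀ k ∈ J, ∀ p L, 1 / (N k : ℝ) ≤ L → ∑ j ∈ J with ((N k : ℝ) ≤ N j ∧ |q j - p| ≤ L), 1 / (N j : ℝ) ≤ cc * L)
    (hν : ∀ p L, 0 < L → ((volume.restrict K).map (fun y : Euc d => ‖y‖)) (Metric.closedBall p L) ≤ ENNReal.ofReal (cc * L))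
    {NF : ℝ} (hNF : 0 < NF) (hsum : ∑ c ∈ J, n2 (f c) ≤ ENNReal.ofReal NF) :
    n2 (fun y => ∑ c ∈ J, ψ y * VV (fun y ξ => κ c ‖y‖ ‖ξ‖) (f c) y) ≤
      ENNReal.ofReal (4 * (160 * cc) ^ 2 * (D ^ 2 * (C + 1) * (2 * NF))) := by
  set ε : ℝ := NF / (J.card + 1) with hε
  have hε0 : 0 < ε := by positivity
  set n : ι → ℝ := fun c => (n2 (f c)).toReal + ε with hn
  have hn0 : ∀ c, 0 < n c := fun c => add_pos_of_nonneg_of_pos ENNReal.toReal_nonneg hε0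
  have hNp : ∀ c, (0:ℝ) < N c := fun c => by exact_mod_cast hN c
  set β : ι → ℝ := fun c => √((C + 1) * N c * n c) with hβ
  have hβ0 : ∀ c, 0 < β c := fun c => Real.sqrt_pos.2 (mul_pos (mul_pos (by linarith) (hNp c)) (hn0 c))
  have hβsq : ∀ c, β c ^ 2 = (C + 1) * N c * n c := fun c => Real.sq_sqrt (mul_pos (mul_pos (by linarith) (hNp c)) (hn0 c)).le
  set τ : ι → ℝ → ℝ := fun c r => D * th (N c) (q c) r with hτ
  have hτ0 : ∀ c r, 0 < τ c r := fun c r => mul_pos hD (th_pos (hNp c) _ _)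
  have hτ1 : ∀ c r, τ c r ≤ D := fun c r => mul_le_of_le_one_right hD.le (th_le_one (hNp c) _ _)
  have hτm : ∀ c, Measurable (τ c) := fun c => (th_meas _ _).const_mul D
  set S : ℝ → ℝ := fun r => ∑ c ∈ J, β c * τ c r with hS
  have hS0 : ∀ r, 0 ≤ S r := fun r => Finset.sum_nonneg fun c _ => (mul_pos (hβ0 c) (hτ0 c r)).le
  have hSm : Measurable S := Finset.measurable_fun_sum _ fun c _ => (hτm c).const_mul _
  set SM : ℝ := ∑ c ∈ J, β c * D with hSM
  have hS1 : ∀ r, S r ≤ SM := fun r => Finset.sum_le_sum fun c _ => mul_le_mul_of_nonneg_left (hτ1 c r) (hβ0 c).le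
  clear_value ε β SM n
  set v : ι → ℝ → ℝ := fun c r => √(S r / (β c * τ c r)) with hv
  have hvm : ∀ c, Measurable (v c) := fun c => (hSm.div ((hτm c).const_mul _)).sqrt
  set τ' : ι → ℝ → ℝ := fun c r => v c r * τ c r with hτ'
  have hv2 : ∀ c r, v c r ^ 2 = S r / (β c * τ c r) := fun c r => Real.sq_sqrt (div_nonneg (hS0 r) (mul_pos (hβ0 c) (hτ0 c r)).le)
  have hτ'2 : ∀ c r, τ' c r ^ 2 = (β c)⁻¹ * (τ c r * S r) := by
    intro c r
    simp only [hτ']; rw [mul_pow, hv2]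
    have := (hβ0 c).ne'; have := (hτ0 c r).ne'
    field_simp
  set κ' : ι → ℝ → ℝ → ℂ := fun c r ρ => (v c r : ℂ) * κ c r ρ with hκ'
  set H : ι → Euc d → ℂ := fun c y => ψ y * VV (fun y ξ => κ' c ‖y‖ ‖ξ‖) (f c) y with hH
  set G : ι → Euc d → ℂ := fun c y => ψ y * VV (fun y ξ => κ c ‖y‖ ‖ξ‖) (f c) y with hG
  have hκ'm : ∀ c, Measurable (Function.uncurry (κ' c)) := fun c =>
    (Complex.measurable_ofReal.comp ((hvm c).comp measurable_fst)).mul (hκ c)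
  have hHG : ∀ c y, H c y = (v c ‖y‖ : ℂ) * G c y := by
    intro c y
    simp only [hH, hG]
    rw [mul_left_comm]
    congr 1
    unfold VV
    rw [← integral_const_mul]
    congr 1; ext ξ; simp only [hκ']; ring
  have hHm : ∀ c, Measurable (H c) := fun c => hψ.mul (VV_meas (kap_meas (hκ'm c)) (hf c).1)
  have hKf : volume K ≠ ⊤ := hK.measure_lt_top.ne
  haveI : IsFiniteMeasure (volume.restrict K) := ⟨by rw [Measure.restrict_apply_univ]; exact hK.measure_lt_top⟩
  have hint : ∀ g : ℝ → ℝ, Measurable g → ∀ M, (∀ r, |g r| ≤ M) → IntegrableOn (fun y : Euc d => g ‖y‖) K := by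
    intro g hg M hM
    exact Integrable.of_bound (hg.comp measurable_norm).aestronglyMeasurable M (ae_of_all _ fun y => hM _)
  have hτS : ∀ c, IntegrableOn (fun y : Euc d => τ c ‖y‖ * S ‖y‖) K := fun c =>
    hint (fun r => τ c r * S r) ((hτm c).mul hSm) (D * SM) fun r => by
      rw [abs_of_nonneg (mul_nonneg (hτ0 c r).le (hS0 r))]
      exact mul_le_mul (hτ1 c r) (hS1 r) (hS0 r) hD.le
  have step : ∀ c ∈ J, n2 (H c) ≤ ENNReal.ofReal (∫ y in K, β c * (τ c ‖y‖ * S ‖y‖)) := by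
    intro c hc
    have hb : ∀ r, τ' c r ≤ √((β c)⁻¹ * (D * SM)) := by
      intro r
      apply Real.le_sqrt_of_sq_le
      rw [hτ'2]
      exact mul_le_mul_of_nonneg_left (mul_le_mul (hτ1 c r) (hS1 r) (hS0 r) hD.le) (inv_nonneg.2 (hβ0 c).le)
    refine (shells h hψ (N c) (a0 c) (f c) (hf c) (hs c) (κ' c) (τ' c) (hκ'm c) ((hvm c).mul (hτm c)) hb ?_).trans ?_
    · intro r ρ
      simp only [hκ', hτ']
      rw [norm_mul, Complex.norm_real, Real.norm_eq_abs, abs_of_nonneg (Real.sqrt_nonneg _)]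
      exact mul_le_mul_of_nonneg_left (hκτ c r ρ) (Real.sqrt_nonneg _)
    · simp only [hτ'2]
      rw [integral_const_mul, integral_const_mul]
      set I := ∫ y in K, τ c ‖y‖ * S ‖y‖ with hI
      have hI0 : 0 ≤ I := integral_nonneg fun y => mul_nonneg (hτ0 c _).le (hS0 _)
      have hm : n2 (f c) ≤ ENNReal.ofReal (n c) := by
        rw [← ENNReal.ofReal_toReal (hf c).n2_ne_top]
        apply ENNReal.ofReal_le_ofReal
        rw [hn]; simp only; linarith
      have hi := inv_nonneg.2 (hβ0 c).le
      calc (N c : ℝ≥0∞) * (ENNReal.ofReal (C * ((β c)⁻¹ * I)) * n2 (f c)) ≤ (N c : ℝ≥0∞) * (ENNReal.ofReal (C * ((β c)⁻¹ * I)) * ENNReal.ofReal (n c)) := by gcongr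
        _ = ENNReal.ofReal (N c * ((C * ((β c)⁻¹ * I)) * n c)) := by
          rw [ENNReal.ofReal_mul (hNp c).le, ENNReal.ofReal_mul (mul_nonneg hC (mul_nonneg hi hI0)), ENNReal.ofReal_natCast]
        _ ≤ ENNReal.ofReal (β c * I) := by
          apply ENNReal.ofReal_le_ofReal
          have e1 : N c * ((C * ((β c)⁻¹ * I)) * n c) = (C * N c * n c) * (β c)⁻¹ * I := by ring
          rw [e1]
          apply mul_le_mul_of_nonneg_right _ hI0
          rw [← div_eq_mul_inv, div_le_iff₀ (hβ0 c), ← sq, hβsq]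
          have := mul_pos (hNp c) (hn0 c)
          nlinarith
  have h1 : n2 (fun y => ∑ c ∈ J, G c y) ≤ ∑ c ∈ J, n2 (H c) := by
    unfold n2
    rw [← lintegral_finsetSum' _ (fun j hj => ((hHm j).enorm.pow_const 2).aemeasurable)]
    refine lintegral_mono fun y => ?_
    simp only [enorm_sq_eq]
    rw [← ENNReal.ofReal_sum_of_nonneg (fun _ _ => by positivity)]
    apply ENNReal.ofReal_le_ofReal
    set r := ‖y‖
    calc ‖∑ c ∈ J, G c y‖ ^ 2 ≤ (∑ c ∈ J, ‖G c y‖) ^ 2 := by gcongr; exact norm_sum_le _ _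
      _ ≤ (∑ c ∈ J, β c * τ c r) * ∑ c ∈ J, ‖G c y‖ ^ 2 / (β c * τ c r) := by
        apply Finset.sum_sq_le_sum_mul_sum_of_sq_le_mul
        · exact fun c _ => (mul_pos (hβ0 c) (hτ0 c r)).le
        · exact fun c _ => div_nonneg (sq_nonneg _) (mul_pos (hβ0 c) (hτ0 c r)).le
        · intro c _
          have := (mul_pos (hβ0 c) (hτ0 c r)).ne'
          exact (mul_div_cancel₀ _ this).ge
      _ = ∑ c ∈ J, ‖H c y‖ ^ 2 := by
        rw [Finset.mul_sum]
        apply Finset.sum_congr rfl; intro c _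
        rw [hHG, norm_mul (v c ‖y‖ : ℂ), Complex.norm_real, Real.norm_eq_abs, mul_pow, sq_abs, hv2]
        simp only [hS, r]; ring
  refine (h1.trans (Finset.sum_le_sum step)).trans ?_
  rw [← ENNReal.ofReal_sum_of_nonneg (fun c _ => integral_nonneg fun y => mul_nonneg (hβ0 c).le (mul_nonneg (hτ0 c _).le (hS0 _))), ← integral_finsetSum _ (fun c _ => (hτS c).const_mul _)]
  have e2 : ∀ y : Euc d, ∑ c ∈ J, β c * (τ c ‖y‖ * S ‖y‖) = S ‖y‖ ^ 2 := by
    intro y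
    rw [sq]; conv_rhs => enter [1]; rw [hS]
    rw [Finset.sum_mul]
    exact Finset.sum_congr rfl fun c _ => by ring
  simp only [e2]
  have hS2 : IntegrableOn (fun y : Euc d => S ‖y‖ ^ 2) K := hint (fun r => S r ^ 2) (hSm.pow_const 2) (SM ^ 2) fun r => by
    rw [abs_of_nonneg (sq_nonneg _)]; exact pow_le_pow_left₀ (hS0 r) (hS1 r) 2
  rw [ofReal_integral_eq_lintegral_ofReal hS2 (ae_of_all _ fun y => sq_nonneg _)]
  rw [← lintegral_map (f := fun r => ENNReal.ofReal (S r ^ 2)) (g := fun y : Euc d => ‖y‖) (hSm.pow_const 2).ennreal_ofReal measurable_norm]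
  set a : ι → ℝ := fun c => D * √((C + 1) * n c) with ha
  have hSe : ∀ r, S r = ∑ c ∈ J, a c * √(N c) * th (N c) (q c) r := by
    intro r
    simp only [hS]; apply Finset.sum_congr rfl; intro c _
    simp only [ha, hτ, hβ]
    rw [show (C + 1) * N c * n c = (C + 1) * n c * N c by ring, Real.sqrt_mul (mul_pos (by linarith) (hn0 c)).le]; ring
  simp only [hSe]
  refine (carl J (fun c => (N c : ℝ)) q a hNp (fun c => mul_nonneg hD.le (Real.sqrt_nonneg _)) hcc hp _ hν).trans ?_
  apply ENNReal.ofReal_le_ofReal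
  apply mul_le_mul_of_nonneg_left _ (by positivity)
  have e3 : ∑ c ∈ J, a c ^ 2 = D ^ 2 * (C + 1) * ∑ c ∈ J, n c := by
    rw [Finset.mul_sum]; apply Finset.sum_congr rfl; intro c _
    simp only [ha]; rw [mul_pow, Real.sq_sqrt (mul_pos (by linarith) (hn0 c)).le]; ring
  rw [e3]
  apply mul_le_mul_of_nonneg_left _ (by positivity)
  simp only [hn]
  rw [Finset.sum_add_distrib, Finset.sum_const, nsmul_eq_mul, ← ENNReal.toReal_sum (fun c _ => (hf c).n2_ne_top)]
  have h5 := ENNReal.toReal_le_of_le_ofReal hNF.le hsum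
  have h6 : (J.card : ℝ) * ε ≤ NF := by
    rw [hε, mul_div_assoc', div_le_iff₀ (by positivity)]; nlinarith
  linarith

theorem BB.conv {d : ℕ} {f m : Euc d → ℂ} (hf : BB f) (hm : BB m) : BB (fun x => ∫ z, f z * m (x - z)) := by
  have hfi := hf.integrable
  obtain ⟨hf1, M1, R1, hf2⟩ := hf
  obtain ⟨hm1, M2, R2, hm2⟩ := hm
  refine ⟨?_, (∫ z, ‖f z‖) * M2, R1 + R2, fun x => ⟨?_, fun hx => ?_⟩⟩
  · have : StronglyMeasurable (fun x => ∫ z, f z * m (x - z)) := by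
      apply StronglyMeasurable.integral_prod_right' (f := fun p : Euc d × Euc d => f p.2 * m (p.1 - p.2))
      apply Measurable.stronglyMeasurable
      exact (hf1.comp measurable_snd).mul (hm1.comp (measurable_fst.sub measurable_snd))
    exact this.measurable
  · refine (norm_integral_le_integral_norm _).trans ?_
    rw [← integral_mul_const]
    apply integral_mono_of_nonneg (ae_of_all _ fun z => norm_nonneg _) (hfi.norm.mul_const _) (ae_of_all _ fun z => ?_)
    simp only [norm_mul]
    exact mul_le_mul_of_nonneg_left (hm2 _).1 (norm_nonneg _)
  · apply integral_eq_zero_of_ae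
    refine ae_of_all _ fun z => ?_
    show f z * m (x - z) = 0
    by_cases h : R1 < ‖z‖
    · rw [(hf2 z).2 h, zero_mul]
    · rw [(hm2 (x - z)).2, mul_zero]
      have := norm_sub_norm_le x z
      push Not at h
      linarith

theorem BB.zero {d : ℕ} : BB (fun _ : Euc d => (0:ℂ)) := ⟨measurable_const, 0, 0, fun _ => by simp⟩

theorem BB.add {d : ℕ} {f g : Euc d → ℂ} (hf : BB f) (hg : BB g) : BB (fun x => f x + g x) := by
  obtain ⟨hf1, M1, R1, hf2⟩ := hf
  obtain ⟨hm1, M2, R2, hm2⟩ := hg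
  refine ⟨hf1.add hm1, M1 + M2, max R1 R2, fun x => ⟨norm_add_le_of_le (hf2 x).1 (hm2 x).1, fun hx => ?_⟩⟩
  show f x + g x = 0
  rw [(hf2 x).2 (lt_of_le_of_lt (le_max_left _ _) hx), (hm2 x).2 (lt_of_le_of_lt (le_max_right _ _) hx), add_zero]

theorem BB.sum {d : ℕ} {ι : Type*} (J : Finset ι) {f : ι → Euc d → ℂ} (hf : ∀ c, BB (f c)) : BB (fun x => ∑ c ∈ J, f c x) := by
  classical
  induction J using Finset.induction_on with
  | empty => simpa using BB.zero
  | insert a s ha ih => simp only [Finset.sum_insert ha]; exact (hf a).add ih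

theorem UU_VV {d : ℕ} (F : Euc d → ℂ) (y : Euc d) : UU F y = VV (fun _ _ => 1) F y := by
  unfold UU VV; simp

theorem UU_sum {d : ℕ} {ι : Type*} (J : Finset ι) {f : ι → Euc d → ℂ} (hf : ∀ c, Integrable (f c)) (y : Euc d) :
    UU (fun x => ∑ c ∈ J, f c x) y = ∑ c ∈ J, UU (f c) y := by
  simp only [UU_VV]
  rw [VV_sum J (fun _ => measurable_const) hf y (M := 1) (by simp)]
  unfold VV; simp

theorem smoothL {ι : Type*} [DecidableEq ι] (J : Finset ι) {d : ℕ} (f m : ι → Euc d → ℂ) (hf : ∀ c, BB (f c)) (hm : ∀ c, BB (m c))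
    (φ : ι → ℝ → ℂ) (hφ : ∀ c y, UU (m c) y = φ c ‖y‖) {C : ℝ} (hφC : ∀ c r, 0 ≤ r → ‖φ c r‖ ≤ C) (M : ℕ)
    (hov : ∀ x : Euc d, ∃ S : Finset ι, S ⊆ J ∧ S.card ≤ M ∧ ∀ c ∈ J, c ∉ S → ∀ z, f c z ≠ 0 → m c (x - z) = 0) :
    n2 (fun y => ∑ c ∈ J, φ c ‖y‖ * UU (f c) y) ≤ ENNReal.ofReal (M * C ^ 2 * (2 * Real.pi) ^ d) * ∑ c ∈ J, n2 (f c) := by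
  set g : ι → Euc d → ℂ := fun c x => ∫ z, f c z * m c (x - z) with hg
  have hgB : ∀ c, BB (g c) := fun c => (hf c).conv (hm c)
  have hpi : (0:ℝ) ≤ (2 * Real.pi) ^ d := by positivity
  have h1 : ∀ c y, φ c ‖y‖ * UU (f c) y = UU (g c) y := fun c y => by
    rw [UU_conv (hf c).integrable (hm c).integrable, hφ, mul_comm]
  have h2 : (fun y => ∑ c ∈ J, φ c ‖y‖ * UU (f c) y) = UU (fun x => ∑ c ∈ J, g c x) := by
    ext y; rw [UU_sum J fun c => (hgB c).integrable]; simp only [h1]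
  rw [h2, UU_planch (BB.sum J hgB)]
  have h3 : n2 (fun x => ∑ c ∈ J, g c x) ≤ M * ∑ c ∈ J, n2 (g c) := by
    refine n2_sum_ov J g (fun c _ => (hgB c).1) M fun x => ?_
    obtain ⟨S, hS, hc, h0⟩ := hov x
    refine ⟨S, hS, hc, fun c hc hcS => ?_⟩
    simp only [hg]
    apply integral_eq_zero_of_ae
    refine ae_of_all _ fun z => ?_
    show f c z * m c (x - z) = 0
    by_cases h : f c z = 0
    · rw [h, zero_mul]
    · rw [h0 c hc hcS z h, mul_zero]
  have h4 : ∀ c, ENNReal.ofReal ((2 * Real.pi) ^ d) * n2 (g c) ≤ ENNReal.ofReal (C ^ 2 * (2 * Real.pi) ^ d) * n2 (f c) := by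
    intro c
    rw [← UU_planch (hgB c), ENNReal.ofReal_mul (sq_nonneg _), mul_assoc, ← UU_planch (hf c)]
    apply n2_le_cmul
    intro y
    rw [← h1, norm_mul]
    exact mul_le_mul_of_nonneg_right (hφC c _ (norm_nonneg _)) (norm_nonneg _)
  calc ENNReal.ofReal ((2 * Real.pi) ^ d) * n2 (fun x => ∑ c ∈ J, g c x) ≤ ENNReal.ofReal ((2 * Real.pi) ^ d) * (M * ∑ c ∈ J, n2 (g c)) := by gcongr
    _ = M * ∑ c ∈ J, ENNReal.ofReal ((2 * Real.pi) ^ d) * n2 (g c) := by rw [← Finset.mul_sum]; ring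
    _ ≤ M * ∑ c ∈ J, ENNReal.ofReal (C ^ 2 * (2 * Real.pi) ^ d) * n2 (f c) := by
      refine mul_le_mul_right (Finset.sum_le_sum fun c _ => h4 c) _
    _ = _ := by
      rw [← Finset.mul_sum, mul_assoc (M:ℝ), ENNReal.ofReal_mul (Nat.cast_nonneg M), ENNReal.ofReal_natCast, mul_assoc]

theorem lev_meas (g : ℝ → ℝ) (A : ℝ) (n : ℕ) : Measurable (lev g A n) := by
  classical
  unfold lev
  refine measurable_findGreatest (fun k _ => ?_)
  exact (Nat.measurable_floor.comp (measurable_id.div_const ((2:ℝ) ^ k))) (MeasurableSet.of_discrete (s := {i : ℕ | sm g A k i}))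

theorem InC_meas (g : ℝ → ℝ) (A : ℝ) (n : ℕ) (c : ℕ × ℕ) : MeasurableSet {ρ | InC g A n c ρ} := by
  unfold InC
  refine (measurableSet_le measurable_const measurable_id).inter ((lev_meas g A n (measurableSet_singleton c.1)).inter ?_)
  exact (Nat.measurable_floor.comp (measurable_id.div_const _)) (measurableSet_singleton c.2)

def cutQ {d : ℕ} (Q : ℝ → ℝ) (y ξ : Euc d) : ℂ := if ‖y‖ ≤ Q ‖ξ‖ then 1 else 0

theorem cutQ_meas {d : ℕ} {Q : ℝ → ℝ} (hQ : Measurable Q) : Measurable (Function.uncurry (cutQ (d := d) Q)) := by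
  unfold cutQ Function.uncurry
  exact Measurable.ite (measurableSet_le (by fun_prop) (by fun_prop)) measurable_const measurable_const

theorem cutQ_le {d : ℕ} {Q : ℝ → ℝ} (y ξ : Euc d) : ‖cutQ Q y ξ‖ ≤ 1 := by
  unfold cutQ; split_ifs <;> simp

open Classical in
theorem CB {d : ℕ} (hd : 1 ≤ d) {e0 : Euc d} (he0 : ‖e0‖ = 1) {K : Set (Euc d)} (hK : IsCompact K)
    (hKe : ∀ y ∈ K, 1/4 ≤ ‖y‖ ∧ 0.8 * ‖y‖ ≤ |⟪y, e0⟫|) {ψ : Euc d → ℂ} (hψ : ContDiff ℝ (⊤ : ℕ∞) ψ)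
    (hψK : ∀ y, y ∉ K → ψ y = 0) {A : ℝ} (hA1 : 1 ≤ A) :
    ∃ C : ℝ, 0 ≤ C ∧ ∀ Q : ℝ → ℝ, (Monotone Q ∨ Antitone Q) → (∀ x, 1 ≤ Q x ∧ Q x ≤ A) → ∀ F : Euc d → ℂ, BB F →
      (∀ ξ, F ξ ≠ 0 → 0.99 * ‖ξ‖ ≤ ⟪ξ, e0⟫) → n2 (fun y => ψ y * VV (cutQ Q) F y) ≤ ENNReal.ofReal C * n2 F := by
  obtain ⟨C1, hC1, hF1⟩ := F1 he0 hK hKe hψ hψK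
  have hF1' : F1P e0 K ψ C1 := hF1
  obtain ⟨C2, hC2, hmoll⟩ := moll d hd
  obtain ⟨R, hR⟩ := hK.isBounded.exists_norm_le
  obtain ⟨c0, hc0, hvol⟩ := shell_vol hd (le_max_right R 0) (fun y hy => (hR y hy).trans (le_max_left R 0)) hK.isClosed.measurableSet
  have hψs : HasCompactSupport ψ := HasCompactSupport.intro hK hψK
  obtain ⟨Mψ, hMψ⟩ := hψs.exists_bound_of_continuous hψ.continuous
  have hψm : Measurable ψ := hψ.continuous.measurable
  set D : ℝ := 16 * C2 + (1 + A) ^ 2 with hD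
  have hD0 : 0 < D := by positivity
  set cc := max 289 c0 with hcc
  have hcc0 : 0 ≤ cc := le_trans (by norm_num) (le_max_left _ _)
  set CA := 4 * (160 * cc) ^ 2 * (D ^ 2 * (C1 + 1) * 2) with hCA
  set CBc := Mψ ^ 2 * (15 * C2 ^ 2 * (2 * Real.pi) ^ d) with hCB
  have hCA0 : 0 ≤ CA := by positivity
  have hCB0 : 0 ≤ CBc := by have := Real.pi_pos; positivity
  refine ⟨2 * (CA + CBc), by positivity, ?_⟩
  intro Q hQmono hQ F hF hcone
  by_cases hF0 : n2 F = 0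
  · have : (fun y => ψ y * VV (cutQ Q) F y) = fun _ => 0 := by
      ext y; rw [VV_ae0 hF.1 hF0, mul_zero]
    rw [this]; unfold n2; simp
  have hQm : Measurable Q := hQmono.elim Monotone.measurable Antitone.measurable
  obtain ⟨g, hg, hgQ, hgp⟩ : ∃ g : ℝ → ℝ, Monotone g ∧ (∀ x y, |g x - g y| = |Q x - Q y|) ∧ ∀ p, ∃ p', ∀ x, |Q x - p| = |g x - p'| := by
    rcases hQmono with h | h
    · exact ⟨Q, h, fun _ _ => rfl, fun p => ⟨p, fun _ => rfl⟩⟩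
    · refine ⟨fun x => -Q x, fun x y hxy => neg_le_neg (h hxy), fun x y => ?_, fun p => ⟨-p, fun x => ?_⟩⟩
      · rw [show -Q x - -Q y = -(Q x - Q y) by ring, abs_neg]
      · rw [show -Q x - -p = -(Q x - p) by ring, abs_neg]
  have hA : ∀ x y, g x - g y ≤ A := fun x y => by
    refine (le_abs_self _).trans ?_
    rw [hgQ, abs_le]
    constructor <;> linarith [hQ x, hQ y, (hQ x).1, (hQ x).2, (hQ y).1, (hQ y).2]
  obtain ⟨M, RF, hMR⟩ := hF.2
  obtain ⟨n, hn⟩ := pow_unbounded_of_one_lt RF (one_lt_two (α := ℝ))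
  have hsuppn : ∀ ξ, F ξ ≠ 0 → ‖ξ‖ < 2 ^ n := fun ξ hξ => by
    by_contra hh; push Not at hh; exact hξ ((hMR ξ).2 (by linarith))
  set J := cells g A n with hJ
  set s : ℕ × ℕ → Set (Euc d) := fun c => {ξ | InC g A n c ‖ξ‖} with hs
  have hsm : ∀ c, MeasurableSet (s c) := fun c => measurable_norm (InC_meas g A n c)
  have hdis : ∀ i j x, x ∈ s i → x ∈ s j → i = j := by
    intro i j x hi hj
    have e1 : i.1 = j.1 := hi.2.1.symm.trans hj.2.1
    refine Prod.ext e1 ?_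
    rw [← hi.2.2, ← hj.2.2, e1]
  set f : ℕ × ℕ → Euc d → ℂ := fun c => (s c).indicator F with hf
  have hfB : ∀ c, BB (f c) := fun c => hF.ind (hsm c)
  have hfne : ∀ c ξ, f c ξ ≠ 0 → InC g A n c ‖ξ‖ ∧ F ξ ≠ 0 := by
    intro c ξ h
    have hm := Set.mem_of_indicator_ne_zero h
    simp only [hf] at h
    rw [Set.indicator_of_mem hm] at h
    exact ⟨hm, h⟩
  have hFsum : ∀ ξ, ∑ c ∈ J, f c ξ = F ξ := by
    intro ξ
    by_cases hξ : F ξ = 0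
    · rw [hξ, Finset.sum_eq_zero]; intro i _; simp only [hf]; rw [Set.indicator_apply_eq_zero]; exact fun _ => hξ
    · set c : ℕ × ℕ := (lev g A n ‖ξ‖, ⌊‖ξ‖ / 2 ^ (lev g A n ‖ξ‖)⌋₊)
      have hmem : ξ ∈ s c := ⟨norm_nonneg _, rfl, rfl⟩
      rw [Finset.sum_eq_single_of_mem c (mem_cells (hsuppn ξ hξ) hmem)]
      · exact Set.indicator_of_mem hmem _
      · intro j _ hj
        exact Set.indicator_of_notMem (fun hh => hj (hdis _ _ _ hh hmem)) _
  have hnsum : ∑ c ∈ J, n2 (f c) ≤ n2 F := n2_parts J F hF.1 s hsm hdis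
  set q : ℕ × ℕ → ℝ := fun c => Q (c.2 * 2 ^ c.1) with hq
  have hp2 : ∀ j : ℕ, (0:ℝ) < 2 ^ j := fun j => by positivity
  choose m φ hm hm0 hφm hUm hφC hφd using fun c : ℕ × ℕ => hmoll (2 ^ c.1 / 4) (by have := hp2 c.1; positivity) (q c)
  set κ : ℕ × ℕ → ℝ → ℝ → ℂ := fun c r ρ => if (0 ≤ r ∧ InC g A n c ρ) then ((if r ≤ Q ρ then (1:ℂ) else 0) - φ c r) else 0 with hκ
  have hκm : ∀ c, Measurable (Function.uncurry (κ c)) := by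
    intro c
    simp only [hκ, Function.uncurry]
    refine Measurable.ite ?_ (Measurable.sub (Measurable.ite (measurableSet_le measurable_fst (hQm.comp measurable_snd)) measurable_const measurable_const) ((hφm c).comp measurable_fst)) measurable_const
    exact (measurableSet_le measurable_const measurable_fst).inter (measurable_snd (InC_meas g A n c))
  have hκτ : ∀ c r ρ, ‖κ c r ρ‖ ≤ D * th ((2 ^ c.1 : ℕ) : ℝ) (q c) r := by
    intro c r ρ
    push_cast
    by_cases hc : 0 ≤ r ∧ InC g A n c ρ
    · simp only [hκ]; rw [if_pos hc]
      have h2 := hp2 c.1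
      have b1 : ‖(if r ≤ q c then (1:ℂ) else 0) - φ c r‖ ≤ 16 * C2 * th (2 ^ c.1) (q c) r := by
        refine (hφd c r hc.1).trans ?_
        unfold th
        rw [mul_one_div, div_le_div_iff₀ (by positivity) (by positivity)]
        have : (1 + 2 ^ c.1 * |r - q c|) ^ 2 ≤ 16 * (1 + 2 ^ c.1 / 4 * |r - q c|) ^ 2 := by
          have h3 : 0 ≤ 2 ^ c.1 * |r - q c| := by positivity
          nlinarith
        nlinarith
      have b2 : ‖(if r ≤ Q ρ then (1:ℂ) else 0) - (if r ≤ q c then (1:ℂ) else 0)‖ ≤ (1 + A) ^ 2 * th (2 ^ c.1) (q c) r := by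
        have hth := th_nonneg (2 ^ c.1) (q c) r
        by_cases hb : (r ≤ Q ρ ↔ r ≤ q c)
        · simp only [hb, sub_self, norm_zero]; positivity
        · have e1 : ‖(if r ≤ Q ρ then (1:ℂ) else 0) - (if r ≤ q c then (1:ℂ) else 0)‖ ≤ 1 := by
            split_ifs <;> simp
          refine e1.trans ?_
          have e2 : |r - q c| ≤ |Q ρ - q c| := by
            rcases lt_or_ge (Q ρ) r with h | h
            · have h' : r ≤ q c := by by_contra hh; exact hb ⟨fun h3 => absurd h3 (not_le.2 h), fun h3 => absurd h3 hh⟩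
              rw [abs_of_nonpos (by linarith), abs_of_nonpos (by linarith)]; linarith
            · have h' : q c < r := by by_contra hh; push Not at hh; exact hb ⟨fun _ => hh, fun _ => h⟩
              rw [abs_of_nonneg (by linarith), abs_of_nonneg (by linarith)]; linarith
          have e3 := hc.2.osc hg hA
          rw [hgQ] at e3
          have e4 : 2 ^ c.1 * |r - q c| ≤ A := le_trans (mul_le_mul_of_nonneg_left e2 h2.le) e3
          unfold th
          rw [mul_one_div, le_div_iff₀ (by positivity), one_mul]
          have h3 : 0 ≤ 2 ^ c.1 * |r - q c| := by positivity
          gcongr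
      calc _ = ‖((if r ≤ Q ρ then (1:ℂ) else 0) - (if r ≤ q c then (1:ℂ) else 0)) + ((if r ≤ q c then (1:ℂ) else 0) - φ c r)‖ := by congr 1; ring
        _ ≤ _ := (norm_add_le _ _).trans (add_le_add b2 b1)
        _ = _ := by rw [hD]; ring
    · simp only [hκ]; rw [if_neg hc, norm_zero]
      exact mul_nonneg hD0.le (th_nonneg _ _ _)
  have hdec : ∀ y, ψ y * VV (cutQ Q) F y = (∑ c ∈ J, ψ y * VV (fun y ξ => κ c ‖y‖ ‖ξ‖) (f c) y) + ψ y * ∑ c ∈ J, φ c ‖y‖ * UU (f c) y := by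
    intro y
    rw [← Finset.mul_sum, ← mul_add, ← Finset.sum_add_distrib]
    congr 1
    have e1 : ∀ c, VV (fun y ξ => κ c ‖y‖ ‖ξ‖) (f c) y + φ c ‖y‖ * UU (f c) y = VV (cutQ Q) (f c) y := by
      intro c
      have i1 := VV_int (kap_meas (hκm c)) (hfB c).integrable y (M := D * th ((2 ^ c.1 : ℕ) : ℝ) (q c) ‖y‖) (fun ξ => hκτ c _ _)
      have i2 := VV_int (k := fun _ _ => 1) measurable_const (hfB c).integrable y (M := 1) (by simp)
      unfold UU VV
      simp only [one_mul] at i2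
      rw [← integral_const_mul, ← integral_add i1 (i2.const_mul _)]
      congr 1; ext ξ
      by_cases h0 : f c ξ = 0
      · rw [h0]; simp
      · have := (hfne c ξ h0).1
        simp only [hκ, cutQ]
        rw [if_pos ⟨norm_nonneg _, this⟩]; ring
    simp only [e1]
    rw [VV_sum J (fun _ => cutQ_meas hQm) (fun c => (hfB c).integrable) y (M := 1) (fun _ _ => cutQ_le _ _)]
    unfold VV
    congr 1; ext ξ
    rw [← Finset.mul_sum, hFsum]
  have hNF : 0 < (n2 F).toReal := ENNReal.toReal_pos hF0 hF.n2_ne_top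
  have hnF : ENNReal.ofReal (n2 F).toReal = n2 F := ENNReal.ofReal_toReal hF.n2_ne_top
  have T1 := remL J hK hF1' hC1 hψm (fun c => 2 ^ c.1) (fun c => Nat.one_le_two_pow) q (fun c => c.2 * 2 ^ c.1) f hfB (by
      intro c ξ h
      obtain ⟨h1, h2⟩ := hfne c ξ h
      have := h1.mem
      push_cast
      exact ⟨hcone ξ h2, this.1, by linarith [this.2]⟩) κ hκm hD0 hκτ hcc0 (by
      intro k _ p L hL
      push_cast at hL ⊢
      obtain ⟨p', hp'⟩ := hgp p
      simp only [hq, hp']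
      have hL0 : 0 < L := lt_of_lt_of_le (by have := hp2 k.1; positivity) hL
      refine (packing hg hA1 (hp2 k.1) p' L hL).trans ?_
      exact mul_le_mul_of_nonneg_right (le_max_left _ _) hL0.le) (fun p L hL => (hvol p L hL).trans (ENNReal.ofReal_le_ofReal (mul_le_mul_of_nonneg_right (le_max_right _ _) hL.le))) hNF (by rw [hnF]; exact hnsum)
  have T2 : n2 (fun y => ψ y * ∑ c ∈ J, φ c ‖y‖ * UU (f c) y) ≤ ENNReal.ofReal CBc * n2 F := by
    refine (n2_le_cmul (H := fun y => ∑ c ∈ J, φ c ‖y‖ * UU (f c) y) (c := Mψ) fun y => ?_).trans ?_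
    · rw [norm_mul]; exact mul_le_mul_of_nonneg_right (hMψ y) (norm_nonneg _)
    · rw [hCB, ENNReal.ofReal_mul (sq_nonneg _), mul_assoc]
      refine mul_le_mul_right ?_ _
      refine (smoothL J f m hfB hm φ hUm hφC 15 ?_).trans ?_
      · intro x
        refine ⟨_, Finset.filter_subset _ _, overlap (n := n) hg hA ‖x‖ (norm_nonneg _), ?_⟩
        intro c hc hcS z hz
        rw [Finset.mem_filter] at hcS
        apply hm0
        by_contra hh
        push Not at hh
        apply hcS
        refine ⟨hc, ‖z‖, (hfne c z hz).1, ?_⟩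
        rw [abs_sub_comm]
        exact (abs_norm_sub_norm_le x z).trans hh.le
      · push_cast
        exact mul_le_mul_right hnsum _
  simp only [hdec]
  have hUUm : ∀ c, Measurable (UU (f c)) := fun c => (UU_cont (hfB c).integrable).measurable
  refine (n2_add_le ?_ ?_).trans ?_
  · exact Finset.measurable_fun_sum _ fun c _ => hψm.mul (VV_meas (kap_meas (hκm c)) (hfB c).1)
  · exact hψm.mul (Finset.measurable_fun_sum _ fun c _ => ((hφm c).comp measurable_norm).mul (hUUm c))
  · refine (mul_le_mul_right (add_le_add T1 T2) _).trans ?_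
    rw [show 4 * (160 * cc) ^ 2 * (D ^ 2 * (C1 + 1) * (2 * (n2 F).toReal)) = CA * (n2 F).toReal by rw [hCA]; ring, ENNReal.ofReal_mul hCA0, hnF, ← add_mul, ← ENNReal.ofReal_add hCA0 hCB0, ← mul_assoc, ENNReal.ofReal_mul (by norm_num)]
    simp

open scoped FourierTransform in
theorem finv {n : ℕ} {X : Euc n → ℂ} (hX : ContDiff ℝ (⊤ : ℕ∞) X) (hXc : HasCompactSupport X) :
    ∃ Xh : Euc n → ℂ, Continuous Xh ∧ (∃ D, 0 < D ∧ ∀ u, ‖Xh u‖ ≤ D * ((1 + ‖u‖) ^ (n + 1))⁻¹) ∧ ∀ u, X u = UU Xh u := by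
  have hpi := Real.pi_pos
  have h2 : (2 * Real.pi) ≠ 0 := by positivity
  set Y : Euc n → ℂ := fun x => X (-(2 * Real.pi) • x) with hY
  have hYs : ContDiff ℝ (⊤ : ℕ∞) Y := hX.comp (by fun_prop)
  have hYc : HasCompactSupport Y := hXc.comp_homeomorph (Homeomorph.smulOfNeZero (-(2 * Real.pi)) (neg_ne_zero.2 h2))
  set S : SchwartzMap (Euc n) ℂ := hYc.toSchwartzMap hYs with hS
  have hT : ∃ T : SchwartzMap (Euc n) ℂ, T = 𝓕⁻ S := ⟨_, rfl⟩
  obtain ⟨T, hT⟩ := hT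
  have hb : ∃ D, 0 < D ∧ ∀ u, ‖T u‖ ≤ D * ((1 + ‖u‖) ^ (n + 1))⁻¹ := by
    refine ⟨2 ^ (n + 1) * ((Finset.Iic (n + 1, 0)).sup fun m => SchwartzMap.seminorm ℝ m.1 m.2) T + 1, by positivity, fun u => ?_⟩
    have := SchwartzMap.one_add_le_sup_seminorm_apply (𝕜 := ℝ) (m := (n + 1, 0)) le_rfl le_rfl T u
    rw [norm_iteratedFDeriv_zero] at this
    rw [← div_eq_mul_inv, le_div_iff₀ (by positivity), mul_comm]
    linarith
  refine ⟨T, T.continuous, hb, fun u => ?_⟩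
  rw [UU_eq, hT, ← SchwartzMap.fourier_coe, FourierTransform.fourier_fourierInv_eq]
  show X u = X (-(2 * Real.pi) • (-(2 * Real.pi)⁻¹ • u))
  rw [smul_smul, show -(2 * Real.pi) * -(2 * Real.pi)⁻¹ = 1 by field_simp, one_smul]

theorem cs_lint {Z : Type*} [MeasurableSpace Z] {μ : Measure Z} {h H : Z → ℝ≥0∞} (hh : Measurable h) (hH : Measurable H) :
    (∫⁻ z, h z * H z ∂μ) ^ 2 ≤ (∫⁻ z, h z ∂μ) * ∫⁻ z, h z * H z ^ 2 ∂μ := by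
  have := ENNReal.lintegral_mul_norm_pow_le (μ := μ) (f := h) (g := fun z => h z * H z ^ 2) hh.aemeasurable (hh.mul (hH.pow_const 2)).aemeasurable (p := 1/2) (q := 1/2) (by norm_num) (by norm_num) (by norm_num)
  have e : ∀ z, h z ^ (1/2 : ℝ) * (h z * H z ^ 2) ^ (1/2 : ℝ) = h z * H z := by
    intro z
    rw [← ENNReal.mul_rpow_of_nonneg _ _ (by norm_num), show h z * (h z * H z ^ 2) = (h z * H z) ^ 2 by ring, ← ENNReal.rpow_natCast, ← ENNReal.rpow_mul]
    norm_num
  simp only [e] at this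
  calc _ ≤ _ := pow_le_pow_left₀ zero_le this 2
    _ = _ := by
      rw [mul_pow, ← ENNReal.rpow_natCast, ← ENNReal.rpow_natCast, ← ENNReal.rpow_mul, ← ENNReal.rpow_mul]
      norm_num

theorem mink {Z : Type*} [MeasurableSpace Z] {μ : Measure Z} [SFinite μ] {α : Type*} [MeasureSpace α] [SFinite (volume : Measure α)]
    {h : Z → ℝ≥0∞} (hh : Measurable h) {H : Z → α → ℂ} (hH : Measurable (Function.uncurry H)) {G : α → ℂ}
    (hG : ∀ y, ‖G y‖ₑ ≤ ∫⁻ z, h z * ‖H z y‖ₑ ∂μ) {B : ℝ≥0∞} (hB : ∀ z, n2 (H z) ≤ B) :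
    n2 G ≤ (∫⁻ z, h z ∂μ) ^ 2 * B := by
  have hHm : ∀ y, Measurable fun z => ‖H z y‖ₑ := fun y => (hH.comp (measurable_id.prodMk measurable_const)).enorm
  have m2 : Measurable fun p : α × Z => h p.2 * ‖H p.2 p.1‖ₑ ^ 2 := (hh.comp measurable_snd).mul ((hH.comp measurable_swap).enorm.pow_const 2)
  calc n2 G ≤ ∫⁻ y, (∫⁻ z, h z ∂μ) * ∫⁻ z, h z * ‖H z y‖ₑ ^ 2 ∂μ := by
        refine lintegral_mono fun y => ?_
        exact (pow_le_pow_left₀ zero_le (hG y) 2).trans (cs_lint hh (hHm y))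
    _ = (∫⁻ z, h z ∂μ) * ∫⁻ y, ∫⁻ z, h z * ‖H z y‖ₑ ^ 2 ∂μ := by
        rw [lintegral_const_mul _ (Measurable.lintegral_prod_right' m2)]
    _ = (∫⁻ z, h z ∂μ) * ∫⁻ z, h z * n2 (H z) ∂μ := by
        rw [lintegral_lintegral_swap m2.aemeasurable]
        congr 1
        refine lintegral_congr fun z => ?_
        rw [lintegral_const_mul _ (show Measurable fun y => ‖H z y‖ₑ ^ 2 from (hH.comp (measurable_const.prodMk measurable_id)).enorm.pow_const 2)]
        rfl
    _ ≤ (∫⁻ z, h z ∂μ) * ∫⁻ z, h z * B ∂μ := by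
        gcongr with z; exact hB z
    _ = _ := by rw [lintegral_mul_const _ hh]; ring

theorem psiE {d : ℕ} (e : Euc d) {A : ℝ} (hA : 1 ≤ A) : ∃ (K : Set (Euc d)) (ψ : Euc d → ℂ), IsCompact K ∧
    (∀ y ∈ K, 1/4 ≤ ‖y‖ ∧ 0.8 * ‖y‖ ≤ |⟪y, e⟫|) ∧ ContDiff ℝ (⊤ : ℕ∞) ψ ∧ (∀ y, y ∉ K → ψ y = 0) ∧
    ∀ y, 1/2 ≤ ‖y‖ → ‖y‖ ≤ 2 * A → 0.9 * ‖y‖ ≤ |⟪y, e⟫| → ψ y = 1 := by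
  have hci : Continuous fun y : Euc d => |⟪y, e⟫| := by fun_prop
  set K : Set (Euc d) := {y | 1/4 ≤ ‖y‖} ∩ {y | 0.8 * ‖y‖ ≤ |⟪y, e⟫|} ∩ Metric.closedBall 0 (4 * A) with hK
  set s : Set (Euc d) := {y | ‖y‖ ≤ 1/4} ∪ {y | 4 * A ≤ ‖y‖} ∪ {y | |⟪y, e⟫| ≤ 0.8 * ‖y‖} with hs
  set t : Set (Euc d) := {y | 1/2 ≤ ‖y‖} ∩ {y | ‖y‖ ≤ 2 * A} ∩ {y | 0.9 * ‖y‖ ≤ |⟪y, e⟫|} with ht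
  have hsc : IsClosed s := ((isClosed_le (by fun_prop) (by fun_prop)).union (isClosed_le (by fun_prop) (by fun_prop))).union (isClosed_le hci (by fun_prop))
  have htc : IsClosed t := ((isClosed_le (by fun_prop) (by fun_prop)).inter (isClosed_le (by fun_prop) (by fun_prop))).inter (isClosed_le (by fun_prop) hci)
  have hdis : Disjoint s t := by
    rw [Set.disjoint_left]
    rintro y ((h | h) | h) ⟨⟨h1, h2⟩, h3⟩
    · have h' : ‖y‖ ≤ 1/4 := h; have h1' : 1/2 ≤ ‖y‖ := h1; linarith
    · have h' : 4 * A ≤ ‖y‖ := h; have h1' : ‖y‖ ≤ 2 * A := h2; linarith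
    · have h' : |⟪y, e⟫| ≤ 0.8 * ‖y‖ := h; have h1' : 1/2 ≤ ‖y‖ := h1; have h3' : 0.9 * ‖y‖ ≤ |⟪y, e⟫| := h3; linarith
  obtain ⟨f, hf0, hf1, _⟩ := exists_contMDiffMap_zero_one_of_isClosed (n := (⊤ : ℕ∞)) (modelWithCornersSelf ℝ (Euc d)) hsc htc hdis
  refine ⟨K, fun y => (f y : ℂ), ?_, ?_, ?_, ?_, ?_⟩
  · refine (isCompact_closedBall _ _).inter_left ((isClosed_le (by fun_prop) (by fun_prop)).inter (isClosed_le (by fun_prop) hci))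
  · rintro y ⟨⟨h1, h2⟩, _⟩; exact ⟨h1, h2⟩
  · exact Complex.ofRealCLM.contDiff.comp f.contMDiff.contDiff
  · intro y hy
    have : y ∈ s := by
      by_contra hh
      apply hy
      simp only [hs, Set.mem_union, not_or, Set.mem_ofPred_eq, not_le] at hh
      exact ⟨⟨hh.1.1.le, hh.2.le⟩, mem_closedBall_zero_iff.2 hh.1.2.le⟩
    show ((f y : ℝ) : ℂ) = 0
    rw [hf0 this]; simp
  · intro y h1 h2 h3
    show ((f y : ℝ) : ℂ) = 1
    rw [hf1 ⟨⟨h1, h2⟩, h3⟩]; simp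

theorem cones {d : ℕ} (hd : 1 ≤ d) : ∃ T : Finset (Euc d), (∀ e ∈ T, ‖e‖ = 1) ∧ ∀ ξ : Euc d, ∃ e ∈ T, 0.99 * ‖ξ‖ ≤ ⟪ξ, e⟫ := by
  haveI : Nonempty (Fin d) := ⟨⟨0, hd⟩⟩
  obtain ⟨T, hT1, hT2⟩ := (isCompact_sphere (0 : Euc d) 1).elim_nhds_subcover (fun e => {x | 0.99 < ⟪x, e⟫}) (by
    intro e he
    rw [mem_sphere_zero_iff_norm] at he
    refine (isOpen_lt (by fun_prop) (by fun_prop)).mem_nhds ?_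
    show 0.99 < ⟪e, e⟫
    rw [real_inner_self_eq_norm_sq, he]; norm_num)
  have key : ∀ x : Euc d, ‖x‖ = 1 → ∃ e ∈ T, 0.99 < ⟪x, e⟫ := by
    intro x hx
    have := hT2 (mem_sphere_zero_iff_norm.2 hx)
    simpa using this
  refine ⟨T, fun e he => mem_sphere_zero_iff_norm.1 (hT1 e he), fun ξ => ?_⟩
  by_cases h : ξ = 0
  · obtain ⟨x, hx⟩ := exists_norm_eq (Euc d) zero_le_one
    obtain ⟨e, he, _⟩ := key x hx
    exact ⟨e, he, by simp [h]⟩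
  · have hn : 0 < ‖ξ‖ := norm_pos_iff.2 h
    obtain ⟨e, he, h1⟩ := key (‖ξ‖⁻¹ • ξ) (by rw [norm_smul, norm_inv, norm_norm, inv_mul_cancel₀ hn.ne'])
    refine ⟨e, he, ?_⟩
    rw [real_inner_smul_left, inv_mul_eq_div, lt_div_iff₀ hn] at h1
    exact h1.le

theorem CB1 {d : ℕ} (hd : 1 ≤ d) {e0 : Euc d} (he0 : ‖e0‖ = 1) {K : Set (Euc d)} (hK : IsCompact K)
    (hKe : ∀ y ∈ K, 1/4 ≤ ‖y‖ ∧ 0.8 * ‖y‖ ≤ |⟪y, e0⟫|) {ψ : Euc d → ℂ} (hψ : ContDiff ℝ (⊤ : ℕ∞) ψ)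
    (hψK : ∀ y, y ∉ K → ψ y = 0) {A : ℝ} (hA1 : 1 ≤ A) : ∃ C : ℝ, 0 ≤ C ∧ ∀ Q : ℝ → ℝ, (Monotone Q ∨ Antitone Q) →
    (∀ x, 1 ≤ Q x ∧ Q x ≤ A) → ∀ F, BB F → (∀ ξ, F ξ ≠ 0 → 0.99 * ‖ξ‖ ≤ ⟪ξ, e0⟫) →
    n2 (fun y => ψ y * VV (fun y ξ => 1 - cutQ Q y ξ) F y) ≤ ENNReal.ofReal C * n2 F := by
  obtain ⟨C, hC, h⟩ := CB hd he0 hK hKe hψ hψK hA1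
  obtain ⟨M, hM⟩ : ∃ M, ∀ y, ‖ψ y‖ ≤ M := by
    obtain ⟨M, hM⟩ := hK.exists_bound_of_continuousOn hψ.continuous.continuousOn
    refine ⟨max M 0, fun y => ?_⟩
    by_cases hy : y ∈ K
    · exact (hM y hy).trans (le_max_left _ _)
    · rw [hψK y hy]; simp
  refine ⟨2 * (M ^ 2 * (2 * Real.pi) ^ d + C), by have := Real.pi_pos; positivity, fun Q hQ hQA F hF hFs => ?_⟩
  have hQm : Measurable Q := hQ.elim (fun h => h.measurable) (fun h => h.measurable)
  have e : (fun y => ψ y * VV (fun y ξ => 1 - cutQ Q y ξ) F y) = fun y => ψ y * UU F y + ψ y * VV (cutQ Q) (fun ξ => -F ξ) y := by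
    funext y
    rw [← mul_add, UU_VV]
    congr 1
    unfold VV
    refine Eq.trans ?_ (integral_add (VV_int (k := fun _ _ => 1) measurable_const hF.integrable y (M := 1) (by simp)) (VV_int (cutQ_meas hQm) hF.integrable.neg y (cutQ_le y)))
    refine integral_congr_ae (ae_of_all _ fun ξ => ?_)
    simp only [Pi.neg_apply]; ring
  have hnF : BB (fun ξ => -F ξ) := by
    obtain ⟨h1, M, R, h2⟩ := hF
    exact ⟨h1.neg, M, R, fun ξ => by simpa using h2 ξ⟩
  have hn : n2 (fun ξ => -F ξ) = n2 F := by simp [n2]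
  have h1 := h Q hQ hQA _ hnF (fun ξ h0 => hFs ξ (by simpa using h0))
  rw [hn] at h1
  have h2 : n2 (fun y => ψ y * UU F y) ≤ ENNReal.ofReal (M ^ 2) * (ENNReal.ofReal ((2 * Real.pi) ^ d) * n2 F) := by
    rw [← UU_planch hF]
    refine n2_le_cmul fun y => ?_
    rw [norm_mul]
    exact mul_le_mul_of_nonneg_right (hM y) (norm_nonneg _)
  rw [e]
  have hUm : Measurable (UU F) := by
    have : UU F = VV (fun _ _ => 1) F := funext (UU_VV F)
    rw [this]; exact VV_meas measurable_const hF.1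
  refine (n2_add_le (hψ.continuous.measurable.mul hUm) (hψ.continuous.measurable.mul (VV_meas (cutQ_meas hQm) hnF.1))).trans ?_
  have hp := Real.pi_pos
  rw [ENNReal.ofReal_mul (by norm_num), ENNReal.ofReal_add (by positivity) hC, ENNReal.ofReal_mul (by positivity), mul_assoc, add_mul, mul_assoc, ENNReal.ofReal_ofNat]
  gcongr
  · exact h2
  · exact h1

def kS {d : ℕ} (χ : Euc d → ℂ) (Q w : ℝ → ℝ) (s : ℝ) (y ξ : Euc d) : ℂ :=
  χ ((w ‖ξ‖)⁻¹ • (y + (s * Q ‖ξ‖ / ‖ξ‖) • ξ)) * (if Q ‖ξ‖ < ‖y‖ then 1 else 0)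

theorem kS_meas {d : ℕ} {χ : Euc d → ℂ} (hχ : Continuous χ) {Q w : ℝ → ℝ} (hQ : Measurable Q) (hw : Measurable w) (s : ℝ) :
    Measurable (Function.uncurry (kS χ Q w s)) := by
  unfold kS Function.uncurry
  have h2 : Measurable fun p : Euc d × Euc d => ‖p.2‖ := by fun_prop
  refine (hχ.measurable.comp (((hw.comp h2).inv).smul (measurable_fst.add ((((hQ.comp h2).const_mul s).div h2).smul measurable_snd)))).mul ?_
  exact Measurable.ite (measurableSet_lt (hQ.comp h2) (by fun_prop)) measurable_const measurable_const

theorem fscale {d : ℕ} {X Xh : Euc d → ℂ} (h : ∀ u, X u = UU Xh u) {w W : ℝ} (hw : 0 < w) (hW : 0 < W) (z : Euc d) :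
    X (w⁻¹ • z) = ∫ ζ, Complex.exp (Complex.I * ((⟪W⁻¹ • z, ζ⟫ : ℝ) : ℂ)) * ((((w / W) ^ d : ℝ) : ℂ) * Xh ((w / W) • ζ)) := by
  rw [h]
  unfold UU
  have := Measure.integral_comp_smul (volume : Measure (Euc d)) (fun ζ => Complex.exp (Complex.I * ((⟪w⁻¹ • z, ζ⟫ : ℝ) : ℂ)) * Xh ζ) (w / W)
  have hp : 0 < w / W := div_pos hw hW
  have e : ∀ ζ, Complex.exp (Complex.I * ((⟪W⁻¹ • z, ζ⟫ : ℝ) : ℂ)) * ((((w / W) ^ d : ℝ) : ℂ) * Xh ((w / W) • ζ)) = ((w / W) ^ d : ℝ) • (Complex.exp (Complex.I * ((⟪w⁻¹ • z, (w / W) • ζ⟫ : ℝ) : ℂ)) * Xh ((w / W) • ζ)) := by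
    intro ζ
    rw [Complex.real_smul, real_inner_smul_left, real_inner_smul_left, real_inner_smul_right, show w⁻¹ * (w / W * ⟪z, ζ⟫) = W⁻¹ * ⟪z, ζ⟫ by field_simp]
    ring
  simp only [e]
  rw [integral_smul, this, finrank_euclideanSpace_fin, abs_of_pos (by positivity), smul_inv_smul₀ (by positivity)]

theorem psi_one {d : ℕ} {χ ψ : Euc d → ℂ} {A Rχ W s q w : ℝ} {e y ξ : Euc d} (hψ1 : ∀ y, 1/2 ≤ ‖y‖ → ‖y‖ ≤ 2 * A → 0.9 * ‖y‖ ≤ |⟪y, e⟫| → ψ y = 1)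
    (he : ‖e‖ = 1) (hR : ∀ u, χ u ≠ 0 → ‖u‖ ≤ Rχ) (hQ1 : 1 ≤ q ∧ q ≤ A) (hwp : 0 < w) (hw : w ≤ A * W) (hRW : Rχ * (A * W) ≤ 1/25) (hs : |s| = 1)
    (hξ0 : ξ ≠ 0) (hξ : 0.99 * ‖ξ‖ ≤ ⟪ξ, e⟫) (hc : χ (w⁻¹ • (y + (s * q / ‖ξ‖) • ξ)) ≠ 0) (hy : q < ‖y‖) : ψ y = 1 := by
  have hξn : 0 < ‖ξ‖ := norm_pos_iff.2 hξ0
  have hn := hR _ hc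
  rw [norm_smul, norm_inv, Real.norm_of_nonneg hwp.le, inv_mul_le_iff₀ hwp] at hn
  have hRn : 0 ≤ Rχ := (norm_nonneg _).trans (hR _ hc)
  have hn2 : ‖y + (s * q / ‖ξ‖) • ξ‖ ≤ 1/25 := hn.trans (le_trans (by rw [mul_comm]; exact mul_le_mul_of_nonneg_left hw hRn) hRW)
  have hv : ‖(s * q / ‖ξ‖) • ξ‖ = q := by
    rw [norm_smul, Real.norm_eq_abs, abs_div, abs_mul, hs, one_mul, abs_norm, div_mul_cancel₀ _ hξn.ne', abs_of_nonneg (by linarith)]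
  have hyu : ‖y‖ ≤ q + 1/25 := by
    have := norm_sub_le (y + (s * q / ‖ξ‖) • ξ) ((s * q / ‖ξ‖) • ξ)
    rw [add_sub_cancel_right] at this
    linarith
  have hie : 0.99 * q ≤ |⟪(s * q / ‖ξ‖) • ξ, e⟫| := by
    rw [real_inner_smul_left, abs_mul, abs_div, abs_mul, hs, one_mul, abs_norm, abs_of_nonneg (show 0 ≤ q by linarith), div_mul_eq_mul_div, le_div_iff₀ hξn]
    have := mul_le_mul_of_nonneg_left (hξ.trans (le_abs_self _)) (show 0 ≤ q by linarith)
    linarith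
  have hi2 : |⟪y + (s * q / ‖ξ‖) • ξ, e⟫| ≤ 1/25 := by
    have := abs_real_inner_le_norm (y + (s * q / ‖ξ‖) • ξ) e
    rw [he, mul_one] at this; linarith
  rw [inner_add_left] at hi2
  have h3 : |⟪(s * q / ‖ξ‖) • ξ, e⟫| ≤ |⟪y, e⟫| + 1/25 := by
    have := abs_sub (⟪y, e⟫ + ⟪(s * q / ‖ξ‖) • ξ, e⟫) ⟪y, e⟫
    rw [add_sub_cancel_left] at this
    linarith
  exact hψ1 y (by linarith) (by linarith) (by linarith)

set_option maxHeartbeats 1000000 in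
theorem SBc {d : ℕ} (hd : 1 ≤ d) {χ : Euc d → ℂ} (hχ : ContDiff ℝ (⊤ : ℕ∞) χ) (hχc : HasCompactSupport χ) {Rχ : ℝ}
    (hR : ∀ u, χ u ≠ 0 → ‖u‖ ≤ Rχ) {A : ℝ} (hA1 : 1 ≤ A) {e : Euc d} (he : ‖e‖ = 1) : ∃ C : ℝ, 0 ≤ C ∧ ∀ (Q w : ℝ → ℝ) (W s : ℝ),
    (Monotone Q ∨ Antitone Q) → (∀ x, 1 ≤ Q x ∧ Q x ≤ A) → Measurable w → 0 < W → (∀ x, W ≤ w x ∧ w x ≤ A * W) →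
    Rχ * (A * W) ≤ 1/25 → |s| = 1 → ∀ F, BB F → (∀ ξ, F ξ ≠ 0 → ξ ≠ 0 ∧ 0.99 * ‖ξ‖ ≤ ⟪ξ, e⟫) →
    n2 (VV (kS χ Q w s) F) ≤ ENNReal.ofReal C * n2 F := by
  obtain ⟨K, ψ, hK, hKe, hψ, hψK, hψ1⟩ := psiE e hA1
  obtain ⟨C, hC, hCB⟩ := CB1 hd he hK hKe hψ hψK hA1
  obtain ⟨Xh, hXc, ⟨D, hD, hXD⟩, hX⟩ := finv hχ hχc
  obtain ⟨hz, hhz⟩ : ∃ hz : Euc d → ℝ, ∀ ζ, hz ζ = A ^ d * (D * ((1 + ‖ζ‖) ^ (d + 1))⁻¹) := ⟨_, fun _ => rfl⟩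
  have hz0 : ∀ ζ, 0 < hz ζ := fun ζ => by rw [hhz]; positivity
  have hzc : Continuous hz := by
    rw [show hz = fun ζ => A ^ d * (D * ((1 + ‖ζ‖) ^ (d + 1))⁻¹) from funext hhz]
    refine continuous_const.mul (continuous_const.mul (Continuous.inv₀ (by fun_prop) fun ζ => by positivity))
  have hzi : Integrable hz := by
    have := integrable_one_add_norm (E := Euc d) (μ := volume) (r := (d + 1 : ℕ)) (by simp)
    refine ((this.const_mul D).const_mul (A ^ d)).congr (ae_of_all _ fun ζ => ?_)
    simp only [hhz]
    rw [Real.rpow_neg (by positivity), Real.rpow_natCast]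
  refine ⟨(∫ ζ, hz ζ) ^ 2 * C, mul_nonneg (sq_nonneg _) hC, fun Q w W s hQ hQA hwm hW hw hRW hs F hF hFs => ?_⟩
  have hQm : Measurable Q := hQ.elim (fun h => h.measurable) (fun h => h.measurable)
  have hA0 : 0 < A := by linarith
  obtain ⟨q, hq⟩ : ∃ q : Euc d → Euc d → ℂ, ∀ ζ ξ, q ζ ξ = Complex.exp (Complex.I * ((⟪W⁻¹ • (s * Q ‖ξ‖ / ‖ξ‖) • ξ, ζ⟫ : ℝ) : ℂ)) * ((((w ‖ξ‖ / W) ^ d : ℝ) : ℂ) * Xh ((w ‖ξ‖ / W) • ζ)) * F ξ := ⟨_, fun _ _ => rfl⟩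
  have hqm : Measurable (Function.uncurry q) := by
    unfold Function.uncurry
    simp only [hq]
    have h2 : Measurable fun p : Euc d × Euc d => ‖p.2‖ := by fun_prop
    have h3 : Measurable fun p : Euc d × Euc d => w ‖p.2‖ / W := (hwm.comp h2).div_const W
    have h4 : Measurable fun p : Euc d × Euc d => ⟪W⁻¹ • (s * Q ‖p.2‖ / ‖p.2‖) • p.2, p.1⟫ :=
      Measurable.inner (Measurable.const_smul (g := fun p : Euc d × Euc d => (s * Q ‖p.2‖ / ‖p.2‖) • p.2) (((hQm.comp h2).const_mul s |>.div h2).smul measurable_snd) W⁻¹) measurable_fst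
    refine Measurable.mul (Measurable.mul ?_ (Measurable.mul ?_ ?_)) (hF.1.comp measurable_snd)
    · exact Complex.measurable_exp.comp ((Complex.measurable_ofReal.comp h4).const_mul _)
    · exact Complex.measurable_ofReal.comp (h3.pow_const d)
    · exact hXc.measurable.comp (h3.smul measurable_fst)
  have hqb : ∀ ζ ξ, ‖q ζ ξ‖ ≤ hz ζ * ‖F ξ‖ := by
    intro ζ ξ
    have a1 : 1 ≤ w ‖ξ‖ / W := by rw [le_div_iff₀ hW, one_mul]; exact (hw _).1
    have a2 : w ‖ξ‖ / W ≤ A := by rw [div_le_iff₀ hW]; exact (hw _).2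
    simp only [hq, hhz]
    rw [norm_mul, norm_mul, norm_mul, mul_comm Complex.I, Complex.norm_exp_ofReal_mul_I, one_mul, Complex.norm_real, Real.norm_of_nonneg (by positivity)]
    gcongr
    refine (hXD _).trans ?_
    gcongr
    rw [norm_smul, Real.norm_of_nonneg (by linarith)]
    nlinarith [norm_nonneg ζ]
  obtain ⟨H, hH⟩ : ∃ H : Euc d → Euc d → ℂ, ∀ ζ y, H ζ y = ψ y * VV (fun y ξ => 1 - cutQ Q y ξ) (fun ξ => ((hz ζ : ℝ) : ℂ)⁻¹ * q ζ ξ) y := ⟨_, fun _ _ => rfl⟩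
  have hcm : Measurable (Function.uncurry fun y ξ : Euc d => 1 - cutQ Q y ξ) := measurable_const.sub (cutQ_meas hQm)
  have hcb : ∀ y ξ : Euc d, ‖1 - cutQ Q y ξ‖ ≤ 1 := by
    intro y ξ; unfold cutQ; split_ifs <;> simp
  have hgm : Measurable fun p : Euc d × Euc d => ((hz p.1 : ℝ) : ℂ)⁻¹ * q p.1 p.2 :=
    (Complex.measurable_ofReal.comp (hzc.measurable.comp measurable_fst)).inv.mul hqm
  have hHm : Measurable (Function.uncurry H) := by
    unfold Function.uncurry
    simp only [hH]
    refine (hψ.continuous.measurable.comp measurable_snd).mul ?_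
    have : StronglyMeasurable fun p : Euc d × Euc d => VV (fun y ξ => 1 - cutQ Q y ξ) (fun ξ => ((hz p.1 : ℝ) : ℂ)⁻¹ * q p.1 ξ) p.2 := by
      unfold VV
      apply StronglyMeasurable.integral_prod_right' (f := fun p : (Euc d × Euc d) × Euc d => Complex.exp (Complex.I * ((⟪p.1.2, p.2⟫ : ℝ) : ℂ)) * ((1 - cutQ Q p.1.2 p.2) * (((hz p.1.1 : ℝ) : ℂ)⁻¹ * q p.1.1 p.2)))
      apply Measurable.stronglyMeasurable
      have h1 : Continuous fun p : (Euc d × Euc d) × Euc d => Complex.exp (Complex.I * ((⟪p.1.2, p.2⟫ : ℝ) : ℂ)) := by fun_prop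
      have m1 : Measurable fun p : (Euc d × Euc d) × Euc d => (p.1.2, p.2) := by fun_prop
      have m2 : Measurable fun p : (Euc d × Euc d) × Euc d => (p.1.1, p.2) := by fun_prop
      exact h1.measurable.mul ((hcm.comp m1).mul (hgm.comp m2))
    exact this.measurable
  have hB : ∀ ζ, n2 (H ζ) ≤ ENNReal.ofReal C * n2 F := by
    intro ζ
    have b : ∀ ξ, ‖((hz ζ : ℝ) : ℂ)⁻¹ * q ζ ξ‖ ≤ ‖F ξ‖ := by
      intro ξ
      rw [norm_mul, norm_inv, Complex.norm_real, Real.norm_of_nonneg (hz0 ζ).le, inv_mul_le_iff₀ (hz0 ζ)]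
      exact hqb ζ ξ
    have hb : BB fun ξ => ((hz ζ : ℝ) : ℂ)⁻¹ * q ζ ξ := by
      obtain ⟨_, M, R, h2⟩ := hF
      refine ⟨hgm.comp (measurable_const.prodMk measurable_id), M, R, fun ξ => ⟨(b ξ).trans (h2 ξ).1, fun h => ?_⟩⟩
      have := b ξ
      rw [(h2 ξ).2 h, norm_zero] at this
      exact norm_le_zero_iff.1 this
    rw [show H ζ = _ from funext (hH ζ)]
    refine (hCB Q hQ hQA _ hb fun ξ h0 => ?_).trans (by gcongr; exact n2_mono b)
    exact (hFs ξ fun hf => h0 (by rw [← norm_le_zero_iff]; simpa [hf] using b ξ)).2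
  have hpt : ∀ y ξ, kS χ Q w s y ξ * F ξ = ψ y * (1 - cutQ Q y ξ) * ∫ ζ, Complex.exp (Complex.I * ((⟪W⁻¹ • y, ζ⟫ : ℝ) : ℂ)) * q ζ ξ := by
    intro y ξ
    have hwp : 0 < w ‖ξ‖ := hW.trans_le (hw _).1
    have e1 : ∫ ζ, Complex.exp (Complex.I * ((⟪W⁻¹ • y, ζ⟫ : ℝ) : ℂ)) * q ζ ξ = χ ((w ‖ξ‖)⁻¹ • (y + (s * Q ‖ξ‖ / ‖ξ‖) • ξ)) * F ξ := by
      rw [fscale hX hwp hW, ← integral_mul_const]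
      refine integral_congr_ae (ae_of_all _ fun ζ => ?_)
      simp only [hq]
      rw [smul_add, inner_add_left, Complex.ofReal_add, mul_add, Complex.exp_add]
      ring
    rw [e1]
    have e2 : (if Q ‖ξ‖ < ‖y‖ then (1:ℂ) else 0) = 1 - cutQ Q y ξ := by
      unfold cutQ
      by_cases h : ‖y‖ ≤ Q ‖ξ‖
      · rw [if_pos h, if_neg (not_lt.2 h)]; simp
      · rw [if_neg h, if_pos (not_le.1 h)]; simp
    unfold kS
    rw [e2]
    by_cases hf : F ξ = 0
    · rw [hf]; ring
    by_cases hc : χ ((w ‖ξ‖)⁻¹ • (y + (s * Q ‖ξ‖ / ‖ξ‖) • ξ)) = 0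
    · rw [hc]; ring
    by_cases hy : ‖y‖ ≤ Q ‖ξ‖
    · have : 1 - cutQ Q y ξ = 0 := by unfold cutQ; rw [if_pos hy]; simp
      rw [this]; ring
    suffices ψ y = 1 by rw [this]; ring
    obtain ⟨hξ0, hξ⟩ := hFs ξ hf
    exact psi_one hψ1 he hR (hQA _) hwp ((hw _).2) hRW hs hξ0 hξ hc (not_le.1 hy)
  have hid : ∀ y, VV (kS χ Q w s) F y = ∫ ζ, Complex.exp (Complex.I * ((⟪W⁻¹ • y, ζ⟫ : ℝ) : ℂ)) * (((hz ζ : ℝ) : ℂ) * H ζ y) := by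
    intro y
    have c1 : VV (kS χ Q w s) F y = ∫ ξ, ∫ ζ, Complex.exp (Complex.I * ((⟪y, ξ⟫ : ℝ) : ℂ)) * (ψ y * (1 - cutQ Q y ξ)) * (Complex.exp (Complex.I * ((⟪W⁻¹ • y, ζ⟫ : ℝ) : ℂ)) * q ζ ξ) := by
      unfold VV
      refine integral_congr_ae (ae_of_all _ fun ξ => ?_)
      simp only
      rw [hpt, integral_const_mul]; ring
    rw [c1, integral_integral_swap]
    · refine integral_congr_ae (ae_of_all _ fun ζ => ?_)
      simp only [hH]
      unfold VV
      rw [← integral_const_mul, ← integral_const_mul, ← integral_const_mul]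
      refine integral_congr_ae (ae_of_all _ fun ξ => ?_)
      have : ((hz ζ : ℝ) : ℂ) * ((hz ζ : ℝ) : ℂ)⁻¹ = 1 := mul_inv_cancel₀ (by exact_mod_cast (hz0 ζ).ne')
      linear_combination (-(Complex.exp (Complex.I * ((⟪y, ξ⟫ : ℝ) : ℂ)) * (ψ y * (1 - cutQ Q y ξ)) * (Complex.exp (Complex.I * ((⟪W⁻¹ • y, ζ⟫ : ℝ) : ℂ)) * q ζ ξ))) * this
    · have hi := (hF.integrable.norm.mul_prod hzi).const_mul ‖ψ y‖
      refine hi.mono' ?_ (ae_of_all _ fun p => ?_)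
      · apply Measurable.aestronglyMeasurable
        have h1 : Continuous fun p : Euc d × Euc d => Complex.exp (Complex.I * ((⟪y, p.1⟫ : ℝ) : ℂ)) := by fun_prop
        have h2 : Continuous fun p : Euc d × Euc d => Complex.exp (Complex.I * ((⟪W⁻¹ • y, p.2⟫ : ℝ) : ℂ)) := by fun_prop
        exact (h1.measurable.mul ((hcm.comp (measurable_const.prodMk measurable_fst)).const_mul _)).mul (h2.measurable.mul (hqm.comp measurable_swap))
      · show ‖Complex.exp (Complex.I * ((⟪y, p.1⟫ : ℝ) : ℂ)) * (ψ y * (1 - cutQ Q y p.1)) * (Complex.exp (Complex.I * ((⟪W⁻¹ • y, p.2⟫ : ℝ) : ℂ)) * q p.2 p.1)‖ ≤ ‖ψ y‖ * (‖F p.1‖ * hz p.2)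
        rw [norm_mul, norm_mul, norm_mul, norm_mul, mul_comm Complex.I, Complex.norm_exp_ofReal_mul_I, mul_comm Complex.I, Complex.norm_exp_ofReal_mul_I, one_mul, one_mul, mul_assoc]
        refine mul_le_mul_of_nonneg_left ?_ (norm_nonneg _)
        have := mul_le_mul (hcb y p.1) (hqb p.2 p.1) (norm_nonneg _) zero_le_one
        linarith
  have hfin := mink (μ := volume) (h := fun ζ => ENNReal.ofReal (hz ζ)) hzc.measurable.ennreal_ofReal hHm (G := VV (kS χ Q w s) F) (fun y => by
    rw [hid y]
    refine (enorm_integral_le_lintegral_enorm _).trans (le_of_eq (lintegral_congr fun ζ => ?_))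
    rw [enorm_mul, enorm_mul, ← ofReal_norm_eq_enorm (Complex.exp _), mul_comm Complex.I, Complex.norm_exp_ofReal_mul_I, ENNReal.ofReal_one, one_mul, ← ofReal_norm_eq_enorm ((hz ζ : ℝ) : ℂ), Complex.norm_real, Real.norm_of_nonneg (hz0 ζ).le]) hB
  refine hfin.trans (le_of_eq ?_)
  rw [← ofReal_integral_eq_lintegral_ofReal hzi (ae_of_all _ fun ζ => (hz0 ζ).le), ENNReal.ofReal_mul (sq_nonneg _), ENNReal.ofReal_pow (integral_nonneg fun ζ => (hz0 ζ).le), mul_assoc]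

theorem VV_add {d : ℕ} {k : Euc d → Euc d → ℂ} (hk : Measurable (Function.uncurry k)) {M : ℝ} (hM : ∀ y ξ, ‖k y ξ‖ ≤ M) {F G : Euc d → ℂ} (hF : Integrable F) (hG : Integrable G) (y : Euc d) :
    VV k (fun ξ => F ξ + G ξ) y = VV k F y + VV k G y := by
  unfold VV
  rw [← integral_add (VV_int hk hF y (hM y)) (VV_int hk hG y (hM y))]
  refine integral_congr_ae (ae_of_all _ fun ξ => ?_)
  simp only; ring

theorem kS_le {d : ℕ} {χ : Euc d → ℂ} {M : ℝ} (hM : ∀ u, ‖χ u‖ ≤ M) {Q w : ℝ → ℝ} {s : ℝ} (y ξ : Euc d) : ‖kS χ Q w s y ξ‖ ≤ M := by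
  have := (norm_nonneg _).trans (hM 0)
  unfold kS; split_ifs
  · rw [mul_one]; exact hM _
  · simpa using this

theorem chi_bd {d : ℕ} {χ : Euc d → ℂ} (hχ : ContDiff ℝ (⊤ : ℕ∞) χ) (hχc : HasCompactSupport χ) : ∃ M R : ℝ, 0 ≤ R ∧ (∀ u, ‖χ u‖ ≤ M) ∧ ∀ u, χ u ≠ 0 → ‖u‖ ≤ R := by
  obtain ⟨M, hM⟩ := hχc.exists_bound_of_continuous hχ.continuous
  obtain ⟨R, hR⟩ := hχc.isCompact.isBounded.exists_norm_le
  exact ⟨M, max R 0, le_max_right _ _, hM, fun u hu => (hR u (subset_tsupport _ hu)).trans (le_max_left _ _)⟩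

theorem SB {d : ℕ} (hd : 1 ≤ d) {χ : Euc d → ℂ} (hχ : ContDiff ℝ (⊤ : ℕ∞) χ) (hχc : HasCompactSupport χ) {Rχ : ℝ}
    (hR : ∀ u, χ u ≠ 0 → ‖u‖ ≤ Rχ) {A : ℝ} (hA1 : 1 ≤ A) : ∃ C : ℝ, 0 ≤ C ∧ ∀ (Q w : ℝ → ℝ) (W s : ℝ),
    (Monotone Q ∨ Antitone Q) → (∀ x, 1 ≤ Q x ∧ Q x ≤ A) → Measurable w → 0 < W → (∀ x, W ≤ w x ∧ w x ≤ A * W) →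
    Rχ * (A * W) ≤ 1/25 → |s| = 1 → ∀ F, BB F → F 0 = 0 →
    n2 (VV (kS χ Q w s) F) ≤ ENNReal.ofReal C * n2 F := by
  classical
  obtain ⟨M, _, _, hM, _⟩ := chi_bd hχ hχc
  have key : ∀ T : Finset (Euc d), (∀ e ∈ T, ‖e‖ = 1) → ∃ C : ℝ, 0 ≤ C ∧ ∀ (Q w : ℝ → ℝ) (W s : ℝ),
      (Monotone Q ∨ Antitone Q) → (∀ x, 1 ≤ Q x ∧ Q x ≤ A) → Measurable w → 0 < W → (∀ x, W ≤ w x ∧ w x ≤ A * W) →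
      Rχ * (A * W) ≤ 1/25 → |s| = 1 → ∀ F, BB F → (∀ ξ, F ξ ≠ 0 → ξ ≠ 0 ∧ ∃ e ∈ T, 0.99 * ‖ξ‖ ≤ ⟪ξ, e⟫) →
      n2 (VV (kS χ Q w s) F) ≤ ENNReal.ofReal C * n2 F := by
    intro T
    induction T using Finset.induction_on with
    | empty =>
      intro _
      refine ⟨0, le_rfl, fun Q w W s _ _ _ _ _ _ _ F _ hF => ?_⟩
      have h0 : F = fun _ => 0 := by
        funext ξ; by_contra h; obtain ⟨_, e, he, _⟩ := hF ξ h; simp at he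
      have : VV (kS χ Q w s) F = fun _ => 0 := by funext y; unfold VV; simp [h0]
      rw [this]; simp [n2]
    | insert a T _ ih =>
      intro hT
      obtain ⟨C1, hC1, h1⟩ := ih fun e he => hT e (Finset.mem_insert_of_mem he)
      obtain ⟨C2, hC2, h2⟩ := SBc hd hχ hχc hR hA1 (hT a (Finset.mem_insert_self a T))
      refine ⟨2 * (C2 + C1), by positivity, fun Q w W s hQ hQA hwm hW hw hRW hs F hF hFs => ?_⟩
      have hQm : Measurable Q := hQ.elim (fun h => h.measurable) (fun h => h.measurable)
      have hkm := kS_meas (d := d) hχ.continuous hQm hwm s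
      set S : Set (Euc d) := {ξ | 0.99 * ‖ξ‖ ≤ ⟪ξ, a⟫} with hS
      have hSm : MeasurableSet S := measurableSet_le (by fun_prop) (by fun_prop)
      have hB1 := hF.ind hSm
      have hB2 := hF.ind hSm.compl
      have e : VV (kS χ Q w s) F = fun y => VV (kS χ Q w s) (S.indicator F) y + VV (kS χ Q w s) (Sᶜ.indicator F) y := by
        funext y
        rw [← VV_add hkm (fun y ξ => kS_le hM y ξ) hB1.integrable hB2.integrable]
        congr 1; funext ξ
        exact (Set.indicator_self_add_compl_apply S F ξ).symm
      rw [e]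
      refine (n2_add_le (VV_meas hkm hB1.1) (VV_meas hkm hB2.1)).trans ?_
      have l1 := h2 Q w W s hQ hQA hwm hW hw hRW hs _ hB1 (fun ξ hξ => by
        have hm := Set.mem_of_indicator_ne_zero hξ
        rw [Set.indicator_of_mem hm] at hξ
        exact ⟨(hFs ξ hξ).1, hm⟩)
      have l2 := h1 Q w W s hQ hQA hwm hW hw hRW hs _ hB2 (fun ξ hξ => by
        have hm := Set.mem_of_indicator_ne_zero hξ
        rw [Set.indicator_of_mem hm] at hξ
        obtain ⟨h0, e, he, h3⟩ := hFs ξ hξ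
        refine ⟨h0, e, ?_, h3⟩
        rcases Finset.mem_insert.1 he with rfl | h
        · exact absurd h3 hm
        · exact h)
      have m1 : n2 (S.indicator F) ≤ n2 F := n2_mono fun ξ => norm_indicator_le_norm_self _ _
      have m2 : n2 (Sᶜ.indicator F) ≤ n2 F := n2_mono fun ξ => norm_indicator_le_norm_self _ _
      rw [ENNReal.ofReal_mul (by norm_num), ENNReal.ofReal_add hC2 hC1, mul_assoc, add_mul, ENNReal.ofReal_ofNat]
      gcongr
      · exact l1.trans (by gcongr)
      · exact l2.trans (by gcongr)
  obtain ⟨T, hT1, hT2⟩ := cones hd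
  obtain ⟨C, hC, h⟩ := key T hT1
  exact ⟨C, hC, fun Q w W s hQ hQA hwm hW hw hRW hs F hF hF0 => h Q w W s hQ hQA hwm hW hw hRW hs F hF fun ξ hξ => ⟨fun h => hξ (h ▸ hF0), hT2 ξ⟩⟩

theorem bdd_ext {h : ℝ → ℝ} (hc : ContinuousOn h (Set.Ioi 0)) (h0 : ∃ C, ∀ᶠ ρ in 𝓝[>] (0:ℝ), h ρ ≤ C) (h1 : ∃ C, ∀ᶠ ρ in atTop, h ρ ≤ C) :
    ∃ C, 1 ≤ C ∧ ∀ ρ, 0 < ρ → h ρ ≤ C := by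
  obtain ⟨C0, h0⟩ := h0
  obtain ⟨C1, h1⟩ := h1
  obtain ⟨a, ha, h0⟩ := mem_nhdsGT_iff_exists_Ioo_subset.1 h0
  obtain ⟨b, h1⟩ := eventually_atTop.1 h1
  have ha' : 0 < a := ha
  obtain ⟨C2, h2⟩ := (isCompact_Icc (a := a) (b := b)).exists_bound_of_continuousOn (hc.mono fun x hx => ha'.trans_le hx.1)
  refine ⟨max 1 (max C0 (max C1 C2)), le_max_left _ _, fun ρ hρ => ?_⟩
  rcases lt_or_ge ρ a with g | g
  · exact (h0 ⟨hρ, g⟩ : h ρ ≤ C0).trans (by simp)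
  rcases le_total ρ b with h' | h'
  · exact ((le_abs_self _).trans (h2 ρ ⟨g, h'⟩)).trans (by simp)
  · exact (h1 ρ h').trans (by simp)

theorem dblF {p : ℝ → ℝ} {l : Filter ℝ} {a L c C : ℝ} (hpos : ∀ᶠ ρ in l, 0 < ρ) (ha : Tendsto (fun ρ : ℝ => ρ ^ a) l (𝓝 0))
    (h2 : Tendsto (fun ρ : ℝ => 2 * ρ) l l) (hc : 0 < c) (hL : 0 ≤ L) (hp : ∀ᶠ ρ in l, 0 < p ρ)
    (hb : ∀ᶠ ρ in l, c * ρ ^ a ≤ |p ρ - L| ∧ |p ρ - L| ≤ C * ρ ^ a) :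
    ∃ D, ∀ᶠ ρ in l, p (2 * ρ) ≤ D * p ρ ∧ p ρ ≤ D * p (2 * ρ) ∧ ρ ^ a ≤ D * p ρ := by
  rcases hL.eq_or_lt with rfl | hL
  · refine ⟨max (C * 2 ^ a / c) (max (C / 2 ^ a / c) c⁻¹), ?_⟩
    filter_upwards [hpos, hp, hb, h2.eventually hp, h2.eventually hb] with ρ r0 p0 b0 p1 b1
    rw [sub_zero, abs_of_pos p0] at b0
    rw [sub_zero, abs_of_pos p1, Real.mul_rpow (by norm_num) r0.le] at b1
    have t2 : (0:ℝ) < 2 ^ a := by positivity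
    have tr : (0:ℝ) < ρ ^ a := by positivity
    have hC : 0 < C := by
      by_contra h
      have := mul_nonneg (neg_nonneg.2 (not_lt.1 h)) tr.le
      linarith [b0.2]
    refine ⟨?_, ?_, ?_⟩
    · calc p (2 * ρ) ≤ C * 2 ^ a / c * (c * ρ ^ a) := by
            refine b1.2.trans (le_of_eq ?_); field_simp
        _ ≤ C * 2 ^ a / c * p ρ := by gcongr; exact b0.1
        _ ≤ _ := by gcongr; simp
    · calc p ρ ≤ C / 2 ^ a / c * (c * (2 ^ a * ρ ^ a)) := by
            refine b0.2.trans (le_of_eq ?_); field_simp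
        _ ≤ C / 2 ^ a / c * p (2 * ρ) := by gcongr; exact b1.1
        _ ≤ _ := by gcongr; simp
    · calc ρ ^ a = c⁻¹ * (c * ρ ^ a) := by field_simp
        _ ≤ c⁻¹ * p ρ := by gcongr; exact b0.1
        _ ≤ _ := by gcongr; simp
  · have hC0 : Tendsto (fun ρ : ℝ => C * ρ ^ a) l (𝓝 0) := by simpa using ha.const_mul C
    have hs : ∀ᶠ ρ in l, |p ρ - L| ≤ L / 2 := by
      filter_upwards [hb, hC0.eventually (gt_mem_nhds (show (0:ℝ) < L / 2 by linarith))] with ρ b h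
      linarith [b.2]
    refine ⟨max 3 (2 / L), ?_⟩
    filter_upwards [hs, h2.eventually hs, ha.eventually (gt_mem_nhds (show (0:ℝ) < 1 by norm_num))] with ρ s1 s2 s3
    rw [abs_le] at s1 s2
    have hpp : 0 < p ρ := by linarith
    have hpp2 : 0 < p (2 * ρ) := by linarith
    refine ⟨?_, ?_, ?_⟩
    · calc p (2 * ρ) ≤ 3 * p ρ := by linarith
        _ ≤ _ := by gcongr; simp
    · calc p ρ ≤ 3 * p (2 * ρ) := by linarith
        _ ≤ _ := by gcongr; simp
    · calc ρ ^ a ≤ 2 / L * (L / 2) := by field_simp; linarith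
        _ ≤ 2 / L * p ρ := by gcongr; linarith
        _ ≤ _ := by gcongr; simp

def mm (a b ρ : ℝ) : ℝ := min (ρ ^ a) (ρ ^ b)

theorem mm_pos {a b ρ : ℝ} (h : 0 < ρ) : 0 < mm a b ρ := lt_min (by positivity) (by positivity)

theorem mm_cont (a b : ℝ) : ContinuousOn (mm a b) (Set.Ioi 0) := by
  unfold mm
  exact ContinuousOn.inf (fun x hx => (Real.continuousAt_rpow_const _ _ (Or.inl (ne_of_gt hx))).continuousWithinAt) (fun x hx => (Real.continuousAt_rpow_const _ _ (Or.inl (ne_of_gt hx))).continuousWithinAt)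

theorem rp0 {a : ℝ} (ha : 0 < a) : Tendsto (fun ρ : ℝ => ρ ^ a) (𝓝[>] 0) (𝓝 0) := by
  have := (Real.continuousAt_rpow_const (0:ℝ) a (Or.inr ha.le)).tendsto
  rw [Real.zero_rpow ha.ne'] at this
  exact this.mono_left nhdsWithin_le_nhds

theorem two0 : Tendsto (fun ρ : ℝ => 2 * ρ) (𝓝[>] 0) (𝓝[>] 0) := by
  apply tendsto_nhdsWithin_of_tendsto_nhds_of_eventually_within
  · have : Tendsto (fun ρ : ℝ => 2 * ρ) (𝓝 0) (𝓝 (2 * 0)) := (continuous_const.mul continuous_id).tendsto 0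
    rw [mul_zero] at this
    exact this.mono_left nhdsWithin_le_nhds
  · filter_upwards [self_mem_nhdsWithin] with ρ h
    exact mul_pos two_pos (show (0:ℝ) < ρ from h)

theorem dblP {p₀ p₁ P₀ P₁ : ℝ} (hp1 : p₁ < 0) (hp0 : 0 < p₀) (hP₀ : 0 ≤ P₀) (hP₁ : 0 ≤ P₁) {P : ℝ → ℝ} (hP : HypH p₀ p₁ P₀ P₁ P) :
    ContinuousOn (deriv P) (Set.Ioi 0) ∧ ∃ D, 1 ≤ D ∧ ∀ ρ, 0 < ρ → deriv P (2 * ρ) ≤ D * deriv P ρ ∧ deriv P ρ ≤ D * deriv P (2 * ρ) ∧ mm p₀ p₁ ρ ≤ D * deriv P ρ := by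
  obtain ⟨hsm, hpos, _, ⟨c0, C0, r0, hc0, _, hr0, h0⟩, ⟨c1, C1, r1, hc1, _, h1⟩, _⟩ := hP
  have hcont : ContinuousOn (deriv P) (Set.Ioi 0) := hsm.continuousOn_deriv_of_isOpen isOpen_Ioi (by simp)
  have ev0 : ∀ᶠ ρ in 𝓝[>] (0:ℝ), 0 < ρ := self_mem_nhdsWithin
  obtain ⟨D0, hD0⟩ := dblF (p := deriv P) (C := C0) ev0 (rp0 hp0) two0 hc0 hP₀ (ev0.mono hpos) (by
    filter_upwards [ev0, Ioo_mem_nhdsGT hr0] with ρ a b using (h0 ρ a b.2).1)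
  have ev1 : ∀ᶠ ρ in (atTop : Filter ℝ), 0 < ρ := eventually_gt_atTop 0
  obtain ⟨D1, hD1⟩ := dblF (p := deriv P) (C := C1) ev1 (by simpa using tendsto_rpow_neg_atTop (y := -p₁) (by linarith)) (tendsto_id.const_mul_atTop two_pos) hc1 hP₁ (ev1.mono hpos) (by
    filter_upwards [eventually_gt_atTop r1] with ρ a using (h1 ρ a).1)
  have hc2 : ContinuousOn (fun ρ => deriv P (2 * ρ)) (Set.Ioi 0) := hcont.comp (by fun_prop) fun x hx => mul_pos two_pos (show (0:ℝ) < x from hx)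
  have q1 := bdd_ext (h := fun ρ => deriv P (2 * ρ) / deriv P ρ) (hc2.div hcont fun x hx => (hpos x hx).ne')
    ⟨D0, by filter_upwards [hD0, ev0] with ρ a b; rw [div_le_iff₀ (hpos _ b)]; exact a.1⟩
    ⟨D1, by filter_upwards [hD1, ev1] with ρ a b; rw [div_le_iff₀ (hpos _ b)]; exact a.1⟩
  have q2 := bdd_ext (h := fun ρ => deriv P ρ / deriv P (2 * ρ)) (hcont.div hc2 fun x hx => (hpos _ (mul_pos two_pos hx)).ne')
    ⟨D0, by filter_upwards [hD0, ev0] with ρ a b; rw [div_le_iff₀ (hpos _ (mul_pos two_pos b))]; exact a.2.1⟩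
    ⟨D1, by filter_upwards [hD1, ev1] with ρ a b; rw [div_le_iff₀ (hpos _ (mul_pos two_pos b))]; exact a.2.1⟩
  have q3 := bdd_ext (h := fun ρ => mm p₀ p₁ ρ / deriv P ρ) ((mm_cont _ _).div hcont fun x hx => (hpos x hx).ne')
    ⟨D0, by filter_upwards [hD0, ev0] with ρ a b; rw [div_le_iff₀ (hpos _ b)]; exact (min_le_left _ _).trans a.2.2⟩
    ⟨D1, by filter_upwards [hD1, ev1] with ρ a b; rw [div_le_iff₀ (hpos _ b)]; exact (min_le_right _ _).trans a.2.2⟩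
  obtain ⟨E1, hE1, q1⟩ := q1
  obtain ⟨E2, hE2, q2⟩ := q2
  obtain ⟨E3, hE3, q3⟩ := q3
  refine ⟨hcont, max E1 (max E2 E3), hE1.trans (le_max_left _ _), fun ρ hρ => ?_⟩
  have a1 := q1 ρ hρ
  have a2 := q2 ρ hρ
  have a3 := q3 ρ hρ
  have b1 := hpos ρ hρ
  have b2 := hpos (2 * ρ) (mul_pos two_pos hρ)
  simp only [div_le_iff₀ b1, div_le_iff₀ b2] at a1 a2 a3
  exact ⟨a1.trans (by gcongr; simp), a2.trans (by gcongr; simp), a3.trans (by gcongr; simp)⟩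

theorem LamC {σ₀ σ₁ lam₁ : ℝ} (h0 : 0 < σ₀) (h1 : σ₁ < 0) {Λ : ℝ → ℝ} (hΛ : CondC σ₀ σ₁ lam₁ Λ) :
    ∃ D, 1 ≤ D ∧ ∀ ρ, 0 < ρ → Λ ρ ≤ D * mm σ₀ σ₁ ρ ∧ mm σ₀ σ₁ ρ ≤ D * Λ ρ := by
  obtain ⟨hsm, hpos, ⟨c0, C0, r0, hc0, hcC0, hr0, b0⟩, ⟨c1, C1, r1, hc1, hcC1, b1⟩, _, _⟩ := hΛ
  have ev0 : ∀ᶠ ρ in 𝓝[>] (0:ℝ), 0 < ρ := self_mem_nhdsWithin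
  have m0 : ∀ ρ : ℝ, 0 < ρ → ρ ≤ 1 → mm σ₀ σ₁ ρ = ρ ^ σ₀ := fun ρ a b => min_eq_left (Real.rpow_le_rpow_of_exponent_ge a b (by linarith))
  have m1 : ∀ ρ : ℝ, 1 ≤ ρ → mm σ₀ σ₁ ρ = ρ ^ σ₁ := fun ρ a => min_eq_right (Real.rpow_le_rpow_of_exponent_le a (by linarith))
  have ev0' : ∀ᶠ ρ in 𝓝[>] (0:ℝ), 0 < ρ ∧ ρ < r0 ∧ ρ < 1 := by
    filter_upwards [ev0, Ioo_mem_nhdsGT hr0, Ioo_mem_nhdsGT zero_lt_one] with ρ a b c using ⟨a, b.2, c.2⟩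
  have ev1' : ∀ᶠ ρ in (atTop : Filter ℝ), 1 < ρ ∧ r1 < ρ := (eventually_gt_atTop 1).and (eventually_gt_atTop r1)
  have q1 := bdd_ext (h := fun ρ => Λ ρ / mm σ₀ σ₁ ρ) (hsm.continuousOn.div (mm_cont _ _) fun x hx => (mm_pos hx).ne')
    ⟨C0, by filter_upwards [ev0'] with ρ a; rw [div_le_iff₀ (mm_pos a.1), m0 ρ a.1 a.2.2.le]; exact (b0 ρ a.1 a.2.1).2⟩
    ⟨C1, by filter_upwards [ev1'] with ρ a; rw [div_le_iff₀ (mm_pos (by linarith)), m1 ρ a.1.le]; exact (b1 ρ a.2).2⟩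
  have q2 := bdd_ext (h := fun ρ => mm σ₀ σ₁ ρ / Λ ρ) ((mm_cont _ _).div hsm.continuousOn fun x hx => (hpos x hx).ne')
    ⟨c0⁻¹, by filter_upwards [ev0'] with ρ a; rw [div_le_iff₀ (hpos _ a.1), m0 ρ a.1 a.2.2.le, le_inv_mul_iff₀ hc0]; exact (b0 ρ a.1 a.2.1).1⟩
    ⟨c1⁻¹, by filter_upwards [ev1'] with ρ a; rw [div_le_iff₀ (hpos _ (by linarith)), m1 ρ a.1.le, le_inv_mul_iff₀ hc1]; exact (b1 ρ a.2).1⟩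
  obtain ⟨E1, hE1, q1⟩ := q1
  obtain ⟨E2, hE2, q2⟩ := q2
  refine ⟨max E1 E2, hE1.trans (le_max_left _ _), fun ρ hρ => ?_⟩
  have a1 := q1 ρ hρ
  have a2 := q2 ρ hρ
  have b2 := hpos ρ hρ
  have b1 := mm_pos (a := σ₀) (b := σ₁) hρ
  simp only [div_le_iff₀ b1, div_le_iff₀ b2] at a1 a2
  exact ⟨a1.trans (by gcongr; simp), a2.trans (by gcongr; simp)⟩

theorem Lam_dbl {σ₀ σ₁ lam₁ : ℝ} (h0 : 0 < σ₀) (h1 : σ₁ < 0) {Λ : ℝ → ℝ} (hΛ : CondC σ₀ σ₁ lam₁ Λ) :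
    ∃ D, 1 ≤ D ∧ ∀ ρ ρ', 0 < ρ → ρ ≤ ρ' → ρ' ≤ 2 * ρ → Λ ρ' ≤ D * Λ ρ ∧ Λ ρ ≤ D * Λ ρ' := by
  obtain ⟨D, hD, h⟩ := LamC h0 h1 hΛ
  have e0 : (1:ℝ) ≤ 2 ^ σ₀ := Real.one_le_rpow (by norm_num) h0.le
  have e1 : (1:ℝ) ≤ 2 ^ (-σ₁) := Real.one_le_rpow (by norm_num) (by linarith)
  have hD0 : 0 < D := by linarith
  refine ⟨D * D * (2 ^ σ₀ * 2 ^ (-σ₁)), by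
    have := one_le_mul_of_one_le_of_one_le (one_le_mul_of_one_le_of_one_le hD hD) (one_le_mul_of_one_le_of_one_le e0 e1)
    exact this, fun ρ ρ' hρ hle hle2 => ?_⟩
  have hρ' : 0 < ρ' := by linarith
  have hL := hΛ.2.1 ρ hρ
  have hL' := hΛ.2.1 ρ' hρ'
  have k1 : mm σ₀ σ₁ ρ' ≤ 2 ^ σ₀ * mm σ₀ σ₁ ρ := by
    unfold mm
    rw [mul_min_of_nonneg _ _ (by positivity)]
    refine min_le_min ?_ ?_
    · rw [← Real.mul_rpow (by norm_num) hρ.le]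
      exact Real.rpow_le_rpow hρ'.le hle2 h0.le
    · calc ρ' ^ σ₁ ≤ ρ ^ σ₁ := Real.rpow_le_rpow_of_nonpos hρ hle h1.le
        _ ≤ _ := le_mul_of_one_le_left (by positivity) e0
  have k2 : mm σ₀ σ₁ ρ ≤ 2 ^ (-σ₁) * mm σ₀ σ₁ ρ' := by
    unfold mm
    rw [mul_min_of_nonneg _ _ (by positivity)]
    refine min_le_min ?_ ?_
    · calc ρ ^ σ₀ ≤ ρ' ^ σ₀ := Real.rpow_le_rpow hρ.le hle h0.le
        _ ≤ _ := le_mul_of_one_le_left (by positivity) e1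
    · rw [Real.rpow_neg (by norm_num), ← div_eq_inv_mul, le_div_iff₀ (by positivity), mul_comm, ← Real.mul_rpow (by norm_num) hρ.le]
      exact Real.rpow_le_rpow_of_nonpos hρ' hle2 h1.le
  constructor
  · calc Λ ρ' ≤ D * (2 ^ σ₀ * (D * Λ ρ)) := (h ρ' hρ').1.trans (by gcongr; exact k1.trans (by gcongr; exact (h ρ hρ).2))
      _ = D * D * (2 ^ σ₀ * 1) * Λ ρ := by ring
      _ ≤ _ := by gcongr
  · calc Λ ρ ≤ D * (2 ^ (-σ₁) * (D * Λ ρ')) := (h ρ hρ).1.trans (by gcongr; exact k2.trans (by gcongr; exact (h ρ' hρ').2))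
      _ = D * D * (1 * 2 ^ (-σ₁)) * Λ ρ' := by ring
      _ ≤ _ := by gcongr

theorem mm_le {a b s r : ℝ} (hr : 0 < r) (hs : s ≤ a) (hb : b ≤ s) : mm a b r ≤ r ^ s := by
  rcases le_total r 1 with h | h
  · exact (min_le_left _ _).trans (Real.rpow_le_rpow_of_exponent_ge hr h hs)
  · exact (min_le_right _ _).trans (Real.rpow_le_rpow_of_exponent_le h hb)

theorem small {p₀ p₁ σ₀ σ₁ lam₁ δ : ℝ} (hp1 : p₁ < 0) (hp0 : 0 < p₀) (hσ₀ : p₀ ≤ σ₀) (hσ₁ : σ₁ ≤ p₁) {Λ : ℝ → ℝ} (hΛ : CondC σ₀ σ₁ lam₁ Λ)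
    (hδ0 : δ + σ₀ / 2 < 1/2) {ε : ℝ} (hε : 0 < ε) : ∃ t₀ : ℝ, 1 ≤ t₀ ∧ ∀ τ, t₀ < τ → ∀ ρ, 0 < ρ →
    τ ^ ((1:ℝ)/2 + δ) * Λ (τ ^ ((1:ℝ)/2) * ρ) ≤ ε * (τ * mm p₀ p₁ ρ) := by
  obtain ⟨D, hD, h⟩ := LamC (by linarith) (by linarith) hΛ
  have hlim := tendsto_rpow_neg_atTop (y := 1/2 - (δ + σ₀ / 2)) (by linarith)
  obtain ⟨t1, ht1⟩ := eventually_atTop.1 (hlim.eventually (gt_mem_nhds (show 0 < ε / D by positivity)))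
  refine ⟨max 1 t1, le_max_left _ _, fun τ hτ ρ hρ => ?_⟩
  have hτ1 : 1 < τ := (le_max_left _ _).trans_lt hτ
  have hτ0 : 0 < τ := by linarith
  have hsm := ht1 τ ((le_max_right _ _).trans hτ.le)
  have hr : 0 < τ ^ ((1:ℝ)/2) * ρ := by positivity
  have key : ∀ s, s ≤ σ₀ → σ₁ ≤ s → τ ^ ((1:ℝ)/2 + δ) * Λ (τ ^ ((1:ℝ)/2) * ρ) ≤ ε * (τ * ρ ^ s) := by
    intro s h1 h2
    have e1 : τ ^ ((1:ℝ)/2 + δ) * τ ^ (s / 2) ≤ τ * τ ^ (-(1/2 - (δ + σ₀ / 2))) := by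
      rw [← Real.rpow_add hτ0]
      nth_rw 2 [← Real.rpow_one τ]
      rw [← Real.rpow_add hτ0]
      exact Real.rpow_le_rpow_of_exponent_le hτ1.le (by linarith)
    have e2 : (τ ^ ((1:ℝ)/2) * ρ) ^ s = τ ^ (s / 2) * ρ ^ s := by
      rw [Real.mul_rpow (by positivity) hρ.le, ← Real.rpow_mul hτ0.le]; congr 2; ring
    calc τ ^ ((1:ℝ)/2 + δ) * Λ (τ ^ ((1:ℝ)/2) * ρ) ≤ τ ^ ((1:ℝ)/2 + δ) * (D * (τ ^ (s / 2) * ρ ^ s)) := by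
          gcongr
          refine (h _ hr).1.trans ?_
          rw [← e2]
          gcongr
          exact mm_le hr h1 h2
      _ = D * ρ ^ s * (τ ^ ((1:ℝ)/2 + δ) * τ ^ (s / 2)) := by ring
      _ ≤ D * ρ ^ s * (τ * (ε / D)) := mul_le_mul_of_nonneg_left (e1.trans (mul_le_mul_of_nonneg_left hsm.le hτ0.le)) (by positivity)
      _ = _ := by field_simp
  unfold mm
  rw [mul_min_of_nonneg _ _ hτ0.le, mul_min_of_nonneg _ _ hε.le]
  exact le_min (key p₀ hσ₀ (by linarith)) (key p₁ (by linarith) hσ₁)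

open Classical in
theorem bucket (B : ℝ) : ∃ N : ℕ, ∀ E : ℝ → Prop, (∀ ρ ρ', 0 < ρ → 0 < ρ' → E ρ → E ρ' → ρ ≤ B * ρ') → ∀ J : Finset ℤ,
    (J.filter (fun k => ∃ ρ : ℝ, (2:ℝ) ^ k ≤ ρ ∧ ρ < (2:ℝ) ^ (k + 1) ∧ E ρ)).card ≤ N := by
  obtain ⟨n, hn⟩ := pow_unbounded_of_one_lt B (by norm_num : (1:ℝ) < 2)
  refine ⟨n + 2, fun E hE J => ?_⟩
  set S := J.filter (fun k => ∃ ρ : ℝ, (2:ℝ) ^ k ≤ ρ ∧ ρ < (2:ℝ) ^ (k + 1) ∧ E ρ) with hS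
  rcases S.eq_empty_or_nonempty with h | h
  · rw [h]; simp
  set m := S.min' h with hm
  have hmS : m ∈ S := S.min'_mem h
  have hsub : S ⊆ Finset.Icc m (m + (n + 1)) := by
    intro k hk
    rw [Finset.mem_Icc]
    refine ⟨S.min'_le k hk, ?_⟩
    obtain ⟨_, ρ, h1, h2, h3⟩ := Finset.mem_filter.1 hk
    obtain ⟨_, ρ', h1', h2', h3'⟩ := Finset.mem_filter.1 hmS
    have r0 : 0 < ρ := (by positivity : (0:ℝ) < 2 ^ k).trans_le h1
    have r0' : 0 < ρ' := (by positivity : (0:ℝ) < 2 ^ m).trans_le h1'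
    have h4 := hE ρ ρ' r0 r0' h3 h3'
    have h5 : (2:ℝ) ^ k < 2 ^ ((n : ℤ) + (m + 1)) := by
      rw [zpow_add₀ (by norm_num), zpow_natCast]
      calc (2:ℝ) ^ k ≤ B * ρ' := h1.trans h4
        _ ≤ 2 ^ n * ρ' := by gcongr
        _ < _ := by gcongr
    have := (zpow_lt_zpow_iff_right₀ (by norm_num : (1:ℝ) < 2)).1 h5
    linarith
  refine (Finset.card_le_card hsub).trans ?_
  rw [Int.card_Icc]; omega

theorem rpow_cmp {a B ρ ρ' : ℝ} (h : 0 < ρ) (h' : 0 < ρ') (hB : 1 ≤ B) (ha : a ≠ 0) (h1 : ρ ^ a ≤ B * ρ' ^ a) (h2 : ρ' ^ a ≤ B * ρ ^ a) :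
    ρ ≤ B ^ |a|⁻¹ * ρ' := by
  have hB0 : 0 < B := by linarith
  have key : ρ ^ |a| ≤ B * ρ' ^ |a| := by
    rcases ha.lt_or_gt with h0 | h0
    · rw [abs_of_neg h0, Real.rpow_neg h.le, Real.rpow_neg h'.le]
      rw [← div_eq_mul_inv, le_div_iff₀ (by positivity), inv_mul_le_iff₀ (by positivity)]
      linarith
    · rwa [abs_of_pos h0]
  have hp : 0 < |a| := abs_pos.2 ha
  have := Real.rpow_le_rpow (by positivity) key (inv_nonneg.2 hp.le)
  rwa [← Real.rpow_mul h.le, mul_inv_cancel₀ hp.ne', Real.rpow_one, Real.mul_rpow hB0.le (by positivity), ← Real.rpow_mul h'.le, mul_inv_cancel₀ hp.ne', Real.rpow_one] at this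

theorem near_cmp {X v L c C r r' v' : ℝ} (hc : 0 < c) (hC : 0 < C) (hr : 0 < r) (hr' : 0 < r') (h1 : c * r ≤ |v - L|) (h2 : |v' - L| ≤ C * r')
    (h3 : |X - v| ≤ c / 2 * r) (h4 : |X - v'| ≤ c / 2 * r') : r ≤ (2 * C / c + 1) * r' := by
  have a1 : |v - L| ≤ |X - v| + |X - v'| + |v' - L| := by
    have := abs_add_le (-(X - v)) (X - v')
    have h5 := abs_add_le (-(X - v) + (X - v')) (v' - L)
    rw [abs_neg] at this
    rw [show -(X - v) + (X - v') + (v' - L) = v - L by ring] at h5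
    linarith
  have : c / 2 * r ≤ (C + c / 2) * r' := by linarith
  rw [show (2 * C / c + 1) * r' = (C + c / 2) * r' / (c / 2) by field_simp, le_div_iff₀ (by positivity)]
  linarith

open Classical in
theorem ovl {p₀ p₁ P₀ P₁ : ℝ} (hp1 : p₁ < 0) (hp0 : 0 < p₀) {P : ℝ → ℝ} (hP : HypH p₀ p₁ P₀ P₁ P) :
    ∃ ε, 0 < ε ∧ ∃ M : ℕ, ∀ (X : ℝ) (J : Finset ℤ), ∃ S ⊆ J, S.card ≤ M ∧ ∀ k ∈ J, k ∉ S → ∀ ρ : ℝ, (2:ℝ) ^ k ≤ ρ → ρ < (2:ℝ) ^ (k + 1) →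
      ¬ |X - deriv P ρ| ≤ ε * mm p₀ p₁ ρ := by
  obtain ⟨_, hpos, _, ⟨c0, C0, r0, hc0, hcC0, hr0, h0⟩, ⟨c1, C1, r1, hc1, hcC1, h1⟩, _⟩ := hP
  obtain ⟨N0, hN0⟩ := bucket ((2 * C0 / c0 + 1) ^ |p₀|⁻¹)
  obtain ⟨N1, hN1⟩ := bucket ((2 * C1 / c1 + 1) ^ |p₁|⁻¹)
  obtain ⟨N2, hN2⟩ := bucket (max r1 1 / r0)
  set ε := min (c0 / 2) (c1 / 2) with hε
  have hε0 : 0 < ε := lt_min (by linarith) (by linarith)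
  have hC0 : 0 < C0 := by linarith
  have hC1 : 0 < C1 := by linarith
  refine ⟨ε, hε0, N0 + N1 + N2, fun X J => ?_⟩
  set E : ℝ → Prop := fun ρ => |X - deriv P ρ| ≤ ε * mm p₀ p₁ ρ with hE
  set S0 := J.filter (fun k => ∃ ρ : ℝ, (2:ℝ) ^ k ≤ ρ ∧ ρ < (2:ℝ) ^ (k + 1) ∧ (E ρ ∧ ρ < r0)) with hS0
  set S1 := J.filter (fun k => ∃ ρ : ℝ, (2:ℝ) ^ k ≤ ρ ∧ ρ < (2:ℝ) ^ (k + 1) ∧ (E ρ ∧ r1 < ρ)) with hS1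
  set S2 := J.filter (fun k => ∃ ρ : ℝ, (2:ℝ) ^ k ≤ ρ ∧ ρ < (2:ℝ) ^ (k + 1) ∧ (r0 ≤ ρ ∧ ρ ≤ r1)) with hS2
  have b0 : S0.card ≤ N0 := by
    refine hN0 _ (fun ρ ρ' hρ hρ' e e' => ?_) J
    have z1 : |X - deriv P ρ| ≤ c0 / 2 * ρ ^ p₀ := e.1.trans (mul_le_mul (min_le_left _ _) (min_le_left _ _) (mm_pos hρ).le (by positivity))
    have z2 : |X - deriv P ρ'| ≤ c0 / 2 * ρ' ^ p₀ := e'.1.trans (mul_le_mul (min_le_left _ _) (min_le_left _ _) (mm_pos hρ').le (by positivity))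
    have y1 := (h0 ρ hρ e.2).1
    have y2 := (h0 ρ' hρ' e'.2).1
    exact rpow_cmp hρ hρ' (by rw [le_add_iff_nonneg_left]; positivity) hp0.ne' (near_cmp hc0 hC0 (by positivity) (by positivity) y1.1 y2.2 z1 z2) (near_cmp hc0 hC0 (by positivity) (by positivity) y2.1 y1.2 z2 z1)
  have b1 : S1.card ≤ N1 := by
    refine hN1 _ (fun ρ ρ' hρ hρ' e e' => ?_) J
    have z1 : |X - deriv P ρ| ≤ c1 / 2 * ρ ^ p₁ := e.1.trans (mul_le_mul (min_le_right _ _) (min_le_right _ _) (mm_pos hρ).le (by positivity))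
    have z2 : |X - deriv P ρ'| ≤ c1 / 2 * ρ' ^ p₁ := e'.1.trans (mul_le_mul (min_le_right _ _) (min_le_right _ _) (mm_pos hρ').le (by positivity))
    have y1 := (h1 ρ e.2).1
    have y2 := (h1 ρ' e'.2).1
    exact rpow_cmp hρ hρ' (by rw [le_add_iff_nonneg_left]; positivity) hp1.ne (near_cmp hc1 hC1 (by positivity) (by positivity) y1.1 y2.2 z1 z2) (near_cmp hc1 hC1 (by positivity) (by positivity) y2.1 y1.2 z2 z1)
  have b2 : S2.card ≤ N2 := by
    refine hN2 _ (fun ρ ρ' hρ hρ' e e' => ?_) J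
    rw [div_mul_eq_mul_div, le_div_iff₀ hr0]
    exact mul_le_mul (e.2.trans (le_max_left _ _)) e'.1 hr0.le (by positivity)
  refine ⟨S0 ∪ S1 ∪ S2, ?_, ?_, ?_⟩
  · exact Finset.union_subset (Finset.union_subset (Finset.filter_subset _ _) (Finset.filter_subset _ _)) (Finset.filter_subset _ _)
  · have := Finset.card_union_le (S0 ∪ S1) S2
    have := Finset.card_union_le S0 S1
    omega
  · intro k hk hkS ρ l1 l2 hEρ
    apply hkS
    rcases lt_or_ge ρ r0 with g | g
    · exact Finset.mem_union_left _ (Finset.mem_union_left _ (Finset.mem_filter.2 ⟨hk, ρ, l1, l2, hEρ, g⟩))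
    rcases lt_or_ge r1 ρ with g' | g'
    · exact Finset.mem_union_left _ (Finset.mem_union_right _ (Finset.mem_filter.2 ⟨hk, ρ, l1, l2, hEρ, g'⟩))
    · exact Finset.mem_union_right _ (Finset.mem_filter.2 ⟨hk, ρ, l1, l2, g, g'⟩)

theorem VV_scale {d : ℕ} {k k' : Euc d → Euc d → ℂ} {F : Euc d → ℂ} {R : ℝ} (hR : 0 < R)
    (h : ∀ x ξ, F ξ ≠ 0 → k x ξ = k' (R⁻¹ • x) (R • ξ)) {C : ℝ≥0∞}
    (hC : n2 (VV k' fun η => F (R⁻¹ • η)) ≤ C * n2 (fun η => F (R⁻¹ • η))) : n2 (VV k F) ≤ C * n2 F := by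
  have e : VV k F = fun x => (((R⁻¹) ^ d : ℝ) : ℂ) * VV k' (fun η => F (R⁻¹ • η)) (R⁻¹ • x) := by
    funext x
    have := Measure.integral_comp_smul (volume : Measure (Euc d)) (fun ξ => Complex.exp (Complex.I * ((⟪x, ξ⟫ : ℝ) : ℂ)) * (k' (R⁻¹ • x) (R • ξ) * F ξ)) R⁻¹
    rw [finrank_euclideanSpace_fin, abs_of_pos (by positivity)] at this
    have e2 : VV k F x = ∫ ξ, Complex.exp (Complex.I * ((⟪x, ξ⟫ : ℝ) : ℂ)) * (k' (R⁻¹ • x) (R • ξ) * F ξ) := by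
      unfold VV
      refine integral_congr_ae (ae_of_all _ fun ξ => ?_)
      simp only
      by_cases hf : F ξ = 0
      · rw [hf]; ring
      · rw [h x ξ hf]
    rw [e2, eq_inv_smul_iff₀ (by positivity), Complex.real_smul] at *
    rw [← this]
    unfold VV
    congr 1
    refine integral_congr_ae (ae_of_all _ fun ξ => ?_)
    simp only
    rw [smul_inv_smul₀ hR.ne', real_inner_smul_left, real_inner_smul_right]
  have n1 : ∀ G : Euc d → ℂ, n2 (fun x => G (R⁻¹ • x)) = ENNReal.ofReal (|(R⁻¹) ^ d|⁻¹) * n2 G := fun G =>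
    lint_smul (fun x => ‖G x‖ₑ ^ 2) (inv_ne_zero hR.ne')
  rw [e, n2_cmul, n1 (VV k' _)]
  rw [n1] at hC
  have hp : 0 < R⁻¹ ^ d := by positivity
  rw [Complex.norm_real, Real.norm_of_nonneg hp.le]
  rw [abs_of_pos hp] at hC ⊢
  calc _ ≤ ENNReal.ofReal ((R⁻¹ ^ d) ^ 2) * (ENNReal.ofReal ((R⁻¹ ^ d)⁻¹) * (C * (ENNReal.ofReal ((R⁻¹ ^ d)⁻¹) * n2 F))) := by gcongr
    _ = (ENNReal.ofReal ((R⁻¹ ^ d) ^ 2) * ENNReal.ofReal ((R⁻¹ ^ d)⁻¹) * ENNReal.ofReal ((R⁻¹ ^ d)⁻¹)) * (C * n2 F) := by ring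
    _ = C * n2 F := by
      rw [← ENNReal.ofReal_mul (by positivity), ← ENNReal.ofReal_mul (by positivity), show (R⁻¹ ^ d) ^ 2 * (R⁻¹ ^ d)⁻¹ * (R⁻¹ ^ d)⁻¹ = 1 by field_simp]
      simp

def sy {d : ℕ} (P Λ : ℝ → ℝ) (χ : Euc d → ℂ) (δ t : ℝ) (x ξ : Euc d) : ℂ :=
  χ ((|t| ^ ((1:ℝ)/2 + δ) * Λ (|t| ^ ((1:ℝ)/2) * ‖ξ‖))⁻¹ • (x + t • Pgrad P ξ)) *
            (if |t| * ‖Pgrad P ξ‖ < ‖x‖ then (1:ℂ) else 0)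

theorem Pg_norm {d : ℕ} {P : ℝ → ℝ} {ξ : Euc d} (hξ : 0 < ‖ξ‖) (h : 0 < deriv P ‖ξ‖) : ‖Pgrad P ξ‖ = deriv P ‖ξ‖ := by
  unfold Pgrad
  rw [norm_smul, Real.norm_of_nonneg (by positivity), div_mul_cancel₀ _ hξ.ne']

theorem blk {d : ℕ} (hd : 1 ≤ d) {p₀ p₁ : ℝ} (hp₁0 : p₁ < 0) (hp₀0 : 0 < p₀)
    {P₀ P₁ : ℝ} (hP₀ : 0 ≤ P₀) (hP₁ : 0 ≤ P₁) {P : ℝ → ℝ} (hP : HypH p₀ p₁ P₀ P₁ P)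
    {σ₀ σ₁ lam₁ : ℝ} (hσ₀ : p₀ ≤ σ₀) (hσ₁ : σ₁ ≤ p₁) {Λ : ℝ → ℝ} (hΛ : CondC σ₀ σ₁ lam₁ Λ)
    {χ : Euc d → ℂ} (hχsm : ContDiff ℝ (⊤ : ℕ∞) χ) (hχc : HasCompactSupport χ)
    {δ : ℝ} (hδ0 : δ + σ₀ / 2 < 1/2) : ∃ C t₀ : ℝ, 0 ≤ C ∧ 1 ≤ t₀ ∧ ∀ t : ℝ, t₀ < |t| → ∀ a : ℝ, 0 < a → ∀ F, BB F →
      (∀ ξ, F ξ ≠ 0 → a ≤ ‖ξ‖ ∧ ‖ξ‖ ≤ 2 * a) → n2 (VV (sy P Λ χ δ t) F) ≤ ENNReal.ofReal C * n2 F := by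
  obtain ⟨hcont, D, hD, hdbl⟩ := dblP hp₁0 hp₀0 hP₀ hP₁ hP
  obtain ⟨D', hD', hdbl'⟩ := Lam_dbl (by linarith) (by linarith) hΛ
  obtain ⟨M, Rχ, hRχ, hM, hR⟩ := chi_bd hχsm hχc
  set A : ℝ := max D (D' * D') with hA
  have hA1 : 1 ≤ A := hD.trans (le_max_left _ _)
  obtain ⟨C, hC, hSB⟩ := SB hd hχsm hχc hR hA1
  have hA0 : 0 < A := by linarith
  have hD0 : 0 < D := by linarith
  have hD'0 : 0 < D' := by linarith
  clear_value A
  set ε : ℝ := 1 / (25 * ((Rχ + 1) * A * (D * D))) with hε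
  have hε0 : 0 < ε := by positivity
  obtain ⟨t₀, ht₀, hsm⟩ := small hp₁0 hp₀0 hσ₀ hσ₁ hΛ hδ0 hε0
  refine ⟨C, t₀, hC, ht₀, fun t ht a ha F hF hFs => ?_⟩
  have hpos := hP.2.1
  have hLpos := hΛ.2.1
  obtain ⟨τ, hτ⟩ : ∃ τ, τ = |t| := ⟨_, rfl⟩
  rw [← hτ] at ht
  have hτ0 : 0 < τ := by linarith
  have h2a : 0 < 2 * a := by linarith
  obtain ⟨mn, hmn⟩ : ∃ mn, mn = min (deriv P a) (deriv P (2 * a)) := ⟨_, rfl⟩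
  have hmn0 : 0 < mn := by rw [hmn]; exact lt_min (hpos a ha) (hpos _ h2a)
  have hmx : max (deriv P a) (deriv P (2 * a)) ≤ D * mn := by
    rw [hmn, mul_min_of_nonneg _ _ hD0.le]
    have := hdbl a ha
    refine max_le (le_min ?_ this.2.1) (le_min this.1 ?_)
    · exact le_mul_of_one_le_left (hpos a ha).le hD
    · exact le_mul_of_one_le_left (hpos _ h2a).le hD
  -- clamp
  obtain ⟨cl, hcl⟩ : ∃ cl : ℝ → ℝ, ∀ u, cl u = max a (min u (2 * a)) := ⟨_, fun _ => rfl⟩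
  have hcl1 : ∀ u, a ≤ cl u := fun u => by rw [hcl]; exact le_max_left _ _
  have hcl2 : ∀ u, cl u ≤ 2 * a := fun u => by rw [hcl]; exact max_le (by linarith) (min_le_right _ _)
  have hcl0 : ∀ u, 0 < cl u := fun u => ha.trans_le (hcl1 u)
  have hclm : Monotone cl := fun u v h => by rw [hcl, hcl]; exact max_le_max le_rfl (min_le_min h le_rfl)
  have hclc : Continuous cl := by rw [show cl = fun u => max a (min u (2 * a)) from funext hcl]; fun_prop
  have hcle : ∀ u, a ≤ u → u ≤ 2 * a → cl u = u := fun u h1 h2 => by rw [hcl, min_eq_left h2, max_eq_right h1]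
  have hpb : ∀ u, mn ≤ deriv P (cl u) ∧ deriv P (cl u) ≤ D * mn := by
    intro u
    rcases hP.2.2.1 with hm | hm
    · have k1 := hm (show a ∈ Set.Ioi 0 from ha) (hcl0 u) (hcl1 u)
      have k2 := hm (hcl0 u) (show 2 * a ∈ Set.Ioi 0 from h2a) (hcl2 u)
      exact ⟨(hmn ▸ min_le_left _ _ : mn ≤ deriv P a).trans k1, (k2.trans (le_max_right _ _)).trans hmx⟩
    · have k1 := hm (show a ∈ Set.Ioi 0 from ha) (hcl0 u) (hcl1 u)
      have k2 := hm (hcl0 u) (show 2 * a ∈ Set.Ioi 0 from h2a) (hcl2 u)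
      exact ⟨(hmn ▸ min_le_right _ _ : mn ≤ deriv P (2 * a)).trans k2, (k1.trans (le_max_left _ _)).trans hmx⟩
  obtain ⟨R, hRd⟩ : ∃ R, R = τ * mn := ⟨_, rfl⟩
  have hR0 : 0 < R := by rw [hRd]; positivity
  obtain ⟨T, hT⟩ : ∃ T, T = τ ^ ((1:ℝ)/2 + δ) := ⟨_, rfl⟩
  have hT0 : 0 < T := by rw [hT]; positivity
  obtain ⟨h, hh⟩ : ∃ h, h = τ ^ ((1:ℝ)/2) := ⟨_, rfl⟩
  have hh0 : 0 < h := by rw [hh]; positivity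
  have hmono : Monotone fun u => cl (u / R) := fun u v g => hclm (by gcongr)
  obtain ⟨Q, hQ⟩ : ∃ Q : ℝ → ℝ, ∀ u, Q u = τ / R * deriv P (cl (u / R)) := ⟨_, fun _ => rfl⟩
  obtain ⟨w, hw⟩ : ∃ w : ℝ → ℝ, ∀ u, w u = T / R * Λ (h * cl (u / R)) := ⟨_, fun _ => rfl⟩
  obtain ⟨W, hW⟩ : ∃ W, W = T / R * Λ (h * a) / D' := ⟨_, rfl⟩
  have hτR : 0 < τ / R := by positivity
  have hTR : 0 < T / R := by positivity
  have hLa : 0 < Λ (h * a) := hLpos _ (by positivity)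
  have hW0 : 0 < W := by rw [hW]; positivity
  have hQm : Monotone Q ∨ Antitone Q := by
    rcases hP.2.2.1 with hm | hm
    · left; intro u v g; rw [hQ, hQ]
      exact mul_le_mul_of_nonneg_left (hm (hcl0 _) (hcl0 _) (hmono g)) hτR.le
    · right; intro u v g; rw [hQ, hQ]
      exact mul_le_mul_of_nonneg_left (hm (hcl0 _) (hcl0 _) (hmono g)) hτR.le
  have hτm : τ / R = mn⁻¹ := by rw [hRd]; field_simp
  have hQb : ∀ u, 1 ≤ Q u ∧ Q u ≤ A := by
    intro u
    rw [hQ, hτm, le_inv_mul_iff₀ hmn0, inv_mul_le_iff₀ hmn0, mul_one]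
    refine ⟨(hpb _).1, (hpb _).2.trans ?_⟩
    rw [mul_comm]
    exact mul_le_mul_of_nonneg_left (hA ▸ le_max_left _ _) hmn0.le
  have hwm : Measurable w := by
    rw [show w = fun u => T / R * Λ (h * cl (u / R)) from funext hw]
    have : Continuous fun u => Λ (h * cl (u / R)) :=
      hΛ.1.continuousOn.comp_continuous (continuous_const.mul (hclc.comp (by fun_prop))) fun u => mul_pos hh0 (hcl0 _)
    exact (continuous_const.mul this).measurable
  have hwb : ∀ u, W ≤ w u ∧ w u ≤ A * W := by
    intro u
    have k := hdbl' (h * a) (h * cl (u / R)) (by positivity) (by gcongr; exact hcl1 _) (by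
      calc h * cl (u / R) ≤ h * (2 * a) := by gcongr; exact hcl2 _
        _ = _ := by ring)
    rw [hw, hW]
    constructor
    · rw [div_le_iff₀ hD'0, mul_assoc]
      refine mul_le_mul_of_nonneg_left ?_ hTR.le
      linarith [k.2]
    · calc T / R * Λ (h * cl (u / R)) ≤ T / R * (D' * Λ (h * a)) := mul_le_mul_of_nonneg_left k.1 hTR.le
        _ = (D' * D') * (T / R * Λ (h * a) / D') := by field_simp
        _ ≤ _ := by
          refine mul_le_mul_of_nonneg_right (hA ▸ le_max_right _ _) ?_
          rw [← hW]; exact hW0.le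
  have hWs : Rχ * (A * W) ≤ 1/25 := by
    have k1 : T * Λ (h * a) ≤ ε * (τ * (D * (D * mn))) := by
      rw [hT, hh]
      refine (hsm τ ht a ha).trans ?_
      gcongr
      refine (hdbl a ha).2.2.trans ?_
      gcongr
      exact (le_max_left _ _).trans hmx
    have k2 : W ≤ ε * (D * D) := by
      rw [hW, div_le_iff₀ hD'0]
      calc T / R * Λ (h * a) = T * Λ (h * a) / R := by ring
        _ ≤ ε * (τ * (D * (D * mn))) / R := by gcongr
        _ = ε * (D * D) := by rw [hRd]; field_simp
        _ ≤ _ := le_mul_of_one_le_right (by positivity) hD'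
    calc Rχ * (A * W) ≤ (Rχ + 1) * (A * (ε * (D * D))) := by gcongr; linarith
      _ = 1/25 := by rw [hε]; field_simp
  obtain ⟨s, hs⟩ : ∃ s, s = t / τ := ⟨_, rfl⟩
  have hs1 : |s| = 1 := by rw [hs, abs_div, ← hτ, abs_of_pos hτ0, div_self hτ0.ne']
  have hst : s * τ = t := by rw [hs]; field_simp
  refine VV_scale (k' := kS χ Q w s) hR0 ?_ (hSB Q w W s hQm hQb hwm hW0 hwb hWs hs1 _ ?_ ?_)
  · intro x ξ hξ
    obtain ⟨l1, l2⟩ := hFs ξ hξ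
    have hξ0 : 0 < ‖ξ‖ := by linarith
    have hn : ‖R • ξ‖ = R * ‖ξ‖ := by rw [norm_smul, Real.norm_of_nonneg hR0.le]
    have hc : cl (‖R • ξ‖ / R) = ‖ξ‖ := by rw [hn, mul_div_cancel_left₀ _ hR0.ne', hcle _ l1 l2]
    unfold sy kS
    rw [hQ, hw, hc, hn, Pg_norm hξ0 (hpos _ hξ0), ← hτ, ← hT, ← hh]
    congr 1
    · have hL := hLpos (h * ‖ξ‖) (by positivity)
      congr 1
      rw [← hst]
      unfold Pgrad
      simp only [smul_add, smul_smul]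
      congr 2 <;> field_simp
    · rw [norm_smul, norm_inv, Real.norm_of_nonneg hR0.le]
      congr 1
      rw [lt_inv_mul_iff₀ hR0, ← mul_assoc, mul_div_cancel₀ _ hR0.ne']
  · obtain ⟨hm, M, R', hb⟩ := hF
    refine ⟨hm.comp (measurable_const_smul _), M, R * R', fun ξ => ⟨(hb _).1, fun hx => (hb _).2 ?_⟩⟩
    rw [norm_smul, norm_inv, Real.norm_of_nonneg hR0.le, lt_inv_mul_iff₀ hR0]
    exact hx
  · rw [smul_zero]
    by_contra h0
    have := (hFs 0 h0).1
    rw [norm_zero] at this; linarith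

theorem sy_le {d : ℕ} {P Λ : ℝ → ℝ} {χ : Euc d → ℂ} {M δ t : ℝ} (hM : ∀ u, ‖χ u‖ ≤ M) (x ξ : Euc d) : ‖sy P Λ χ δ t x ξ‖ ≤ M := by
  have := (norm_nonneg _).trans (hM 0)
  unfold sy; split_ifs
  · rw [mul_one]; exact hM _
  · simpa using this

theorem sy_rep {d : ℕ} (hd : 1 ≤ d) {P Λ : ℝ → ℝ} (hΛ : ContinuousOn Λ (Set.Ioi 0)) {χ : Euc d → ℂ} (hχ : Continuous χ) {M : ℝ} (hM : ∀ u, ‖χ u‖ ≤ M) {δ t : ℝ} (ht : 0 < |t|) :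
    ∃ k : Euc d → Euc d → ℂ, Measurable (Function.uncurry k) ∧ (∀ x ξ, ‖k x ξ‖ ≤ M) ∧ ∀ F, VV (sy P Λ χ δ t) F = VV k F := by
  classical
  haveI : Nonempty (Fin d) := ⟨⟨0, hd⟩⟩
  set Λ' : ℝ → ℝ := (Set.Ioi 0).piecewise Λ (fun _ => 1) with hΛ'
  have hm : Measurable Λ' := hΛ.measurable_piecewise continuousOn_const measurableSet_Ioi
  refine ⟨sy P Λ' χ δ t, ?_, sy_le hM, fun F => ?_⟩
  · have h2 : Measurable fun p : Euc d × Euc d => ‖p.2‖ := by fun_prop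
    have h3 : Measurable fun p : Euc d × Euc d => Pgrad P p.2 := by
      unfold Pgrad
      exact (((measurable_deriv P).comp h2).div h2).smul measurable_snd
    unfold sy Function.uncurry
    refine (hχ.measurable.comp (((hm.comp (h2.const_mul _)).const_mul _).inv.smul (measurable_fst.add (h3.const_smul t)))).mul ?_
    exact Measurable.ite (measurableSet_lt (h3.norm.const_mul _) (by fun_prop)) measurable_const measurable_const
  · funext x
    unfold VV
    refine integral_congr_ae ?_
    have : ∀ᵐ ξ : Euc d, ξ ≠ 0 := by
      rw [ae_iff]; simp
    filter_upwards [this] with ξ hξ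
    have hp : 0 < |t| ^ ((1:ℝ)/2) * ‖ξ‖ := by have := norm_pos_iff.2 hξ; positivity
    unfold sy
    rw [hΛ', Set.piecewise_eq_of_mem _ _ _ (show |t| ^ ((1:ℝ)/2) * ‖ξ‖ ∈ Set.Ioi 0 from hp)]

def shl (d : ℕ) (k : ℤ) : Set (Euc d) := {ξ | (2:ℝ) ^ k ≤ ‖ξ‖} ∩ {ξ | ‖ξ‖ < (2:ℝ) ^ (k + 1)}

theorem shl_meas (d : ℕ) (k : ℤ) : MeasurableSet (shl d k) :=
  (measurableSet_le (by fun_prop) (by fun_prop)).inter (measurableSet_lt (by fun_prop) (by fun_prop))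

theorem shl_uniq {d : ℕ} {i j : ℤ} {x : Euc d} (h1 : x ∈ shl d i) (h2 : x ∈ shl d j) : i = j := by
  have a := (zpow_lt_zpow_iff_right₀ (by norm_num : (1:ℝ) < 2)).1 (lt_of_le_of_lt h1.1 h2.2)
  have b := (zpow_lt_zpow_iff_right₀ (by norm_num : (1:ℝ) < 2)).1 (lt_of_le_of_lt h2.1 h1.2)
  omega

theorem ann {d : ℕ} (hd : 1 ≤ d) {p₀ p₁ : ℝ} (hp₁0 : p₁ < 0) (hp₀0 : 0 < p₀)
    {P₀ P₁ : ℝ} (hP₀ : 0 ≤ P₀) (hP₁ : 0 ≤ P₁) {P : ℝ → ℝ} (hP : HypH p₀ p₁ P₀ P₁ P)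
    {σ₀ σ₁ lam₁ : ℝ} (hσ₀ : p₀ ≤ σ₀) (hσ₁ : σ₁ ≤ p₁) {Λ : ℝ → ℝ} (hΛ : CondC σ₀ σ₁ lam₁ Λ)
    {χ : Euc d → ℂ} (hχsm : ContDiff ℝ (⊤ : ℕ∞) χ) (hχc : HasCompactSupport χ)
    {δ : ℝ} (hδ0 : δ + σ₀ / 2 < 1/2) : ∃ C t₀ : ℝ, 0 ≤ C ∧ 1 ≤ t₀ ∧ ∀ t : ℝ, t₀ < |t| → ∀ (n : ℕ) F, BB F →
      (∀ ξ, F ξ ≠ 0 → (2:ℝ) ^ (-(n:ℤ)) ≤ ‖ξ‖ ∧ ‖ξ‖ < (2:ℝ) ^ (n:ℤ)) → n2 (VV (sy P Λ χ δ t) F) ≤ ENNReal.ofReal C * n2 F := by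
  classical
  obtain ⟨C, t1, hC, ht1, hblk⟩ := blk hd hp₁0 hp₀0 hP₀ hP₁ hP hσ₀ hσ₁ hΛ hχsm hχc hδ0
  obtain ⟨M, Rχ, hRχ, hM, hR⟩ := chi_bd hχsm hχc
  obtain ⟨ε, hε, N, hov⟩ := ovl hp₁0 hp₀0 hP
  obtain ⟨t2, ht2, hsm⟩ := small hp₁0 hp₀0 hσ₀ hσ₁ hΛ hδ0 (show 0 < ε / (Rχ + 1) by positivity)
  refine ⟨N * C, max t1 t2, by positivity, ht1.trans (le_max_left _ _), fun t ht n F hF hFs => ?_⟩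
  have hta := (le_max_left _ _).trans_lt ht
  have htb := (le_max_right _ _).trans_lt ht
  have ht0 : 0 < |t| := by linarith
  obtain ⟨k, hkm, hkM, hkV⟩ := sy_rep hd (P := P) (δ := δ) hΛ.1.continuousOn hχsm.continuous hM ht0
  set J : Finset ℤ := Finset.Ico (-(n:ℤ)) n with hJ
  have hFk : ∀ j, BB ((shl d j).indicator F) := fun j => hF.ind (shl_meas d j)
  have hsum : ∀ ξ, F ξ = ∑ j ∈ J, (shl d j).indicator F ξ := by
    intro ξ
    by_cases h0 : F ξ = 0
    · rw [h0, Finset.sum_eq_zero]; intro j _; rw [Set.indicator_apply, h0, ite_self]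
    obtain ⟨l1, l2⟩ := hFs ξ h0
    have hp : 0 < ‖ξ‖ := lt_of_lt_of_le (by positivity) l1
    obtain ⟨i, hi1, hi2⟩ := exists_mem_Ico_zpow hp (by norm_num : (1:ℝ) < 2)
    have a := (zpow_lt_zpow_iff_right₀ (by norm_num : (1:ℝ) < 2)).1 (lt_of_le_of_lt l1 hi2)
    have b := (zpow_lt_zpow_iff_right₀ (by norm_num : (1:ℝ) < 2)).1 (lt_of_le_of_lt hi1 l2)
    have hiJ : i ∈ J := Finset.mem_Ico.2 ⟨by omega, b⟩
    have hmem : ξ ∈ shl d i := ⟨hi1, hi2⟩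
    rw [Finset.sum_eq_single_of_mem i hiJ, Set.indicator_of_mem hmem]
    intro j _ hj
    exact Set.indicator_of_notMem (fun h => hj (shl_uniq h hmem)) _
  have hV : VV (sy P Λ χ δ t) F = fun y => ∑ j ∈ J, VV k ((shl d j).indicator F) y := by
    funext y
    rw [hkV, VV_sum J (k := fun _ => k) (fun _ => hkm) (fun j => (hFk j).integrable) y (fun _ => hkM y)]
    unfold VV
    refine integral_congr_ae (ae_of_all _ fun ξ => ?_)
    simp only
    rw [← Finset.mul_sum, ← hsum]
  rw [hV]
  refine (n2_sum_ov J _ (fun j _ => VV_meas hkm (hFk j).1) N fun x => ?_).trans ?_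
  · obtain ⟨S, hS1, hS2, hS3⟩ := hov (‖x‖ / |t|) J
    refine ⟨S, hS1, hS2, fun j hj hjS => ?_⟩
    rw [← hkV]
    unfold VV
    refine integral_eq_zero_of_ae (ae_of_all _ fun ξ => ?_)
    simp only [Pi.zero_apply]
    by_cases hm : ξ ∈ shl d j
    · have hρ : 0 < ‖ξ‖ := lt_of_lt_of_le (by positivity) (show (2:ℝ) ^ j ≤ ‖ξ‖ from hm.1)
      have hns := hS3 j hj hjS ‖ξ‖ hm.1 hm.2
      have hpp := hP.2.1 _ hρ
      have hz : sy P Λ χ δ t x ξ = 0 := by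
        unfold sy
        by_contra hne
        have hx := hR _ (left_ne_zero_of_mul hne)
        apply hns
        have hL := hΛ.2.1 (|t| ^ ((1:ℝ)/2) * ‖ξ‖) (by positivity)
        have hTL : 0 < |t| ^ ((1:ℝ)/2 + δ) * Λ (|t| ^ ((1:ℝ)/2) * ‖ξ‖) := by positivity
        rw [norm_smul, norm_inv, Real.norm_of_nonneg hTL.le, inv_mul_le_iff₀ hTL] at hx
        have h1 := hsm |t| htb ‖ξ‖ hρ
        have hmm := mm_pos (a := p₀) (b := p₁) hρ
        have h2 : ‖x + t • Pgrad P ξ‖ ≤ ε * (|t| * mm p₀ p₁ ‖ξ‖) := by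
          calc _ ≤ _ := hx
            _ ≤ ε / (Rχ + 1) * (|t| * mm p₀ p₁ ‖ξ‖) * (Rχ + 1) := by gcongr; linarith
            _ = _ := by field_simp
        have h3 : |‖x‖ - |t| * deriv P ‖ξ‖| ≤ ‖x + t • Pgrad P ξ‖ := by
          have := abs_norm_sub_norm_le x (-(t • Pgrad P ξ))
          rw [sub_neg_eq_add, norm_neg, norm_smul, Real.norm_eq_abs, Pg_norm hρ hpp] at this
          exact this
        have h4 : ‖x‖ / |t| - deriv P ‖ξ‖ = (‖x‖ - |t| * deriv P ‖ξ‖) / |t| := by field_simp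
        rw [h4, abs_div, abs_abs, div_le_iff₀ ht0]
        linarith
      rw [hz]; ring
    · rw [Set.indicator_of_notMem hm]; ring
  · rw [ENNReal.ofReal_mul (by positivity), ENNReal.ofReal_natCast, mul_assoc]
    gcongr
    refine le_trans ?_ (mul_le_mul_right (n2_parts J F hF.1 (shl d) (shl_meas d) fun i j x => shl_uniq) _)
    rw [Finset.mul_sum]
    refine Finset.sum_le_sum fun j _ => ?_
    rw [← hkV]
    refine hblk t hta ((2:ℝ) ^ j) (by positivity) _ (hFk j) fun ξ hξ => ?_
    have hm := Set.mem_of_indicator_ne_zero hξ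
    refine ⟨hm.1, (le_of_lt hm.2).trans (le_of_eq ?_)⟩
    rw [zpow_add₀ (by norm_num), zpow_one, mul_comm]

open scoped FourierTransform in
theorem FT_props {d : ℕ} (f : SchwartzMap (Euc d) ℂ) : Continuous (FT f) ∧ Integrable (FT f) ∧ (∃ M, ∀ ξ, ‖FT f ξ‖ ≤ M) ∧
    n2 (FT f) = ENNReal.ofReal ((2 * Real.pi) ^ d) * n2 f := by
  have hpi := Real.pi_pos
  have e1 : ∀ ξ, FT f ξ = UU f ((-1:ℝ) • ξ) := by
    intro ξ
    unfold FT UU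
    refine integral_congr_ae (ae_of_all _ fun x => ?_)
    simp only
    rw [real_inner_smul_left, real_inner_comm]; push_cast; ring_nf
  obtain ⟨T, hT⟩ : ∃ T : SchwartzMap (Euc d) ℂ, T = 𝓕 f := ⟨_, rfl⟩
  have e2 : FT f = fun ξ => T ((2 * Real.pi)⁻¹ • ξ) := by
    funext ξ
    rw [e1, UU_eq, hT, SchwartzMap.fourier_coe, smul_smul]; simp
  refine ⟨?_, ?_, ?_, ?_⟩
  · rw [e2]; exact T.continuous.comp (by fun_prop)
  · rw [e2]; exact T.integrable.comp_smul (by positivity)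
  · rw [e2]
    exact ⟨SchwartzMap.seminorm ℝ 0 0 T, fun ξ => T.norm_le_seminorm ℝ _⟩
  · rw [← UU_planch' f.integrable (f.memLp 2), show FT f = fun ξ => UU f ((-1:ℝ) • ξ) from funext e1]
    have := lint_smul (fun x => ‖UU f x‖ₑ ^ 2) (c := -1) (by norm_num)
    unfold n2
    rw [this]
    simp

theorem full {d : ℕ} (hd : 1 ≤ d) {k : Euc d → Euc d → ℂ} (hkm : Measurable (Function.uncurry k)) {M : ℝ} (hkM : ∀ x ξ, ‖k x ξ‖ ≤ M) {C : ℝ≥0∞}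
    (h : ∀ (n : ℕ) F, BB F → (∀ ξ, F ξ ≠ 0 → (2:ℝ) ^ (-(n:ℤ)) ≤ ‖ξ‖ ∧ ‖ξ‖ < (2:ℝ) ^ (n:ℤ)) → n2 (VV k F) ≤ C * n2 F)
    {F : Euc d → ℂ} (hFc : Continuous F) (hFi : Integrable F) (hFb : ∃ B, ∀ ξ, ‖F ξ‖ ≤ B) : n2 (VV k F) ≤ C * n2 F := by
  haveI : Nonempty (Fin d) := ⟨⟨0, hd⟩⟩
  obtain ⟨B, hB⟩ := hFb
  set s : ℕ → Set (Euc d) := fun n => {ξ | (2:ℝ) ^ (-(n:ℤ)) ≤ ‖ξ‖} ∩ {ξ | ‖ξ‖ < (2:ℝ) ^ (n:ℤ)} with hs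
  have hsm : ∀ n, MeasurableSet (s n) := fun n => (measurableSet_le (by fun_prop) (by fun_prop)).inter (measurableSet_lt (by fun_prop) (by fun_prop))
  have hBB : ∀ n, BB ((s n).indicator F) := fun n => ⟨hFc.measurable.indicator (hsm n), B, (2:ℝ) ^ (n:ℤ), fun ξ =>
    ⟨(norm_indicator_le_norm_self _ _).trans (hB ξ), fun hx => Set.indicator_of_notMem (fun hm => absurd hm.2 (not_lt.2 hx.le)) _⟩⟩
  have hn : ∀ n, n2 (VV k ((s n).indicator F)) ≤ C * n2 F := by
    intro n
    have h1 := h n _ (hBB n) (fun ξ hξ => by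
      have hm : ξ ∈ s n := Set.mem_of_indicator_ne_zero hξ
      exact ⟨hm.1, hm.2⟩)
    refine h1.trans ?_
    gcongr
    exact n2_mono fun ξ => norm_indicator_le_norm_self _ _
  have hlim : ∀ y, Tendsto (fun n => VV k ((s n).indicator F) y) atTop (𝓝 (VV k F y)) := by
    intro y
    unfold VV
    refine tendsto_integral_of_dominated_convergence (fun ξ => M * ‖F ξ‖) (fun n => (VV_int hkm (hBB n).integrable y (hkM y)).aestronglyMeasurable) (hFi.norm.const_mul M) (fun n => ae_of_all _ fun ξ => ?_) ?_
    · rw [norm_mul, mul_comm Complex.I, Complex.norm_exp_ofReal_mul_I, one_mul, norm_mul]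
      exact mul_le_mul (hkM _ _) (norm_indicator_le_norm_self _ _) (norm_nonneg _) ((norm_nonneg _).trans (hkM 0 0))
    · have : ∀ᵐ ξ : Euc d, ξ ≠ 0 := by
        rw [ae_iff]; simp
      filter_upwards [this] with ξ hξ
      have hp := norm_pos_iff.2 hξ
      refine tendsto_const_nhds.congr' ?_
      have ht := tendsto_pow_atTop_atTop_of_one_lt (by norm_num : (1:ℝ) < 2)
      filter_upwards [ht.eventually_gt_atTop ‖ξ‖, ht.eventually_gt_atTop ‖ξ‖⁻¹] with n h1 h2
      rw [Set.indicator_of_mem]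
      refine ⟨?_, ?_⟩
      · show (2:ℝ) ^ (-(n:ℤ)) ≤ ‖ξ‖
        rw [zpow_neg, zpow_natCast]
        exact (inv_lt_of_inv_lt₀ hp h2).le
      · show ‖ξ‖ < (2:ℝ) ^ (n:ℤ)
        rw [zpow_natCast]; exact h1
  have hl2 : ∀ y, liminf (fun n => ‖VV k ((s n).indicator F) y‖ₑ ^ 2) atTop = ‖VV k F y‖ₑ ^ 2 := fun y =>
    ((ENNReal.continuous_pow 2).tendsto _ |>.comp ((hlim y).enorm)).liminf_eq
  calc n2 (VV k F) = ∫⁻ y, liminf (fun n => ‖VV k ((s n).indicator F) y‖ₑ ^ 2) atTop := by unfold n2; simp only [hl2]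
    _ ≤ liminf (fun n => n2 (VV k ((s n).indicator F))) atTop := lintegral_liminf_le fun n => (VV_meas hkm (hBB n).1).enorm.pow_const 2
    _ ≤ liminf (fun _ : ℕ => C * n2 F) atTop := liminf_le_liminf (Eventually.of_forall hn)
    _ = _ := liminf_const _

/-- Proposition 3.1: the alternative truncated symbol
`a^{alt}_{χ,δ,Λ}(t,x,ξ) = χ((x+tP'(ξ))/(|t|^{1/2+δ}Λ(|t|^{1/2}ξ))) 1_{|x| > |t||P'(ξ)|}`
yields an operator bounded on `L²` uniformly for `|t| > t₀ ≫ 1`. -/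
theorem statement12
    (d : ℕ) (hd : 1 ≤ d) (p₀ p₁ : ℝ) (hp₁0 : p₁ < 0) (hp₀0 : 0 < p₀)
    (P₀ P₁ : ℝ) (hP₀ : 0 ≤ P₀) (hP₁ : 0 ≤ P₁)
    (P : ℝ → ℝ) (hP : HypH p₀ p₁ P₀ P₁ P)
    (σ₀ σ₁ lam₁ : ℝ) (hσ₀ : p₀ ≤ σ₀) (hσ₁ : σ₁ ≤ p₁) (hlam₁ : 0 < lam₁)
    (Λ : ℝ → ℝ) (hΛ : CondC σ₀ σ₁ lam₁ Λ)
    (χ : Euc d → ℂ) (hχsm : ContDiff ℝ (⊤ : ℕ∞) χ) (hχc : HasCompactSupport χ)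
    (δ : ℝ) (hδ0 : δ + σ₀ / 2 < 1/2) (hδ1 : δ + σ₁ / 2 < 1/2) :
    ∃ C t₀ : ℝ, 0 < C ∧ 1 ≤ t₀ ∧ ∀ t : ℝ, t₀ < |t| → ∀ f : SchwartzMap (Euc d) ℂ,
      eLpNorm
        (OpS (fun x ξ =>
          χ ((|t| ^ ((1:ℝ)/2 + δ) * Λ (|t| ^ ((1:ℝ)/2) * ‖ξ‖))⁻¹ • (x + t • Pgrad P ξ)) *
            (if |t| * ‖Pgrad P ξ‖ < ‖x‖ then (1:ℂ) else 0)) ⇑f) 2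
        (volume : Measure (Euc d))
      ≤ ENNReal.ofReal C * eLpNorm (⇑f) 2 (volume : Measure (Euc d)) := by
  obtain ⟨C, t₀, hC, ht₀, h⟩ := ann hd hp₁0 hp₀0 hP₀ hP₁ hP hσ₀ hσ₁ hΛ hχsm hχc hδ0
  obtain ⟨M, _, _, hM, _⟩ := chi_bd hχsm hχc
  have hpi := Real.pi_pos
  have hpd : 0 < (2 * Real.pi) ^ d := by positivity
  set E : ℝ := (((2 * Real.pi) ^ d)⁻¹) ^ 2 * (C * (2 * Real.pi) ^ d) + 1 with hE
  have hE0 : 0 < E := by positivity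
  refine ⟨Real.sqrt E, t₀, Real.sqrt_pos.2 hE0, ht₀, fun t ht f => ?_⟩
  obtain ⟨k, hkm, hkM, hkV⟩ := sy_rep hd (P := P) (δ := δ) hΛ.1.continuousOn hχsm.continuous hM (show 0 < |t| by linarith)
  obtain ⟨f1, f2, f3, f4⟩ := FT_props f
  have hmain := full hd hkm hkM (fun n F hF hFs => by rw [← hkV]; exact h t ht n F hF hFs) f1 f2 f3
  rw [← hkV, f4] at hmain
  have hop : OpS (sy P Λ χ δ t) f = fun x => ((((2 * Real.pi) ^ d : ℝ)⁻¹ : ℝ) : ℂ) * VV (sy P Λ χ δ t) (FT f) x := by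
    funext x
    unfold OpS VV
    rw [Complex.ofReal_inv]
    congr 1
    refine integral_congr_ae (ae_of_all _ fun ξ => ?_)
    simp only; ring
  have hn : n2 (OpS (sy P Λ χ δ t) f) ≤ ENNReal.ofReal E * n2 f := by
    rw [hop, n2_cmul, Complex.norm_real, Real.norm_of_nonneg (inv_nonneg.2 hpd.le)]
    calc _ ≤ ENNReal.ofReal ((((2 * Real.pi) ^ d)⁻¹) ^ 2) * (ENNReal.ofReal C * (ENNReal.ofReal ((2 * Real.pi) ^ d) * n2 f)) := by gcongr
      _ = ENNReal.ofReal ((((2 * Real.pi) ^ d)⁻¹) ^ 2 * (C * (2 * Real.pi) ^ d)) * n2 f := by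
        rw [ENNReal.ofReal_mul (by positivity), ENNReal.ofReal_mul hC]; ring
      _ ≤ _ := by gcongr; rw [hE]; linarith
  show eLpNorm (OpS (sy P Λ χ δ t) f) 2 volume ≤ _
  rw [n2_eq, n2_eq, ← Real.sq_sqrt hE0.le, ENNReal.ofReal_pow (Real.sqrt_nonneg _), ← mul_pow] at hn
  exact (ENNReal.pow_le_pow_left_iff (by norm_num)).1 hn
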